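/- Let V be a MOSVA and W a V-bimodule, both satisfying the pole-order condition, and let w ∈ W be a vacuum-like vector (w ∈ W_{[0]} and D_W w = 0). Define δ̂⁰(w) : V → W̃_z by [(δ̂⁰(w))(v)](z) = E(Y_W^L(v,z)w − Y_W^{s(R)}(v,z)w). Then δ̂⁰(w) ∈ Ĉ¹_∞(V,W), and δ̂¹(δ̂⁰(w)) = 0, where δ̂¹ is the coboundary operator on 1-cochains. -/

import Mathlib

set_option autoImplicit false
set_option maxHeartbeats 1000000

open scoped BigOperators

noncomputable section

namespace VA

/-- Absolute convergence of a series of complex numbers indexed by `ι` to the sum `s`. -/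
def AbsConvTo {ι : Type*} (f : ι → ℂ) (s : ℂ) : Prop :=
  Summable (fun i => ‖f i‖) ∧ HasSum f s

/-- The configuration-space condition: the entries of `z` are pairwise distinct. -/
def Conf {ι : Type*} (z : ι → ℂ) : Prop := ∀ i j : ι, i ≠ j → z i ≠ z j

/-- `‖z 0‖ > ‖z 1‖ > ⋯ > ‖z (n-1)‖`. -/
def Ordered {n : ℕ} (z : Fin n → ℂ) : Prop := ∀ i j : Fin n, i < j → ‖z j‖ < ‖z i‖

/-- `‖z 0‖ > ‖z 1‖ > ⋯ > ‖z (n-1)‖ > 0`. -/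
def OrderedPos {n : ℕ} (z : Fin n → ℂ) : Prop := Ordered z ∧ ∀ i, 0 < ‖z i‖

/-- A rational function in the variables `z i`, `i : ι`, whose only possible poles are
at `z i = 0` and on the diagonals `z i = z j` (`i ≠ j`); it is recorded as a numerator
polynomial together with the orders of the poles. -/
structure RatFn (ι : Type*) [Fintype ι] [DecidableEq ι] where
  num : MvPolynomial ι ℂ
  a : ι → ℕ
  b : ι → ι → ℕ

def RatFn.eval {ι : Type*} [Fintype ι] [DecidableEq ι] (R : RatFn ι) (z : ι → ℂ) : ℂ :=
  MvPolynomial.eval z R.num /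
    ((∏ i, z i ^ R.a i) * ∏ q ∈ Finset.univ.offDiag, (z q.1 - z q.2) ^ R.b q.1 q.2)

/-- A rational function in the variables `z i`, `i : ι`, whose only possible poles are
on the diagonals `z i = z j` (`i ≠ j`). -/
structure DiagRatFn (ι : Type*) [Fintype ι] [DecidableEq ι] where
  num : MvPolynomial ι ℂ
  b : ι → ι → ℕ

def DiagRatFn.eval {ι : Type*} [Fintype ι] [DecidableEq ι] (R : DiagRatFn ι) (z : ι → ℂ) : ℂ :=
  MvPolynomial.eval z R.num / ∏ q ∈ Finset.univ.offDiag, (z q.1 - z q.2) ^ R.b q.1 q.2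

/-- A linear functional belongs to the graded dual iff its restriction to all but
finitely many homogeneous components vanishes. -/
def InGradedDual {ι : Type*} {M : Type*} [AddCommGroup M] [Module ℂ M]
    (proj : ι → M →ₗ[ℂ] M) (φ : M →ₗ[ℂ] ℂ) : Prop :=
  (Function.support fun i => φ ∘ₗ proj i).Finite

/-- Iterated application: `compApply n f w = f 0 (f 1 (⋯ (f (n-1) w)))`. -/
def compApply {M : Type*} : (n : ℕ) → (Fin n → (M → M)) → M → M
  | 0, _, w => w
  | n+1, f, w => f 0 (compApply n (fun i => f i.succ) w)

section Graded

variable (W : Type*) [AddCommGroup W] [Module ℂ W]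

/-- A `ℂ`-grading of `W`, recorded via the projections onto the homogeneous
subspaces, whose weights have lower-bounded real parts. -/
structure CGrading where
  proj : ℂ → W →ₗ[ℂ] W
  proj_comp : ∀ m n : ℂ, proj m ∘ₗ proj n = if m = n then proj n else 0
  proj_finite : ∀ w : W, (Function.support fun n => proj n w).Finite
  proj_sum : ∀ w : W, (∑ᶠ n : ℂ, proj n w) = w
  lower_bound : ∃ B : ℝ, ∀ n : ℂ, n.re < B → proj n = 0

/-- A `ℤ`-grading of `V` with lower-bounded weights. -/
structure ZGrading where
  proj : ℤ → W →ₗ[ℂ] W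
  proj_comp : ∀ m n : ℤ, proj m ∘ₗ proj n = if m = n then proj n else 0
  proj_finite : ∀ w : W, (Function.support fun n => proj n w).Finite
  proj_sum : ∀ w : W, (∑ᶠ n : ℤ, proj n w) = w
  lower_bound : ∃ B : ℤ, ∀ n : ℤ, n < B → proj n = 0

variable {W}

/-- The grading operator `d` of a `ℂ`-graded space. -/
def CGrading.d (G : CGrading W) (w : W) : W := ∑ᶠ n : ℂ, n • G.proj n w

/-- The grading operator `d` of a `ℤ`-graded space. -/
def ZGrading.d (G : ZGrading W) (v : W) : W := ∑ᶠ n : ℤ, (n : ℂ) • G.proj n v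

/-- The operator `z^d` on a `ℤ`-graded space. -/
def ZGrading.zd (G : ZGrading W) (z : ℂ) (v : W) : W := ∑ᶠ n : ℤ, (z ^ n) • G.proj n v

/-- The algebraic completion `∏ₙ W_[n]`, realized as the submodule of functions
`ℂ → W` recording a homogeneous component in each weight. -/
def CGrading.compSub (G : CGrading W) : Submodule ℂ (ℂ → W) where
  carrier := {f | ∀ n, G.proj n (f n) = f n}
  add_mem' := by
    intro a b ha hb n
    simp only [Pi.add_apply, map_add, ha n, hb n]
  zero_mem' := by
    intro n
    simp
  smul_mem' := by
    intro c f hf n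
    simp only [Pi.smul_apply, map_smul, hf n]

/-- The algebraic completion of a graded space. -/
abbrev CGrading.Comp (G : CGrading W) : Type _ := ↥G.compSub

/-- The pairing between the graded dual and the algebraic completion. -/
def CGrading.pair (G : CGrading W) (φ : W →ₗ[ℂ] ℂ) (f : G.Comp) : ℂ :=
  ∑ᶠ n : ℂ, φ (f.1 n)

/-- The embedding of `W` into its algebraic completion. -/
def CGrading.emb (G : CGrading W) (w : W) : G.Comp :=
  ⟨fun n => G.proj n w, by
    intro n
    have h := congrArg (fun T : W →ₗ[ℂ] W => T w) (G.proj_comp n n)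
    simpa using h⟩

/-- The componentwise extension of an operator on `W` to the algebraic completion. -/
def CGrading.ext (G : CGrading W) (L : W → W) (f : G.Comp) : G.Comp :=
  ⟨fun m => ∑ᶠ n : ℂ, G.proj m (L (f.1 n)), by
    intro m
    show G.proj m (∑ᶠ n : ℂ, G.proj m (L (f.1 n))) = ∑ᶠ n : ℂ, G.proj m (L (f.1 n))
    by_cases h : (Function.support fun n => G.proj m (L (f.1 n))).Finite
    · have h1 := AddMonoidHom.map_finsum (G.proj m).toAddMonoidHom h
      simp only [LinearMap.toAddMonoidHom_coe] at h1
      rw [h1]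
      refine finsum_congr fun n => ?_
      have h2 := congrArg (fun T : W →ₗ[ℂ] W => T (L (f.1 n))) (G.proj_comp m m)
      simpa using h2
    · rw [finsum_of_infinite_support h]
      simp⟩

/-- The operator `z^d` on the algebraic completion, acting on the component of
weight `n` by `z ^ n` (complex power). -/
def CGrading.zd (G : CGrading W) (z : ℂ) (f : G.Comp) : G.Comp :=
  ⟨fun n => (z ^ n) • f.1 n, by
    intro n
    rw [map_smul, f.2 n]⟩

end Graded


section VOA

/-- A meromorphic open-string vertex algebra (MOSVA): a lower-bounded `ℤ`-graded
space with a vertex operator map (recorded through its coefficients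
`Y u v k = (Y_V)_k(u)v`, the coefficient of `x^{-k-1}` in `Y_V(u,x)v`) and a
vacuum, satisfying the grading, vacuum, `D`-derivative/commutator, rationality and
associativity axioms. -/
structure MOSVA (V : Type*) [AddCommGroup V] [Module ℂ V] where
  gr : ZGrading V
  Y : V →ₗ[ℂ] V →ₗ[ℂ] (ℤ → V)
  vac : V
  /-- lower truncation of vertex operators -/
  trunc : ∀ u v : V, ∃ N : ℤ, ∀ k : ℤ, N ≤ k → Y u v k = 0
  /-- identity property `Y(𝟏,x) = 1` -/
  identity : ∀ (v : V) (k : ℤ), Y vac v k = if k = -1 then v else 0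
  /-- creation property: `Y(u,x)𝟏 ∈ V[[x]]` and `lim_{x→0} Y(u,x)𝟏 = u` -/
  creation : ∀ (u : V) (k : ℤ), 0 ≤ k → Y u vac k = 0
  creation_lim : ∀ u : V, Y u vac (-1) = u
  /-- the `d`-commutator formula, written in terms of coefficients -/
  d_comm : ∀ (u v : V) (k : ℤ),
    gr.d (Y u v k) = Y (gr.d u) v k + (-(k : ℂ) - 1) • Y u v k + Y u (gr.d v) k
  /-- the `D`-derivative property (`D_V u = (Y_V)_{-2}(u)𝟏`) -/
  D_deriv : ∀ (u v : V) (k : ℤ),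
    Y (Y u vac (-2)) v k = (-(k : ℂ)) • Y u v (k - 1)
  /-- the `D`-commutator formula -/
  D_comm : ∀ (u v : V) (k : ℤ),
    Y (Y u v k) vac (-2) - Y u (Y v vac (-2)) k = (-(k : ℂ)) • Y u v (k - 1)
  /-- rationality of products: matrix coefficients of products of vertex operators
  converge absolutely in the ordered region to rational functions with the only
  possible poles at `z i = 0` and `z i = z j` -/
  rationality : ∀ (n : ℕ) (u : Fin n → V) (v : V) (φ : V →ₗ[ℂ] ℂ),
    InGradedDual gr.proj φ → ∃ R : RatFn (Fin n), ∀ z : Fin n → ℂ, OrderedPos z →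
      AbsConvTo (fun k : Fin n → ℤ =>
          φ (compApply n (fun i x => Y (u i) x (k i)) v) * ∏ i, z i ^ (-(k i) - 1))
        (R.eval z)
  /-- rationality of iterates and associativity: products and iterates converge to a
  common rational function -/
  associativity : ∀ (u₁ u₂ v : V) (φ : V →ₗ[ℂ] ℂ), InGradedDual gr.proj φ →
    ∃ R : RatFn (Fin 2),
      (∀ z₁ z₂ : ℂ, ‖z₂‖ < ‖z₁‖ → 0 < ‖z₂‖ →
        AbsConvTo (fun k : ℤ × ℤ =>
            φ (Y u₁ (Y u₂ v k.2) k.1) * z₁ ^ (-k.1 - 1) * z₂ ^ (-k.2 - 1))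
          (R.eval ![z₁, z₂])) ∧
      (∀ z₁ z₂ : ℂ, ‖z₁ - z₂‖ < ‖z₂‖ → 0 < ‖z₁ - z₂‖ →
        AbsConvTo (fun k : ℤ × ℤ =>
            φ (Y (Y u₁ u₂ k.1) v k.2) * (z₁ - z₂) ^ (-k.1 - 1) * z₂ ^ (-k.2 - 1))
          (R.eval ![z₁, z₂]))

variable {V : Type*} [AddCommGroup V] [Module ℂ V]

/-- The operator `D_V`. -/
def MOSVA.D (A : MOSVA V) (v : V) : V := A.Y v A.vac (-2)

/-- The pole-order condition for a MOSVA. -/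
def MOSVA.PoleOrder (A : MOSVA V) : Prop :=
  ∀ u₁ v : V, ∃ C : ℕ, ∀ φ : V →ₗ[ℂ] ℂ, InGradedDual A.gr.proj φ → ∀ u₂ : V,
    ∃ R : RatFn (Fin 2), R.a 0 ≤ C ∧
      ∀ z₁ z₂ : ℂ, ‖z₂‖ < ‖z₁‖ → 0 < ‖z₂‖ →
        AbsConvTo (fun k : ℤ × ℤ =>
            φ (A.Y u₁ (A.Y u₂ v k.2) k.1) * z₁ ^ (-k.1 - 1) * z₂ ^ (-k.2 - 1))
          (R.eval ![z₁, z₂])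

/-- A bimodule for a MOSVA: a `ℂ`-graded space with left and right vertex operator
maps (recorded through their coefficients), satisfying the left module, right module
and compatibility axioms. -/
structure Bimod (A : MOSVA V) (W : Type*) [AddCommGroup W] [Module ℂ W] where
  gr : CGrading W
  YL : V →ₗ[ℂ] W →ₗ[ℂ] (ℤ → W)
  YR : W →ₗ[ℂ] V →ₗ[ℂ] (ℤ → W)
  DW : W →ₗ[ℂ] W
  /-- `D_W` has weight one -/
  DW_wt : ∀ n : ℂ, DW ∘ₗ gr.proj n = gr.proj (n + 1) ∘ₗ DW ∘ₗ gr.proj n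
  truncL : ∀ (u : V) (w : W), ∃ N : ℤ, ∀ k : ℤ, N ≤ k → YL u w k = 0
  truncR : ∀ (w : W) (u : V), ∃ N : ℤ, ∀ k : ℤ, N ≤ k → YR w u k = 0
  identityL : ∀ (w : W) (k : ℤ), YL A.vac w k = if k = -1 then w else 0
  creationR : ∀ (w : W) (k : ℤ), 0 ≤ k → YR w A.vac k = 0
  creationR_lim : ∀ w : W, YR w A.vac (-1) = w
  d_commL : ∀ (u : V) (w : W) (k : ℤ),
    gr.d (YL u w k) = YL (A.gr.d u) w k + (-(k : ℂ) - 1) • YL u w k + YL u (gr.d w) k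
  d_commR : ∀ (w : W) (u : V) (k : ℤ),
    gr.d (YR w u k) = YR (gr.d w) u k + (-(k : ℂ) - 1) • YR w u k + YR w (A.gr.d u) k
  D_derivL : ∀ (u : V) (w : W) (k : ℤ),
    YL (A.D u) w k = (-(k : ℂ)) • YL u w (k - 1)
  D_commL : ∀ (u : V) (w : W) (k : ℤ),
    DW (YL u w k) - YL u (DW w) k = (-(k : ℂ)) • YL u w (k - 1)
  D_derivR : ∀ (w : W) (u : V) (k : ℤ),
    YR (DW w) u k = (-(k : ℂ)) • YR w u (k - 1)
  D_commR : ∀ (w : W) (u : V) (k : ℤ),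
    DW (YR w u k) - YR w (A.D u) k = (-(k : ℂ)) • YR w u (k - 1)
  /-- rationality for products of left vertex operators -/
  rationalityL : ∀ (n : ℕ) (u : Fin n → V) (w : W) (φ : W →ₗ[ℂ] ℂ),
    InGradedDual gr.proj φ → ∃ R : RatFn (Fin n), ∀ z : Fin n → ℂ, OrderedPos z →
      AbsConvTo (fun k : Fin n → ℤ =>
          φ (compApply n (fun i x => YL (u i) x (k i)) w) * ∏ i, z i ^ (-(k i) - 1))
        (R.eval z)
  /-- rationality of iterates and associativity for the left vertex operator map -/
  associativityL : ∀ (u₁ u₂ : V) (w : W) (φ : W →ₗ[ℂ] ℂ), InGradedDual gr.proj φ →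
    ∃ R : RatFn (Fin 2),
      (∀ z₁ z₂ : ℂ, ‖z₂‖ < ‖z₁‖ → 0 < ‖z₂‖ →
        AbsConvTo (fun k : ℤ × ℤ =>
            φ (YL u₁ (YL u₂ w k.2) k.1) * z₁ ^ (-k.1 - 1) * z₂ ^ (-k.2 - 1))
          (R.eval ![z₁, z₂])) ∧
      (∀ z₁ z₂ : ℂ, ‖z₁ - z₂‖ < ‖z₂‖ → 0 < ‖z₁ - z₂‖ →
        AbsConvTo (fun k : ℤ × ℤ =>
            φ (YL (A.Y u₁ u₂ k.1) w k.2) * (z₁ - z₂) ^ (-k.1 - 1) * z₂ ^ (-k.2 - 1))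
          (R.eval ![z₁, z₂]))
  /-- rationality for products `Y_W^R(w,z₁)Y_V(u₁,z₂)⋯Y_V(u_{n-1},z_n)u_n` -/
  rationalityR : ∀ (n : ℕ) (w : W) (v : Fin (n+1) → V) (φ : W →ₗ[ℂ] ℂ),
    InGradedDual gr.proj φ → ∃ R : RatFn (Fin (n+1)),
      ∀ z : Fin (n+1) → ℂ, OrderedPos z →
        AbsConvTo (fun k : Fin (n+1) → ℤ =>
            φ (YR w (compApply n (fun i x => A.Y (v i.castSucc) x (k i.succ))
                (v (Fin.last n))) (k 0)) * ∏ i, z i ^ (-(k i) - 1))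
          (R.eval z)
  /-- rationality of iterates and associativity for the right vertex operator map -/
  associativityR : ∀ (w : W) (u₁ u₂ : V) (φ : W →ₗ[ℂ] ℂ), InGradedDual gr.proj φ →
    ∃ R : RatFn (Fin 2),
      (∀ z₁ z₂ : ℂ, ‖z₂‖ < ‖z₁‖ → 0 < ‖z₂‖ →
        AbsConvTo (fun k : ℤ × ℤ =>
            φ (YR w (A.Y u₁ u₂ k.2) k.1) * z₁ ^ (-k.1 - 1) * z₂ ^ (-k.2 - 1))
          (R.eval ![z₁, z₂])) ∧
      (∀ z₁ z₂ : ℂ, ‖z₁ - z₂‖ < ‖z₂‖ → 0 < ‖z₁ - z₂‖ →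
        AbsConvTo (fun k : ℤ × ℤ =>
            φ (YR (YR w u₁ k.1) u₂ k.2) * (z₁ - z₂) ^ (-k.1 - 1) * z₂ ^ (-k.2 - 1))
          (R.eval ![z₁, z₂]))
  /-- compatibility: rationality of mixed products
  `Y_W^L(u₁,z₁)⋯Y_W^L(u_p,z_p)Y_W^R(w,z₀)Y_V(v₁,⋅)⋯Y_V(v_{q},⋅)v_{q+1}` -/
  compatRat : ∀ (p q : ℕ) (u : Fin p → V) (w : W) (v : Fin (q+1) → V)
      (φ : W →ₗ[ℂ] ℂ), InGradedDual gr.proj φ →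
    ∃ R : RatFn (Fin p ⊕ Fin (q+1)),
      ∀ (zL : Fin p → ℂ) (z0 : ℂ) (zR : Fin q → ℂ),
        Ordered zL → (∀ i, ‖z0‖ < ‖zL i‖) → (∀ j, ‖zR j‖ < ‖z0‖) → Ordered zR →
        0 < ‖z0‖ → (∀ j, 0 < ‖zR j‖) →
        AbsConvTo (fun K : (Fin p → ℤ) × ℤ × (Fin q → ℤ) =>
            φ (compApply p (fun i x => YL (u i) x (K.1 i))
                (YR w (compApply q (fun j x => A.Y (v j.castSucc) x (K.2.2 j))
                  (v (Fin.last q))) K.2.1))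
              * (∏ i, zL i ^ (-(K.1 i) - 1)) * z0 ^ (-K.2.1 - 1)
              * ∏ j, zR j ^ (-(K.2.2 j) - 1))
          (R.eval (Sum.elim zL (Fin.cons z0 zR)))
  /-- compatibility: associativity for the left and right vertex operator maps -/
  compatAssoc : ∀ (u v : V) (w : W) (φ : W →ₗ[ℂ] ℂ), InGradedDual gr.proj φ →
    ∃ R : RatFn (Fin 2),
      (∀ z₁ z₂ : ℂ, ‖z₂‖ < ‖z₁‖ → 0 < ‖z₂‖ →
        AbsConvTo (fun k : ℤ × ℤ =>
            φ (YL u (YR w v k.2) k.1) * z₁ ^ (-k.1 - 1) * z₂ ^ (-k.2 - 1))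
          (R.eval ![z₁, z₂])) ∧
      (∀ z₁ z₂ : ℂ, ‖z₁ - z₂‖ < ‖z₂‖ → 0 < ‖z₁ - z₂‖ →
        AbsConvTo (fun k : ℤ × ℤ =>
            φ (YR (YL u w k.1) v k.2) * (z₁ - z₂) ^ (-k.1 - 1) * z₂ ^ (-k.2 - 1))
          (R.eval ![z₁, z₂]))

variable {W : Type*} [AddCommGroup W] [Module ℂ W] {A : MOSVA V}

/-- The opposite right vertex operator map
`Y_W^{s(R)}(v,x)w = e^{xD_W}Y_W^R(w,-x)v`, through its coefficients. -/
def Bimod.YsR (B : Bimod A W) (v : V) (w : W) (k : ℤ) : W :=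
  ∑ᶠ m : ℕ, (((-1 : ℂ) ^ (k + (m : ℤ) + 1)) * ((m.factorial : ℂ))⁻¹) •
    ((B.DW ^ m) (B.YR w v (k + (m : ℤ))))

/-- The pole-order condition for a bimodule over a MOSVA. -/
def Bimod.PoleOrder (B : Bimod A W) : Prop :=
  (∀ (u₁ : V) (w : W), ∃ C : ℕ, ∀ φ : W →ₗ[ℂ] ℂ, InGradedDual B.gr.proj φ → ∀ u₂ : V,
    ∃ R : RatFn (Fin 2), R.a 0 ≤ C ∧
      ∀ z₁ z₂ : ℂ, ‖z₂‖ < ‖z₁‖ → 0 < ‖z₂‖ →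
        AbsConvTo (fun k : ℤ × ℤ =>
            φ (B.YL u₁ (B.YL u₂ w k.2) k.1) * z₁ ^ (-k.1 - 1) * z₂ ^ (-k.2 - 1))
          (R.eval ![z₁, z₂])) ∧
  (∀ (u₂ : V) (w : W), ∃ C : ℕ, ∀ φ : W →ₗ[ℂ] ℂ, InGradedDual B.gr.proj φ → ∀ u₁ : V,
    ∃ R : RatFn (Fin 2), R.a 0 ≤ C ∧
      ∀ z₁ z₂ : ℂ, ‖z₂‖ < ‖z₁‖ → 0 < ‖z₂‖ →
        AbsConvTo (fun k : ℤ × ℤ =>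
            φ (B.YR w (A.Y u₁ u₂ k.2) k.1) * z₁ ^ (-k.1 - 1) * z₂ ^ (-k.2 - 1))
          (R.eval ![z₁, z₂])) ∧
  (∀ (u₁ u₂ : V), ∃ C : ℕ, ∀ φ : W →ₗ[ℂ] ℂ, InGradedDual B.gr.proj φ → ∀ w : W,
    ∃ R : RatFn (Fin 2), R.a 0 ≤ C ∧
      ∀ z₁ z₂ : ℂ, ‖z₂‖ < ‖z₁‖ → 0 < ‖z₂‖ →
        AbsConvTo (fun k : ℤ × ℤ =>
            φ (B.YL u₁ (B.YR w u₂ k.2) k.1) * z₁ ^ (-k.1 - 1) * z₂ ^ (-k.2 - 1))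
          (R.eval ![z₁, z₂]))

end VOA


section Cochains

variable {V : Type*} [AddCommGroup V] [Module ℂ V]
variable {W : Type*} [AddCommGroup W] [Module ℂ W] {A : MOSVA V}

/-- A `W̄`-valued rational function in the variables `z i`, `i : ι`, with the only
possible poles at `z i = z j`: a map from configuration space to the algebraic
completion whose pairings with graded-dual functionals are such rational functions,
with pole orders uniform in the functional, as witnessed by a formal power series
with coefficients in `W` (condition (ii)). -/
def CGrading.WTilde (G : CGrading W) {ι : Type*} [Fintype ι] [DecidableEq ι]
    (f : (ι → ℂ) → G.Comp) : Prop :=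
  (∀ φ : W →ₗ[ℂ] ℂ, InGradedDual G.proj φ →
      ∃ R : DiagRatFn ι, ∀ z : ι → ℂ, Conf z → G.pair φ (f z) = R.eval z) ∧
  ∃ (p : ι → ι → ℤ) (b : (ι → ℕ) → W),
    ∀ φ : W →ₗ[ℂ] ℂ, InGradedDual G.proj φ →
      (Function.support fun k => φ (b k)).Finite ∧
      ∀ z : ι → ℂ, Conf z →
        (∏ q ∈ Finset.univ.offDiag, (z q.1 - z q.2) ^ (p q.1 q.2)) * G.pair φ (f z)
          = ∑ᶠ k : ι → ℕ, φ (b k) * ∏ i, z i ^ (k i)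

/-- The pattern of left/right vertex operators: the `i`-th operator is
`Y_W^L(u i, z i)` if `isL i`, and `Y_W^{s(R)}(u i, z i)` otherwise; `k` records the
coefficient extracted from each operator. -/
def patOps (B : Bimod A W) {n : ℕ} (isL : Fin n → Bool) (u : Fin n → V)
    (k : Fin n → ℤ) : Fin n → (W → W) :=
  fun i => if isL i then fun x => B.YL (u i) x (k i) else fun x => B.YsR (u i) x (k i)

/-- The pattern with `l` left operators followed by `n - l` opposite right operators. -/
def prefixPat (n l : ℕ) : Fin n → Bool := fun i => decide ((i : ℕ) < l)

/-- A vector `w` such that `Y_W^L(u,x)w ∈ W[[x]]` and `Y_W^{s(R)}(u,x)w ∈ W[[x]]`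
for every `u ∈ V`. -/
def Bimod.RegVec (B : Bimod A W) (w : W) : Prop :=
  ∀ (u : V) (k : ℤ), 0 ≤ k → B.YL u w k = 0 ∧ B.YsR u w k = 0

/-- `f` represents the `W̄`-valued rational function
`E(Y^{L/sR}(u 0, z 0)⋯Y^{L/sR}(u (n-1), z (n-1)) w)` (with the operators prescribed
by the pattern `isL`): `f` is a `W̄`-valued rational function with only diagonal
poles whose pairings are the sums of the corresponding series of matrix coefficients
on the region `|z 0| > ⋯ > |z (n-1)| > 0`. -/
def RepEPat (B : Bimod A W) {n : ℕ} (isL : Fin n → Bool) (u : Fin n → V) (w : W)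
    (f : (Fin n → ℂ) → B.gr.Comp) : Prop :=
  B.gr.WTilde f ∧
  ∀ φ : W →ₗ[ℂ] ℂ, InGradedDual B.gr.proj φ → ∀ z : Fin n → ℂ, OrderedPos z →
    AbsConvTo (fun k : Fin n → ℤ =>
        φ (compApply n (patOps B isL u k) w) * ∏ i, z i ^ (-(k i) - 1))
      (B.gr.pair φ (f z))

/-- `f` represents the `W̄`-valued rational function given by a product of groups of
vertex operators, with group `i` of size `α i` and left/right pattern `isL`;
the variables are indexed by the sigma type `(i : Fin N) × Fin (α i)`. -/
def RepESig (B : Bimod A W) {N : ℕ} (α : Fin N → ℕ)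
    (isL : (i : Fin N) → Fin (α i) → Bool)
    (u : (i : Fin N) → Fin (α i) → V) (w : W)
    (f : (((i : Fin N) × Fin (α i)) → ℂ) → B.gr.Comp) : Prop :=
  B.gr.WTilde f ∧
  ∀ φ : W →ₗ[ℂ] ℂ, InGradedDual B.gr.proj φ →
    ∀ Z : (i : Fin N) → Fin (α i) → ℂ,
      (∀ (i : Fin N) (s t : Fin (α i)), s < t → ‖Z i t‖ < ‖Z i s‖) →
      (∀ (i j : Fin N), i < j → ∀ (s : Fin (α i)) (t : Fin (α j)), ‖Z j t‖ < ‖Z i s‖) →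
      (∀ (i : Fin N) (s : Fin (α i)), 0 < ‖Z i s‖) →
      AbsConvTo (fun K : (i : Fin N) → Fin (α i) → ℤ =>
          φ (compApply N (fun i x => compApply (α i) (fun s y =>
              if isL i s then B.YL (u i s) y (K i s) else B.YsR (u i s) y (K i s)) x) w)
            * ∏ i, ∏ s, Z i s ^ (-(K i s) - 1))
        (B.gr.pair φ (f (fun q => Z q.1 q.2)))

/-- Multilinearity of a map on `n`-tuples of vectors. -/
def IsMultilinear {M : Type*} [AddCommMonoid M] [Module ℂ M] {n : ℕ}
    (Φ : (Fin n → V) → M) : Prop :=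
  (∀ (v : Fin n → V) (i : Fin n) (x y : V),
      Φ (Function.update v i (x + y)) = Φ (Function.update v i x) + Φ (Function.update v i y)) ∧
  ∀ (v : Fin n → V) (i : Fin n) (c : ℂ) (x : V),
      Φ (Function.update v i (c • x)) = c • Φ (Function.update v i x)

/-- The `D`-derivative property of a map `Φ : V^{⊗n} → W̃_{z₁,…,zₙ}`. -/
def DDerivProp (A : MOSVA V) (B : Bimod A W) {n : ℕ}
    (Φ : (Fin n → V) → (Fin n → ℂ) → B.gr.Comp) : Prop :=
  (∀ (v : Fin n → V) (i : Fin n) (φ : W →ₗ[ℂ] ℂ), InGradedDual B.gr.proj φ →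
    ∀ z : Fin n → ℂ, Conf z →
      HasDerivAt (fun t : ℂ => B.gr.pair φ (Φ v (Function.update z i t)))
        (B.gr.pair φ (Φ (Function.update v i (A.D (v i))) z)) (z i)) ∧
  (∀ (v : Fin n → V) (φ : W →ₗ[ℂ] ℂ), InGradedDual B.gr.proj φ →
    ∀ z : Fin n → ℂ, Conf z →
      B.gr.pair φ (B.gr.ext (⇑B.DW) (Φ v z)) =
        ∑ i, B.gr.pair φ (Φ (Function.update v i (A.D (v i))) z))

/-- The `d`-conjugation property of a map `Φ : V^{⊗n} → W̃_{z₁,…,zₙ}`. -/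
def DConjProp (A : MOSVA V) (B : Bimod A W) {n : ℕ}
    (Φ : (Fin n → V) → (Fin n → ℂ) → B.gr.Comp) : Prop :=
  ∀ (v : Fin n → V) (φ : W →ₗ[ℂ] ℂ), InGradedDual B.gr.proj φ →
    ∀ (z : Fin n → ℂ) (c : ℂ), c ≠ 0 → Conf z → Conf (fun i => c * z i) →
      B.gr.pair φ (B.gr.zd c (Φ v z)) =
        B.gr.pair φ (Φ (fun i => A.gr.zd c (v i)) (fun i => c * z i))

/-- Composability of `Φ : V^{⊗n} → W̃` with `m` vertex operators. -/
def ComposableWith (A : MOSVA V) (B : Bimod A W) (n m : ℕ)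
    (Φ : (Fin n → V) → (Fin n → ℂ) → B.gr.Comp) : Prop :=
  ∃ Cb : V → V → ℕ,
  ∀ (α : Fin (n+1) → ℕ), (∑ i, α i) = m + n →
  ∀ l₀ : ℕ, l₀ ≤ α 0 →
  ∀ u : (i : Fin (n+1)) → Fin (α i) → V,
  ∀ φ : W →ₗ[ℂ] ℂ, InGradedDual B.gr.proj φ →
  ∃ R : DiagRatFn ((i : Fin (n+1)) × Fin (α i)),
    (∀ q q' : (i : Fin (n+1)) × Fin (α i), R.b q q' ≤ Cb (u q.1 q.2) (u q'.1 q'.2)) ∧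
    ∀ (z : (i : Fin (n+1)) → Fin (α i) → ℂ) (ζ : Fin n → ℂ),
      (∀ s t : Fin (α 0), s < t → ‖z 0 t‖ < ‖z 0 s‖) →
      (∀ (j : Fin (α 0)) (i : Fin n) (t : Fin (α i.succ)),
          ‖ζ i‖ + ‖z i.succ t - ζ i‖ < ‖z 0 j‖) →
      (∀ (i : Fin n) (s t : Fin (α i.succ)), s < t →
          ‖z i.succ t - ζ i‖ < ‖z i.succ s - ζ i‖) →
      (∀ (i j : Fin n), i < j → ∀ (s : Fin (α i.succ)) (t : Fin (α j.succ)),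
          ‖(z i.succ s - ζ i) - (z j.succ t - ζ j)‖ < ‖ζ i - ζ j‖) →
      AbsConvTo (fun K : (i : Fin (n+1)) → Fin (α i) → ℤ =>
          B.gr.pair φ
            (compApply (α 0) (fun j => B.gr.ext (fun x =>
                if (j : ℕ) < l₀ then B.YL (u 0 j) x (K 0 j) else B.YsR (u 0 j) x (K 0 j)))
              (Φ (fun i => compApply (α i.succ)
                    (fun s x => A.Y (u i.succ s) x (K i.succ s)) A.vac) ζ))
            * (∏ j, z 0 j ^ (-(K 0 j) - 1))
            * ∏ i : Fin n, ∏ s, (z i.succ s - ζ i) ^ (-(K i.succ s) - 1))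
        (R.eval (fun q => z q.1 q.2))

/-- The set `Ĉ^n_m(V,W)`: maps `V^{⊗n} → W̃_{z₁,…,zₙ}` that are linear, satisfy the
`D`-derivative and `d`-conjugation properties and are composable with `m` vertex
operators. -/
def IsCochain (A : MOSVA V) (B : Bimod A W) (n m : ℕ)
    (Φ : (Fin n → V) → (Fin n → ℂ) → B.gr.Comp) : Prop :=
  IsMultilinear Φ ∧ (∀ v, B.gr.WTilde (Φ v)) ∧ DDerivProp A B Φ ∧ DConjProp A B Φ ∧
    ComposableWith A B n m Φ

/-- `Ψ` represents `E_W^{(1,0)} ∘₂ Φ`, i.e. the map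
`v ↦ E(Y_W^L(v 0, z 0) Φ(v 1 ⊗ ⋯ ⊗ v n)(z 1,…,z n))`. -/
def RepLeft (A : MOSVA V) (B : Bimod A W) {n : ℕ}
    (Φ : (Fin n → V) → (Fin n → ℂ) → B.gr.Comp)
    (Ψ : (Fin (n+1) → V) → (Fin (n+1) → ℂ) → B.gr.Comp) : Prop :=
  (∀ v, B.gr.WTilde (Ψ v)) ∧
  ∀ (v : Fin (n+1) → V) (φ : W →ₗ[ℂ] ℂ), InGradedDual B.gr.proj φ →
    ∀ (z₀ : ℂ) (zt : Fin n → ℂ), Conf (Fin.cons z₀ zt) →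
      (∀ i, ‖zt i‖ < ‖z₀‖) → (∀ i, 0 < ‖zt i‖) →
      AbsConvTo (fun k : ℤ =>
          B.gr.pair φ (B.gr.ext (fun x => B.YL (v 0) x k) (Φ (Fin.tail v) zt))
            * z₀ ^ (-k - 1))
        (B.gr.pair φ (Ψ v (Fin.cons z₀ zt)))

/-- `Ψ` represents `E_W^{(0,1)} ∘₂ Φ`, i.e. the map
`v ↦ E(Y_W^{s(R)}(v (n+1), z (n+1)) Φ(v 1 ⊗ ⋯ ⊗ v n)(z 1,…,z n))`. -/
def RepRight (A : MOSVA V) (B : Bimod A W) {n : ℕ}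
    (Φ : (Fin n → V) → (Fin n → ℂ) → B.gr.Comp)
    (Ψ : (Fin (n+1) → V) → (Fin (n+1) → ℂ) → B.gr.Comp) : Prop :=
  (∀ v, B.gr.WTilde (Ψ v)) ∧
  ∀ (v : Fin (n+1) → V) (φ : W →ₗ[ℂ] ℂ), InGradedDual B.gr.proj φ →
    ∀ (zl : ℂ) (zi : Fin n → ℂ), Conf (Fin.snoc zi zl) →
      (∀ i, ‖zi i‖ < ‖zl‖) → (∀ i, 0 < ‖zi i‖) →
      AbsConvTo (fun k : ℤ =>
          B.gr.pair φ (B.gr.ext (fun x => B.YsR (v (Fin.last n)) x k) (Φ (Fin.init v) zi))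
            * zl ^ (-k - 1))
        (B.gr.pair φ (Ψ v (Fin.snoc zi zl)))

/-- Replace the two adjacent entries `i, i+1` of an `(n+1)`-tuple by a single entry. -/
def mergeAt {M : Type*} {n : ℕ} (i : Fin n) (v : Fin (n+1) → M) (a : M) : Fin n → M :=
  fun j => if j < i then v j.castSucc else if j = i then a else v j.succ

/-- `Ψ` represents `Φ ∘ᵢ E_V^{(2)}`, i.e. the map
`v ↦ E(Φ(v 1 ⊗ ⋯ ⊗ Y_V(v i, z i − ζ)Y_V(v (i+1), z (i+1) − ζ)𝟏 ⊗ ⋯ ⊗ v (n+1))(…,ζ,…))`. -/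
def RepCirc (A : MOSVA V) (B : Bimod A W) {n : ℕ} (i : Fin n)
    (Φ : (Fin n → V) → (Fin n → ℂ) → B.gr.Comp)
    (Ψ : (Fin (n+1) → V) → (Fin (n+1) → ℂ) → B.gr.Comp) : Prop :=
  (∀ v, B.gr.WTilde (Ψ v)) ∧
  ∀ (v : Fin (n+1) → V) (φ : W →ₗ[ℂ] ℂ), InGradedDual B.gr.proj φ →
    ∀ (z : Fin (n+1) → ℂ) (ζ : ℂ), Conf z → Conf (mergeAt i z ζ) →
      ‖z i.succ - ζ‖ < ‖z i.castSucc - ζ‖ → 0 < ‖z i.succ - ζ‖ →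
      (∀ j : Fin (n+1), j ≠ i.castSucc → j ≠ i.succ →
        ‖z i.castSucc - ζ‖ < ‖z j - z i.castSucc‖ ∧ ‖z i.succ - ζ‖ < ‖z j - z i.succ‖) →
      AbsConvTo (fun k : ℤ × ℤ =>
          B.gr.pair φ
            (Φ (mergeAt i v (A.Y (v i.castSucc) (A.Y (v i.succ) A.vac k.2) k.1))
              (mergeAt i z ζ))
            * (z i.castSucc - ζ) ^ (-k.1 - 1) * (z i.succ - ζ) ^ (-k.2 - 1))
        (B.gr.pair φ (Ψ v z))

/-- `Ψ` represents the coboundary `δ̂Φ = E_W^{(1,0)}∘₂Φ + Σᵢ (−1)^i Φ∘ᵢE_V^{(2)}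
+ (−1)^{n+1} E_W^{(0,1)}∘₂Φ` of the `n`-cochain `Φ`. -/
def IsDelta (A : MOSVA V) (B : Bimod A W) {n : ℕ}
    (Φ : (Fin n → V) → (Fin n → ℂ) → B.gr.Comp)
    (Ψ : (Fin (n+1) → V) → (Fin (n+1) → ℂ) → B.gr.Comp) : Prop :=
  ∃ (gL gR : (Fin (n+1) → V) → (Fin (n+1) → ℂ) → B.gr.Comp)
    (gC : Fin n → (Fin (n+1) → V) → (Fin (n+1) → ℂ) → B.gr.Comp),
    RepLeft A B Φ gL ∧ RepRight A B Φ gR ∧ (∀ i, RepCirc A B i Φ (gC i)) ∧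
    ∀ v z, Ψ v z = gL v z + (∑ i : Fin n, ((-1 : ℂ) ^ ((i : ℕ) + 1)) • gC i v z)
      + ((-1 : ℂ) ^ (n + 1)) • gR v z

end Cochains

set_option linter.unusedSectionVars false

section

/-- Families of complex numbers indexed by integer multi-exponents. -/
abbrev Fam (ι : Type*) : Type _ := (ι → ℤ) → ℂ

/-- The multi-index of a monomial, as an integer vector. -/
def mvec {ι : Type*} (m : ι →₀ ℕ) : ι → ℤ := fun i => (m i : ℤ)

theorem mvec_zero {ι : Type*} : mvec (0 : ι →₀ ℕ) = 0 := by
  funext i; simp [mvec]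

theorem mvec_add {ι : Type*} (m n : ι →₀ ℕ) : mvec (m + n) = mvec m + mvec n := by
  funext i; simp [mvec]

theorem mvec_single {ι : Type*} [DecidableEq ι] (i : ι) :
    mvec (Finsupp.single i 1) = Pi.single i 1 := by
  funext j
  by_cases h : j = i
  · subst h; simp [mvec]
  · simp [mvec, h]

/-- The shift of a family by an integer vector. -/
def shift {ι : Type*} (d : ι → ℤ) : Module.End ℂ (Fam ι) where
  toFun c := fun K => c (K + d)
  map_add' _ _ := rfl
  map_smul' _ _ := rfl

theorem shift_apply {ι : Type*} (d : ι → ℤ) (c : Fam ι) (K : ι → ℤ) :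
    shift d c K = c (K + d) := rfl

/-- The action of polynomials on families, the variable `X i` acting as the shift of the
`i`-th index. -/
def act {ι : Type*} : MvPolynomial ι ℂ →ₐ[ℂ] Module.End ℂ (Fam ι) :=
  AddMonoidAlgebra.lift ℂ (Module.End ℂ (Fam ι)) (ι →₀ ℕ)
    { toFun := fun m => shift (mvec m.toAdd)
      map_one' := by
        ext c K
        simp [shift_apply, mvec_zero]
      map_mul' := by
        intro a b
        ext c K
        simp only [toAdd_mul, mvec_add, Module.End.mul_apply, shift_apply]
        congr 1
        abel }

theorem act_monomial {ι : Type*} (m : ι →₀ ℕ) (a : ℂ) (c : Fam ι) (K : ι → ℤ) :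
    act (MvPolynomial.monomial m a) c K = a * c (K + mvec m) := by
  have : act (MvPolynomial.monomial m a) = a • shift (mvec m) :=
    AddMonoidAlgebra.lift_single _ _ _
  rw [this]
  rfl

theorem act_X {ι : Type*} [DecidableEq ι] (i : ι) (c : Fam ι) (K : ι → ℤ) :
    act (MvPolynomial.X i) c K = c (K + Pi.single i 1) := by
  rw [MvPolynomial.X, act_monomial, mvec_single, one_mul]

theorem act_C {ι : Type*} (s : ℂ) (c : Fam ι) (K : ι → ℤ) :
    act (MvPolynomial.C s) c K = s * c K := by
  rw [MvPolynomial.C_apply, act_monomial, mvec_zero, add_zero]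

theorem act_mul {ι : Type*} (p q : MvPolynomial ι ℂ) (c : Fam ι) :
    act (p * q) c = act p (act q c) := by
  rw [map_mul]; rfl

theorem act_comm {ι : Type*} (p q : MvPolynomial ι ℂ) (c : Fam ι) :
    act p (act q c) = act q (act p c) := by
  rw [← act_mul, ← act_mul, mul_comm]

theorem act_add {ι : Type*} (p q : MvPolynomial ι ℂ) (c : Fam ι) :
    act (p + q) c = act p c + act q c := by
  rw [map_add]; rfl

theorem act_sub {ι : Type*} (p q : MvPolynomial ι ℂ) (c : Fam ι) :
    act (p - q) c = act p c - act q c := by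
  rw [map_sub]; rfl

theorem act_neg {ι : Type*} (p : MvPolynomial ι ℂ) (c : Fam ι) :
    act (-p) c = -act p c := by
  rw [map_neg]; rfl

theorem act_one {ι : Type*} (c : Fam ι) : act (1 : MvPolynomial ι ℂ) c = c := by
  rw [map_one]; rfl

/-- A property of families stable under sums, scalars and shifts is stable under the
action of polynomials. -/
theorem act_induction {ι : Type*} [DecidableEq ι] (S : Fam ι → Prop)
    (hadd : ∀ c d, S c → S d → S (c + d)) (hsmul : ∀ (a : ℂ) c, S c → S (a • c))
    (hX : ∀ i c, S c → S (fun K => c (K + Pi.single i 1)))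
    (p : MvPolynomial ι ℂ) (c : Fam ι) (hc : S c) : S (act p c) := by
  induction p using MvPolynomial.induction_on generalizing c with
  | C a =>
    have : act (MvPolynomial.C a) c = a • c := by
      funext K; rw [act_C]; rfl
    rw [this]; exact hsmul a c hc
  | add p q hp hq => rw [act_add]; exact hadd _ _ (hp c hc) (hq c hc)
  | mul_X p i hp =>
    rw [act_mul]
    apply hp
    have : act (MvPolynomial.X i) c = fun K => c (K + Pi.single i 1) := by
      funext K; rw [act_X]
    rw [this]; exact hX i c hc

/-- The family of coefficients of a polynomial. -/
def fam {ι : Type*} [Fintype ι] (p : MvPolynomial ι ℂ) : Fam ι := fun K =>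
  if ∀ i, K i < 0 then p.coeff (Finsupp.equivFunOnFinite.symm fun i => (-1 - K i).toNat) else 0

/-- The support of a family lies in the negative orthant. -/
def NegOrthant {ι : Type*} (c : Fam ι) : Prop := ∀ K i, 0 ≤ K i → c K = 0

theorem exists_fam {ι : Type*} [Fintype ι] (c : Fam ι) (hn : NegOrthant c)
    (hf : (Function.support c).Finite) : ∃ p, fam p = c := by
  classical
  let g : (ι →₀ ℕ) → (ι → ℤ) := fun m i => -1 - (m i : ℤ)
  have hg : Function.Injective g := by
    intro a b h
    ext i
    have := congrFun h i
    simp only [g] at this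
    omega
  have hfin : (Function.support fun m => c (g m)).Finite :=
    Set.Finite.preimage hg.injOn hf
  refine ⟨∑ m ∈ hfin.toFinset, MvPolynomial.monomial m (c (g m)), ?_⟩
  funext K
  unfold fam
  split_ifs with h
  · rw [MvPolynomial.coeff_sum]
    simp only [MvPolynomial.coeff_monomial]
    rw [Finset.sum_ite_eq']
    have hK : g (Finsupp.equivFunOnFinite.symm fun i => (-1 - K i).toNat) = K := by
      funext i
      have := h i
      simp [g]
      omega
    split_ifs with h2
    · rw [hK]
    · simp only [Set.Finite.mem_toFinset, Function.mem_support, not_not] at h2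
      rw [hK] at h2
      exact h2.symm
  · push Not at h
    obtain ⟨i, hi⟩ := h
    exact (hn K i hi).symm

end

section

/-- The Laurent monomial attached to a multi-index. -/
def mono {ι : Type*} [Fintype ι] (y : ι → ℂ) (K : ι → ℤ) : ℂ := ∏ i, y i ^ (-(K i) - 1)

/-- In the direction of a vanishing variable the family is supported in negative indices. -/
def NZ {ι : Type*} (y : ι → ℂ) (c : Fam ι) : Prop := ∀ i, y i = 0 → ∀ K, 0 ≤ K i → c K = 0

theorem NZ.act {ι : Type*} [DecidableEq ι] {y : ι → ℂ} {c : Fam ι} (h : NZ y c)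
    (p : MvPolynomial ι ℂ) : NZ y (act p c) := by
  refine act_induction (NZ y) ?_ ?_ ?_ p c h
  · intro c d hc hd i hi K hK
    simp [hc i hi K hK, hd i hi K hK]
  · intro a c hc i hi K hK
    simp [hc i hi K hK]
  · intro j c hc i hi K hK
    apply hc i hi
    by_cases hij : i = j
    · subst hij; simp; omega
    · simp [hij, hK]

/-- The family is bounded below in the direction `i`, uniformly in the direction `j`. -/
def PB {ι : Type*} (i j : ι) (c : Fam ι) : Prop :=
  ∀ K : ι → ℤ, ∃ k0 : ℤ, ∀ K' : ι → ℤ, (∀ m, m ≠ i → m ≠ j → K' m = K m) → K' i < k0 → c K' = 0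

theorem mono_shift {ι : Type*} [Fintype ι] [DecidableEq ι] (y : ι → ℂ) (c : Fam ι) (h : NZ y c)
    (i : ι) (K : ι → ℤ) :
    c (K + Pi.single i 1) * mono y K
      = y i * (c (K + Pi.single i 1) * mono y (K + Pi.single i 1)) := by
  have key : mono y (K + Pi.single i 1) =
      y i ^ (-(K i + 1) - 1) * ∏ m ∈ Finset.univ.erase i, y m ^ (-(K m) - 1) := by
    unfold mono
    rw [← Finset.mul_prod_erase _ _ (Finset.mem_univ i)]
    congr 1
    · simp
    · apply Finset.prod_congr rfl
      intro m hm
      have := Finset.ne_of_mem_erase hm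
      simp [this]
  have key2 : mono y K =
      y i ^ (-(K i) - 1) * ∏ m ∈ Finset.univ.erase i, y m ^ (-(K m) - 1) := by
    unfold mono
    rw [← Finset.mul_prod_erase _ _ (Finset.mem_univ i)]
  rw [key, key2]
  by_cases hy : y i = 0
  · by_cases hK : K i = -1
    · rw [h i hy _ (by simp [hK])]
      simp
    · rw [hy, zero_zpow _ (by omega)]
      simp
  · have : y i ^ (-(K i) - 1) = y i * y i ^ (-(K i + 1) - 1) := by
      rw [← zpow_one_add₀ hy]
      congr 1
      ring
    rw [this]
    ring

theorem conv_act {ι : Type*} [Fintype ι] [DecidableEq ι] (y : ι → ℂ) (p : MvPolynomial ι ℂ)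
    (c : Fam ι) (h : NZ y c) (s : ℂ) (hs : AbsConvTo (fun K => c K * mono y K) s) :
    AbsConvTo (fun K => act p c K * mono y K) (MvPolynomial.eval y p * s) := by
  induction p using MvPolynomial.induction_on generalizing c s with
  | C a =>
    simp only [act_C, mul_assoc, MvPolynomial.eval_C]
    refine ⟨?_, hs.2.mul_left a⟩
    simp only [norm_mul]
    have := hs.1.mul_left ‖a‖
    simpa only [norm_mul] using this
  | add p q hp hq =>
    have h1 := hp c h s hs
    have h2 := hq c h s hs
    have e : (fun K => act (p + q) c K * mono y K) =
        fun K => act p c K * mono y K + act q c K * mono y K := by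
      funext K
      rw [act_add, Pi.add_apply, add_mul]
    rw [e, map_add, add_mul]
    refine ⟨?_, h1.2.add h2.2⟩
    exact Summable.of_nonneg_of_le (fun _ => norm_nonneg _) (fun _ => norm_add_le _ _)
      (h1.1.add h2.1)
  | mul_X p i hp =>
    rw [act_mul, map_mul, MvPolynomial.eval_X, mul_assoc]
    apply hp _ (h.act _)
    have e : ∀ K, act (MvPolynomial.X i) c K * mono y K =
        y i * (c (K + Pi.single i 1) * mono y (K + Pi.single i 1)) := by
      intro K
      rw [act_X, mono_shift y c h]
    simp only [e]
    have hinj := (Equiv.addRight (Pi.single i (1 : ℤ) : ι → ℤ))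
    constructor
    · have := (hs.1.comp_injective (Equiv.addRight (Pi.single i (1 : ℤ) : ι → ℤ)).injective).mul_left
        ‖y i‖
      simpa [norm_mul] using this
    · have := ((Equiv.addRight (Pi.single i (1 : ℤ) : ι → ℤ)).hasSum_iff.mpr hs.2).mul_left (y i)
      simpa using this

/-- Splitting off two coordinates of a multi-index. -/
def slice {ι : Type*} [DecidableEq ι] (i j : ι) (hij : i ≠ j) :
    {K : ι → ℤ // K i = 0 ∧ K j = 0} × ℤ × ℤ ≃ (ι → ℤ) where
  toFun x := Function.update (Function.update x.1.1 i x.2.1) j x.2.2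
  invFun K := (⟨Function.update (Function.update K i 0) j 0, by simp [hij]⟩, K i, K j)
  left_inv := by
    rintro ⟨⟨K, h1, h2⟩, k, l⟩
    simp only [Prod.mk.injEq, Subtype.mk.injEq]
    refine ⟨?_, ?_, ?_⟩
    · funext m
      by_cases hm : m = j
      · subst hm; simp [h2]
      · by_cases hm2 : m = i
        · subst hm2; simp [hm, h1]
        · simp [hm, hm2]
    · simp [hij]
    · simp
  right_inv := by
    intro K
    funext m
    by_cases hm : m = j
    · subst hm; simp
    · by_cases hm2 : m = i
      · subst hm2; simp [hm]
      · simp [hm, hm2]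

open scoped ENNReal in
theorem geometric_bound (α β : ℕ → ℝ≥0∞) (r ρ : ℝ≥0∞) (hr : ρ < r)
    (h0 : α 0 = 0) (h : ∀ n, r * α (n + 1) ≤ β n + ρ * α n) (hβ : ∑' n, β n ≠ ∞) :
    (r - ρ) * ∑' n, α n ≤ ∑' n, β n := by
  have hr0 : r ≠ 0 := (lt_of_le_of_lt zero_le hr).ne'
  have hρ : ρ ≠ ∞ := (lt_of_lt_of_le hr le_top).ne
  have hβn : ∀ n, β n ≠ ∞ := fun n => ne_top_of_le_ne_top hβ (ENNReal.le_tsum n)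
  have hα : ∀ n, α n ≠ ∞ := by
    intro n
    induction n with
    | zero => simp [h0]
    | succ n ih =>
      intro hc
      have := h n
      rw [hc, ENNReal.mul_top hr0, top_le_iff] at this
      exact (ENNReal.add_ne_top.mpr ⟨hβn n, ENNReal.mul_ne_top hρ ih⟩) this
  rw [← ENNReal.tsum_mul_left]
  apply ENNReal.tsum_le_of_sum_range_le
  intro N
  rw [← Finset.mul_sum]
  have hfin : ∑ n ∈ Finset.range N, α n ≠ ∞ := ENNReal.sum_ne_top.mpr fun n _ => hα n
  rw [ENNReal.sub_mul (fun _ _ => hfin)]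
  rw [tsub_le_iff_right]
  cases N with
  | zero => simp
  | succ N =>
    calc r * ∑ n ∈ Finset.range (N + 1), α n = ∑ n ∈ Finset.range N, r * α (n + 1) := by
          rw [Finset.sum_range_succ', h0, add_zero, Finset.mul_sum]
      _ ≤ ∑ n ∈ Finset.range N, (β n + ρ * α n) := Finset.sum_le_sum fun n _ => h n
      _ = ∑ n ∈ Finset.range N, β n + ρ * ∑ n ∈ Finset.range N, α n := by
          rw [Finset.sum_add_distrib, Finset.mul_sum]
      _ ≤ _ := by
          gcongr
          · exact ENNReal.sum_le_tsum _
          · omega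

end

section

open scoped ENNReal

theorem plane_bound (c : ℤ → ℤ → ℂ) (k0 : ℤ) (hc : ∀ k, k < k0 → ∀ l, c k l = 0)
    (y x s : ℂ) (hr : ‖x‖ + ‖s‖ < ‖y‖) (hx : x = 0 → ∀ k l, 0 ≤ l → c k l = 0)
    (hV : ∑' p : ℤ × ℤ, ‖(c (p.1 + 1) p.2 - c p.1 (p.2 + 1) - s * c p.1 p.2)
        * (y ^ (-p.1 - 1) * x ^ (-p.2 - 1))‖ₑ ≠ ∞) :
    (‖y‖ₑ - (‖x‖ₑ + ‖s‖ₑ)) * ∑' p : ℤ × ℤ, ‖c p.1 p.2 * (y ^ (-p.1 - 1) * x ^ (-p.2 - 1))‖ₑ ≤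
      ∑' p : ℤ × ℤ, ‖(c (p.1 + 1) p.2 - c p.1 (p.2 + 1) - s * c p.1 p.2)
        * (y ^ (-p.1 - 1) * x ^ (-p.2 - 1))‖ₑ := by
  have hy : y ≠ 0 := by
    rintro rfl
    simp only [norm_zero] at hr
    have := norm_nonneg x
    have := norm_nonneg s
    linarith
  set d : ℤ → ℤ → ℂ := fun k l => c (k + 1) l - c k (l + 1) - s * c k l with hd
  let u : ℤ → ℝ≥0∞ := fun k => ∑' l : ℤ, ‖c k l * (y ^ (-k - 1) * x ^ (-l - 1))‖ₑ
  let v : ℤ → ℝ≥0∞ := fun k => ∑' l : ℤ, ‖d k l * (y ^ (-k - 1) * x ^ (-l - 1))‖ₑ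
  have hS : ∑' p : ℤ × ℤ, ‖c p.1 p.2 * (y ^ (-p.1 - 1) * x ^ (-p.2 - 1))‖ₑ = ∑' k, u k :=
    ENNReal.tsum_prod (f := fun k l => ‖c k l * (y ^ (-k - 1) * x ^ (-l - 1))‖ₑ)
  have hT : ∑' p : ℤ × ℤ, ‖(c (p.1 + 1) p.2 - c p.1 (p.2 + 1) - s * c p.1 p.2)
        * (y ^ (-p.1 - 1) * x ^ (-p.2 - 1))‖ₑ = ∑' k, v k :=
    ENNReal.tsum_prod (f := fun k l => ‖d k l * (y ^ (-k - 1) * x ^ (-l - 1))‖ₑ)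
  rw [hT] at hV
  rw [hS, hT]
  have hu0 : ∀ k, k < k0 → u k = 0 := by
    intro k hk
    simp [u, hc k hk]
  have hstep : ∀ k, ‖y‖ₑ * u (k + 1) ≤ v k + (‖x‖ₑ + ‖s‖ₑ) * u k := by
    intro k
    have h1 : ‖y‖ₑ * u (k + 1) = ∑' l : ℤ, ‖c (k + 1) l * (y ^ (-k - 1) * x ^ (-l - 1))‖ₑ := by
      rw [← ENNReal.tsum_mul_left]
      refine tsum_congr fun l => ?_
      rw [← enorm_mul]
      congr 1
      have : y ^ (-k - 1) = y * y ^ (-(k + 1) - 1) := by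
        rw [← zpow_one_add₀ hy]
        congr 1
        ring
      rw [this]
      ring
    have h2 : ‖x‖ₑ * u k = ∑' l : ℤ, ‖c k (l + 1) * (y ^ (-k - 1) * x ^ (-l - 1))‖ₑ := by
      rw [← ENNReal.tsum_mul_left]
      rw [← (Equiv.addRight (1 : ℤ)).tsum_eq]
      refine tsum_congr fun l => ?_
      rw [← enorm_mul]
      congr 1
      simp only [Equiv.coe_addRight]
      by_cases hx0 : x = 0
      · by_cases hl : l = -1
        · rw [hx hx0 k (l + 1) (by omega)]
          simp
        · rw [hx0, zero_zpow (-l - 1) (by omega)]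
          simp
      · have : x ^ (-l - 1) = x * x ^ (-(l + 1) - 1) := by
          rw [← zpow_one_add₀ hx0]
          congr 1
          ring
        rw [this]
        ring
    have h3 : ‖s‖ₑ * u k = ∑' l : ℤ, ‖s * c k l * (y ^ (-k - 1) * x ^ (-l - 1))‖ₑ := by
      rw [← ENNReal.tsum_mul_left]
      refine tsum_congr fun l => ?_
      rw [← enorm_mul, mul_assoc]
    rw [add_mul, h1, h2, h3, ← ENNReal.tsum_add, ← ENNReal.tsum_add]
    refine ENNReal.tsum_le_tsum fun l => ?_
    have : c (k + 1) l * (y ^ (-k - 1) * x ^ (-l - 1)) = d k l * (y ^ (-k - 1) * x ^ (-l - 1))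
        + (c k (l + 1) * (y ^ (-k - 1) * x ^ (-l - 1))
          + s * c k l * (y ^ (-k - 1) * x ^ (-l - 1))) := by
      simp only [hd]; ring
    rw [this]
    exact (enorm_add_le _ _).trans (add_le_add le_rfl (enorm_add_le _ _))
  have hinj : Function.Injective fun n : ℕ => k0 - 1 + (n : ℤ) := by
    intro a b h
    simpa using h
  have hu : ∑' k, u k = ∑' n : ℕ, u (k0 - 1 + n) := by
    refine (hinj.tsum_eq ?_).symm
    intro k hk
    by_contra hcon
    apply hk
    apply hu0
    by_contra h'
    exact hcon ⟨(k - (k0 - 1)).toNat, by simp; omega⟩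
  have hv : ∑' n : ℕ, v (k0 - 1 + n) ≤ ∑' k, v k := ENNReal.tsum_comp_le_tsum_of_injective hinj v
  rw [hu]
  refine le_trans (geometric_bound _ (fun n => v (k0 - 1 + n)) _ _ ?_ ?_ ?_ ?_) hv
  · rw [← ofReal_norm, ← ofReal_norm, ← ofReal_norm, ← ENNReal.ofReal_add (norm_nonneg _) (norm_nonneg _)]
    exact (ENNReal.ofReal_lt_ofReal_iff_of_nonneg (by positivity)).mpr hr
  · exact hu0 _ (by simp)
  · intro n
    have := hstep (k0 - 1 + n)
    push_cast
    rw [← add_assoc]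
    exact this
  · exact ne_top_of_le_ne_top hV hv

variable {ι : Type*} [Fintype ι] [DecidableEq ι]

/-- Division by a linear factor `z i - z j - s` preserves absolute convergence. -/
theorem summable_of_factor (i j : ι) (hij : i ≠ j) (s : ℂ) (y : ι → ℂ)
    (hr : ‖y j‖ + ‖s‖ < ‖y i‖) (c : Fam ι) (hc : PB i j c) (hz : NZ y c)
    (hs : Summable fun K => ‖act (MvPolynomial.X i - MvPolynomial.X j - MvPolynomial.C s) c K
      * mono y K‖) :
    Summable fun K => ‖c K * mono y K‖ := by
  set d := act (MvPolynomial.X i - MvPolynomial.X j - MvPolynomial.C s) c with hd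
  rw [← tsum_enorm_ne_top_iff_summable_norm] at hs ⊢
  rw [← (slice i j hij).tsum_eq] at hs ⊢
  rw [ENNReal.tsum_prod'] at hs ⊢
  let P : {K : ι → ℤ // K i = 0 ∧ K j = 0} → ℂ := fun K =>
    ∏ m ∈ (Finset.univ.erase i).erase j, y m ^ (-(K.1 m) - 1)
  have hmono : ∀ K k l, mono y (slice i j hij (K, k, l)) =
      (y i ^ (-k - 1) * y j ^ (-l - 1)) * P K := by
    intro K k l
    unfold mono
    rw [← Finset.mul_prod_erase _ _ (Finset.mem_univ i),
      ← Finset.mul_prod_erase (Finset.univ.erase i) _ (a := j) (by simp [hij.symm]), ← mul_assoc]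
    congr 1
    · simp [slice, hij]
    · apply Finset.prod_congr rfl
      intro m hm
      simp only [Finset.mem_erase] at hm
      simp [slice, hm.1, hm.2.1]
  have hdd : ∀ K k l, d (slice i j hij (K, k, l)) =
      c (slice i j hij (K, k + 1, l)) - c (slice i j hij (K, k, l + 1))
        - s * c (slice i j hij (K, k, l)) := by
    intro K k l
    rw [hd, act_sub, act_sub, Pi.sub_apply, Pi.sub_apply, act_X, act_X, act_C]
    congr 3
    · funext m
      by_cases hm : m = j
      · subst hm; simp [slice, hij.symm]
      · by_cases hm2 : m = i
        · subst hm2; simp [slice, hm]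
        · simp [slice, hm, hm2]
    · funext m
      by_cases hm : m = j
      · subst hm; simp [slice]
      · by_cases hm2 : m = i
        · subst hm2; simp [slice, hm]
        · simp [slice, hm, hm2]
  have key : ∀ K, (‖y i‖ₑ - (‖y j‖ₑ + ‖s‖ₑ)) *
      ∑' p : ℤ × ℤ, ‖c (slice i j hij (K, p)) * mono y (slice i j hij (K, p))‖ₑ ≤
      ∑' p : ℤ × ℤ, ‖d (slice i j hij (K, p)) * mono y (slice i j hij (K, p))‖ₑ := by
    intro K
    have hfin : ∑' p : ℤ × ℤ, ‖d (slice i j hij (K, p)) * mono y (slice i j hij (K, p))‖ₑ ≠ ∞ :=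
      ne_top_of_le_ne_top hs (ENNReal.le_tsum K)
    have e1 : ∀ p : ℤ × ℤ, ‖c (slice i j hij (K, p)) * mono y (slice i j hij (K, p))‖ₑ =
        ‖c (slice i j hij (K, p.1, p.2)) * (y i ^ (-p.1 - 1) * y j ^ (-p.2 - 1))‖ₑ * ‖P K‖ₑ := by
      rintro ⟨k, l⟩
      simp only [hmono, ← enorm_mul, mul_assoc]
    have e2 : ∀ p : ℤ × ℤ, ‖d (slice i j hij (K, p)) * mono y (slice i j hij (K, p))‖ₑ =
        ‖(c (slice i j hij (K, p.1 + 1, p.2)) - c (slice i j hij (K, p.1, p.2 + 1))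
          - s * c (slice i j hij (K, p.1, p.2))) * (y i ^ (-p.1 - 1) * y j ^ (-p.2 - 1))‖ₑ
          * ‖P K‖ₑ := by
      rintro ⟨k, l⟩
      simp only [hmono, hdd, ← enorm_mul, mul_assoc]
    simp only [e1, e2, ENNReal.tsum_mul_right] at hfin ⊢
    by_cases hP : ‖P K‖ₑ = 0
    · simp [hP]
    · rw [← mul_assoc]
      gcongr
      obtain ⟨k0, hk0⟩ := hc K.1
      apply plane_bound (fun k l => c (slice i j hij (K, k, l))) k0
      · intro k hk l
        apply hk0
        · intro m h1 h2
          simp [slice, h1, h2]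
        · simpa [slice, hij] using hk
      · exact hr
      · intro hx k l hl
        apply hz j hx
        simpa [slice] using hl
      · intro htop
        rw [htop] at hfin
        exact hfin (ENNReal.top_mul hP)
  have hpos : ‖y i‖ₑ - (‖y j‖ₑ + ‖s‖ₑ) ≠ 0 := by
    rw [← ofReal_norm, ← ofReal_norm, ← ofReal_norm, ← ENNReal.ofReal_add (norm_nonneg _) (norm_nonneg _)]
    rw [ne_eq, tsub_eq_zero_iff_le, not_le]
    exact (ENNReal.ofReal_lt_ofReal_iff_of_nonneg (by positivity)).mpr hr
  intro htop
  apply hs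
  rw [← top_le_iff]
  calc ∞ = (‖y i‖ₑ - (‖y j‖ₑ + ‖s‖ₑ)) * ∞ := (ENNReal.mul_top hpos).symm
    _ = _ := by rw [← htop, ENNReal.tsum_mul_left.symm]
    _ ≤ _ := ENNReal.tsum_le_tsum key

end

section

variable {ι : Type*} [Fintype ι] [DecidableEq ι]

theorem fam_conv (N : MvPolynomial ι ℂ) (y : ι → ℂ) :
    AbsConvTo (fun K => fam N K * mono y K) (MvPolynomial.eval y N) := by
  let g : (ι →₀ ℕ) → (ι → ℤ) := fun m i => -1 - (m i : ℤ)
  have hg : Function.Injective g := by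
    intro a b h
    ext i
    have := congrFun h i
    simp only [g] at this
    omega
  have hout : ∀ K, K ∉ Set.range g → fam N K * mono y K = 0 := by
    intro K hK
    unfold fam
    split_ifs with h
    · exfalso
      apply hK
      refine ⟨Finsupp.equivFunOnFinite.symm fun i => (-1 - K i).toNat, ?_⟩
      funext i
      have := h i
      simp [g]
      omega
    · simp
  have hval : ∀ m, fam N (g m) * mono y (g m) = N.coeff m * ∏ i, y i ^ m i := by
    intro m
    have h : ∀ i, g m i < 0 := by intro i; simp only [g]; omega
    unfold fam mono
    rw [if_pos h]
    congr 1
    · congr 1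
      ext i
      simp [g]
    · apply Finset.prod_congr rfl
      intro i _
      have : -(g m i) - 1 = (m i : ℤ) := by simp only [g]; ring
      rw [this, zpow_natCast]
  have hz : ∀ m ∉ N.support, N.coeff m * ∏ i, y i ^ m i = 0 := by
    intro m hm
    rw [MvPolynomial.notMem_support_iff.mp hm, zero_mul]
  constructor
  · rw [← hg.summable_iff (by intro K hK; simp only [hout K hK, norm_zero])]
    apply summable_of_ne_finset_zero (s := N.support)
    intro m hm
    simp only [Function.comp]
    rw [hval, hz m hm, norm_zero]
  · rw [← hg.hasSum_iff hout, MvPolynomial.eval_eq']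
    have : ((fun K => fam N K * mono y K) ∘ g) = fun m => N.coeff m * ∏ i, y i ^ m i := by
      funext m
      exact hval m
    rw [this]
    exact hasSum_sum_of_ne_finset_zero hz

omit [Fintype ι] [DecidableEq ι] in
theorem AbsConvTo.unique {f : ι → ℂ} {s t : ℂ} (h : AbsConvTo f s) (h' : AbsConvTo f t) : s = t :=
  h.2.unique h'.2

/-- Iterated boundedness from below: in the order given by the list, each index is bounded
below in terms of the previous ones. -/
def BddL {ι : Type*} (ℓ : List ι) (c : Fam ι) : Prop :=
  ∀ pre i post, ℓ = pre ++ i :: post → ∀ K : ι → ℤ, ∃ k0 : ℤ, ∀ K' : ι → ℤ,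
    (∀ m ∈ pre, K' m = K m) → K' i < k0 → c K' = 0

omit [Fintype ι] in
theorem BddL.act {ℓ : List ι} {c : Fam ι} (h : BddL ℓ c) (p : MvPolynomial ι ℂ) :
    BddL ℓ (act p c) := by
  refine act_induction (BddL ℓ) ?_ ?_ ?_ p c h
  · intro c d hc hd pre i post he K
    obtain ⟨k1, h1⟩ := hc pre i post he K
    obtain ⟨k2, h2⟩ := hd pre i post he K
    refine ⟨min k1 k2, fun K' hK hi => ?_⟩
    simp [h1 K' hK (by omega), h2 K' hK (by omega)]
  · intro a c hc pre i post he K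
    obtain ⟨k1, h1⟩ := hc pre i post he K
    refine ⟨k1, fun K' hK hi => ?_⟩
    simp [h1 K' hK hi]
  · intro j c hc pre i post he K
    obtain ⟨k1, h1⟩ := hc pre i post he (K + Pi.single j 1)
    refine ⟨k1 - 1, fun K' hK hi => h1 _ ?_ ?_⟩
    · intro m hm
      simp [hK m hm]
    · by_cases hij : i = j
      · subst hij; simp; omega
      · simp [hij]; omega

omit [Fintype ι] [DecidableEq ι] in
theorem BddL.pb {ℓ : List ι} {c : Fam ι} (h : BddL ℓ c) (hn : ℓ.Nodup) {pre : List ι} {i : ι}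
    {post : List ι} (he : ℓ = pre ++ i :: post) {j : ι} (hj : j ∈ post) : PB i j c := by
  intro K
  obtain ⟨k0, hk⟩ := h pre i post he K
  refine ⟨k0, fun K' hK hi => hk K' ?_ hi⟩
  intro m hm
  rw [he, List.nodup_append] at hn
  apply hK
  · exact hn.2.2 m hm i (by simp)
  · exact hn.2.2 m hm j (by simp [hj])

omit [Fintype ι] [DecidableEq ι] in
theorem before_cases {ℓ : List ι} {i j : ι} (hi : i ∈ ℓ) (hj : j ∈ ℓ) (hij : i ≠ j) :
    (∃ pre post, ℓ = pre ++ i :: post ∧ j ∈ post) ∨ (∃ pre post, ℓ = pre ++ j :: post ∧ i ∈ post) := by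
  obtain ⟨pre, post, rfl⟩ := List.append_of_mem hi
  simp only [List.mem_append, List.mem_cons, hij.symm, false_or] at hj
  rcases hj with hj | hj
  · right
    obtain ⟨p1, p2, rfl⟩ := List.append_of_mem hj
    exact ⟨p1, p2 ++ i :: post, by simp, by simp⟩
  · left
    exact ⟨pre, post, rfl, hj⟩

theorem fam_of_neg {ℓ : List ι} (hmem : ∀ i, i ∈ ℓ) {c : Fam ι} (h : BddL ℓ c)
    (hneg : NegOrthant c) : ∃ N, fam N = c := by
  apply exists_fam c hneg
  have key : ∀ pre post : List ι, ℓ = pre ++ post →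
      ((fun (K : ι → ℤ) (m : ι) => if m ∈ pre then K m else 0) '' Function.support c).Finite := by
    intro pre
    induction pre using List.reverseRecOn with
    | nil =>
      intro post _
      apply Set.Finite.subset (Set.finite_singleton (0 : ι → ℤ))
      rintro _ ⟨K, _, rfl⟩
      simp [funext_iff]
    | append_singleton pre i ih =>
      intro post he
      have he' : ℓ = pre ++ i :: post := by simpa using he
      choose k0 hk0 using h pre i post he'
      have hfin := ih (i :: post) he'
      have : (⋃ s ∈ ((fun (K : ι → ℤ) (m : ι) => if m ∈ pre then K m else 0) '' Function.support c),
          ((fun k => Function.update s i k) '' (Set.Icc (k0 s) (-1)))).Finite :=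
        hfin.biUnion fun s _ => (Set.finite_Icc _ _).image _
      refine this.subset ?_
      rintro _ ⟨K, hK, rfl⟩
      simp only [Set.mem_iUnion]
      refine ⟨_, ⟨K, hK, rfl⟩, K i, ⟨?_, ?_⟩, ?_⟩
      · by_contra hcon
        apply hK
        refine hk0 (fun m => if m ∈ pre then K m else 0) K ?_ ?_
        · intro m hm
          simp [hm]
        · exact not_le.mp hcon
      · by_contra hcon
        exact hK (hneg K i (by omega))
      · funext m
        by_cases hm : m = i
        · subst hm; simp
        · simp [hm]
  have := key ℓ [] (by simp)
  have e : (fun (K : ι → ℤ) (m : ι) => if m ∈ ℓ then K m else 0) = id := by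
    funext K m
    simp [hmem m]
  rw [e, Set.image_id] at this
  exact this

/-- Translation of the variables. -/
def trans (cen : ι → ℂ) : MvPolynomial ι ℂ →ₐ[ℂ] MvPolynomial ι ℂ :=
  MvPolynomial.aeval fun i => MvPolynomial.X i + MvPolynomial.C (cen i)

omit [Fintype ι] [DecidableEq ι] in
theorem eval_trans (cen x : ι → ℂ) (p : MvPolynomial ι ℂ) :
    MvPolynomial.eval x (trans cen p) = MvPolynomial.eval (fun i => x i + cen i) p := by
  induction p using MvPolynomial.induction_on with
  | C a => simp [trans]
  | add p q hp hq => simp [hp, hq]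
  | mul_X p i hp => rw [map_mul, map_mul, map_mul, hp]; simp [trans]

/-- The total denominator. -/
def den (M : ι → ι → ℕ) : MvPolynomial ι ℂ :=
  ∏ q ∈ Finset.univ.offDiag, (MvPolynomial.X q.1 - MvPolynomial.X q.2) ^ M q.1 q.2

omit [DecidableEq ι] in
theorem eval_den (M : ι → ι → ℕ) (z : ι → ℂ) :
    MvPolynomial.eval z (den M) = ∏ q ∈ Finset.univ.offDiag, (z q.1 - z q.2) ^ M q.1 q.2 := by
  simp [den]

theorem eval_den_ne_zero (M : ι → ι → ℕ) (z : ι → ℂ) (hz : Conf z) :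
    MvPolynomial.eval z (den M) ≠ 0 := by
  rw [eval_den, Finset.prod_ne_zero_iff]
  intro q hq
  simp only [Finset.mem_offDiag] at hq
  exact pow_ne_zero _ (sub_ne_zero.mpr (hz _ _ hq.2.2))

theorem den_dvd (M : ι → ι → ℕ) {i j : ι} (hij : i ≠ j) :
    ∃ p, den M = p * (MvPolynomial.X i - MvPolynomial.X j) ^ M i j := by
  have : (i, j) ∈ (Finset.univ.offDiag : Finset (ι × ι)) := by simp [hij]
  unfold den
  rw [← Finset.prod_erase_mul _ _ this]
  exact ⟨_, rfl⟩

/-- The region of convergence, in the order given by a list. -/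
def Region (cen x : ι → ℂ) (ℓ : List ι) : Prop :=
  ℓ.Pairwise fun i j => ‖x j‖ + ‖cen j - cen i‖ < ‖x i‖

omit [Fintype ι] in
theorem Region.conf {cen x : ι → ℂ} {ℓ : List ι} (h : Region cen x ℓ) (hmem : ∀ i, i ∈ ℓ) :
    Conf fun i => x i + cen i := by
  have key : ∀ i j : ι, ‖x j‖ + ‖cen j - cen i‖ < ‖x i‖ → x i + cen i ≠ x j + cen j := by
    intro i j h he
    have : x i = x j + (cen j - cen i) := by linear_combination he
    rw [this] at h
    exact absurd (norm_add_le (x j) (cen j - cen i)) (not_le.mpr h)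
  intro i j hij
  rcases before_cases (hmem i) (hmem j) hij with ⟨pre, post, rfl, hj⟩ | ⟨pre, post, rfl, hj⟩
  · exact key i j ((List.pairwise_cons.mp (List.pairwise_append.mp h).2.1).1 j hj)
  · exact (key j i ((List.pairwise_cons.mp (List.pairwise_append.mp h).2.1).1 i hj)).symm

theorem conv_main {ℓ : List ι} (hn : ℓ.Nodup) (hmem : ∀ i, i ∈ ℓ) (M : ι → ι → ℕ) (c : Fam ι)
    (hc : BddL ℓ c) (cen x : ι → ℂ) (hx : Region cen x ℓ) (hz : NZ x c) (N : MvPolynomial ι ℂ)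
    (hN : act (trans cen (den M)) c = fam (trans cen N)) :
    AbsConvTo (fun K => c K * mono x K)
      (MvPolynomial.eval (fun i => x i + cen i) N /
        MvPolynomial.eval (fun i => x i + cen i) (den M)) := by
  let Good : MvPolynomial ι ℂ → Prop := fun p => ∀ c, BddL ℓ c → NZ x c →
    (Summable fun K => ‖act p c K * mono x K‖) → Summable fun K => ‖c K * mono x K‖
  have hmul : ∀ p q, Good p → Good q → Good (p * q) := by
    intro p q hp hq c hc hz h
    rw [act_mul] at h
    exact hq c hc hz (hp _ (hc.act q) (hz.act q) h)
  have hone : Good 1 := by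
    intro c hc hz h
    rwa [act_one] at h
  have hbase : ∀ pre i post j, ℓ = pre ++ i :: post → j ∈ post →
      Good (MvPolynomial.X i - MvPolynomial.X j - MvPolynomial.C (cen j - cen i)) := by
    intro pre i post j he hj c hc hz h
    refine summable_of_factor i j ?_ _ x ?_ c (hc.pb hn he hj) hz h
    · rintro rfl
      rw [he, List.nodup_append] at hn
      exact (List.nodup_cons.mp hn.2.1).1 hj
    · unfold Region at hx
      rw [he] at hx
      exact (List.pairwise_cons.mp (List.pairwise_append.mp hx).2.1).1 j hj
  have hneg : ∀ p, Good p → Good (-p) := by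
    intro p hp c hc hz h
    apply hp c hc hz
    simpa [act_neg] using h
  have hpair : ∀ i j, i ≠ j → Good (trans cen (MvPolynomial.X i - MvPolynomial.X j)) := by
    intro i j hij
    rcases before_cases (hmem i) (hmem j) hij with ⟨pre, post, he, hj⟩ | ⟨pre, post, he, hj⟩
    · have := hbase pre i post j he hj
      convert this using 1
      simp [trans]
      ring
    · have := hneg _ (hbase pre j post i he hj)
      convert this using 1
      simp [trans]
      ring
  have hden : Good (trans cen (den M)) := by
    unfold den
    rw [map_prod]
    refine Finset.prod_induction _ Good hmul hone ?_
    intro q hq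
    rw [map_pow]
    have h1 := hpair q.1 q.2 (by simpa using hq)
    generalize M q.1 q.2 = n
    induction n with
    | zero => simpa using hone
    | succ n ih => rw [pow_succ]; exact hmul _ _ ih h1
  have hfam := fam_conv (trans cen N) x
  have hsum : Summable fun K => ‖c K * mono x K‖ := by
    apply hden c hc hz
    rw [hN]
    exact hfam.1
  obtain ⟨s, hs⟩ := hsum.of_norm
  have hs' : AbsConvTo (fun K => c K * mono x K) s := ⟨hsum, hs⟩
  have h1 := conv_act x (trans cen (den M)) c hz s hs'
  rw [hN] at h1
  have h2 := h1.2.unique hfam.2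
  rw [eval_trans, eval_trans] at h2
  have hne := eval_den_ne_zero M _ (hx.conf hmem)
  rw [← h2, mul_comm, mul_div_assoc, div_self hne, mul_one]
  exact hs'

end

section

variable {ι : Type*} [DecidableEq ι]

/-- Formal differentiation of a family in the variable `i`. -/
def del (i : ι) : Module.End ℂ (Fam ι) where
  toFun c := fun K => -(K i : ℂ) * c (K - Pi.single i 1)
  map_add' c d := by funext K; simp [mul_add]
  map_smul' a c := by funext K; simp; ring

theorem del_apply (i : ι) (c : Fam ι) (K : ι → ℤ) :
    del i c K = -(K i : ℂ) * c (K - Pi.single i 1) := rfl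

theorem del_X (i j : ι) (c : Fam ι) :
    del i (act (MvPolynomial.X j) c) =
      act (MvPolynomial.X j) (del i c) + if i = j then c else 0 := by
  funext K
  simp only [del_apply, act_X, Pi.add_apply]
  have e : K - Pi.single i 1 + Pi.single j (1 : ℤ) = K + Pi.single j 1 - Pi.single i 1 := by abel
  rw [e]
  split_ifs with h
  · subst h
    simp
    ring
  · simp [h]

/-- The operator `T` is locally nilpotent on `c`. -/
def LN (T : Module.End ℂ (Fam ι)) (c : Fam ι) : Prop :=
  ∀ K, ∃ n0 : ℕ, ∀ n, n0 ≤ n → (T ^ n) c K = 0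

/-- The exponential of a locally nilpotent operator. -/
def expT (T : Module.End ℂ (Fam ι)) (c : Fam ι) : Fam ι := fun K =>
  ∑ᶠ n : ℕ, ((n.factorial : ℂ))⁻¹ * (T ^ n) c K

theorem expT_eq_sum (T : Module.End ℂ (Fam ι)) (c : Fam ι) (K : ι → ℤ) (n0 : ℕ)
    (h : ∀ n, n0 ≤ n → (T ^ n) c K = 0) :
    expT T c K = ∑ n ∈ Finset.range n0, ((n.factorial : ℂ))⁻¹ * (T ^ n) c K := by
  apply finsum_eq_sum_of_support_subset
  intro n hn
  simp only [Function.mem_support] at hn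
  simp only [Finset.coe_range, Set.mem_Iio]
  by_contra hcon
  exact hn (by rw [h n (not_lt.mp hcon), mul_zero])

theorem LN.add {T : Module.End ℂ (Fam ι)} {c d : Fam ι} (hc : LN T c) (hd : LN T d) :
    LN T (c + d) := by
  intro K
  obtain ⟨n, hn⟩ := hc K
  obtain ⟨m, hm⟩ := hd K
  refine ⟨max n m, fun k hk => ?_⟩
  rw [map_add, Pi.add_apply, hn k (le_trans (le_max_left _ _) hk),
    hm k (le_trans (le_max_right _ _) hk), add_zero]

theorem LN.smul {T : Module.End ℂ (Fam ι)} {c : Fam ι} (hc : LN T c) (a : ℂ) :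
    LN T (a • c) := by
  intro K
  obtain ⟨n, hn⟩ := hc K
  exact ⟨n, fun k hk => by rw [map_smul, Pi.smul_apply, hn k hk, smul_zero]⟩

theorem expT_add {T : Module.End ℂ (Fam ι)} {c d : Fam ι} (hc : LN T c) (hd : LN T d) :
    expT T (c + d) = expT T c + expT T d := by
  funext K
  obtain ⟨n, hn⟩ := hc K
  obtain ⟨m, hm⟩ := hd K
  have h1 : ∀ k, max n m ≤ k → (T ^ k) c K = 0 := fun k hk => hn k (le_trans (le_max_left _ _) hk)
  have h2 : ∀ k, max n m ≤ k → (T ^ k) d K = 0 := fun k hk => hm k (le_trans (le_max_right _ _) hk)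
  rw [Pi.add_apply, expT_eq_sum T c K _ h1, expT_eq_sum T d K _ h2, expT_eq_sum T (c + d) K (max n m),
    ← Finset.sum_add_distrib]
  · apply Finset.sum_congr rfl
    intro k _
    rw [map_add, Pi.add_apply, mul_add]
  · intro k hk
    rw [map_add, Pi.add_apply, h1 k hk, h2 k hk, add_zero]

theorem expT_smul {T : Module.End ℂ (Fam ι)} {c : Fam ι} (a : ℂ) :
    expT T (a • c) = a • expT T c := by
  funext K
  simp only [expT, map_smul, Pi.smul_apply, smul_eq_mul]
  rw [← smul_eq_mul a, smul_finsum]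
  exact finsum_congr fun n => by rw [smul_eq_mul]; ring

variable {T : Module.End ℂ (Fam ι)} {g : ι → MvPolynomial ι ℂ}

theorem pow_X (hT : ∀ i c, T (act (MvPolynomial.X i) c) = act (MvPolynomial.X i) (T c) + act (g i) c)
    (hg : ∀ i c, T (act (g i) c) = act (g i) (T c)) (i : ι) (c : Fam ι) (n : ℕ) :
    (T ^ (n + 1)) (act (MvPolynomial.X i) c) =
      act (MvPolynomial.X i) ((T ^ (n + 1)) c) + ((n : ℂ) + 1) • act (g i) ((T ^ n) c) := by
  induction n with
  | zero => simp [hT]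
  | succ n ih =>
    have h1 : ∀ m : ℕ, ∀ d, (T ^ (m + 1)) d = T ((T ^ m) d) := by
      intro m d; rw [pow_succ', Module.End.mul_apply]
    rw [h1 (n + 1), ih, map_add, hT, map_smul, hg, ← h1 n, ← h1 (n + 1)]
    push_cast
    module

theorem LN_shift {c : Fam ι} (hc : ∀ K, ∃ n0 : ℕ, ∀ n, n0 ≤ n → (T ^ n) c K = 0)
    (p : MvPolynomial ι ℂ) (K : ι → ℤ) :
    ∃ n0 : ℕ, ∀ n, n0 ≤ n → act p ((T ^ n) c) K = 0 := by
  induction p using MvPolynomial.induction_on generalizing K with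
  | C a =>
    obtain ⟨n0, h⟩ := hc K
    exact ⟨n0, fun n hn => by rw [act_C, h n hn, mul_zero]⟩
  | add p q hp hq =>
    obtain ⟨n, hn⟩ := hp K
    obtain ⟨m, hm⟩ := hq K
    exact ⟨max n m, fun k hk => by
      rw [act_add, Pi.add_apply, hn k (le_trans (le_max_left _ _) hk),
        hm k (le_trans (le_max_right _ _) hk), add_zero]⟩
  | mul_X p i hp =>
    obtain ⟨n, hn⟩ := hp (K + Pi.single i 1)
    refine ⟨n, fun k hk => ?_⟩
    rw [mul_comm, act_mul, act_X]
    exact hn k hk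

theorem LN_X (hT : ∀ i c, T (act (MvPolynomial.X i) c) = act (MvPolynomial.X i) (T c) + act (g i) c)
    (hg : ∀ i c, T (act (g i) c) = act (g i) (T c)) (i : ι) {c : Fam ι} (hc : LN T c) :
    LN T (act (MvPolynomial.X i) c) := by
  intro K
  obtain ⟨n, hn⟩ := LN_shift hc (MvPolynomial.X i) K
  obtain ⟨m, hm⟩ := LN_shift hc (g i) K
  refine ⟨max n m + 1, fun k hk => ?_⟩
  obtain ⟨k, rfl⟩ : ∃ k', k = k' + 1 := ⟨k - 1, by omega⟩
  rw [pow_X hT hg, Pi.add_apply, Pi.smul_apply, hn _ (by omega), hm _ (by omega), smul_zero, add_zero]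

theorem LN.act (hT : ∀ i c, T (act (MvPolynomial.X i) c) = act (MvPolynomial.X i) (T c) + act (g i) c)
    (hg : ∀ i c, T (act (g i) c) = act (g i) (T c)) (p : MvPolynomial ι ℂ) {c : Fam ι}
    (hc : LN T c) : LN T (act p c) := by
  refine act_induction (LN T) (fun _ _ h h' => h.add h') (fun a _ h => h.smul a) ?_ p c hc
  intro i c hc
  have := LN_X hT hg i hc
  have e : VA.act (MvPolynomial.X i) c = fun K => c (K + Pi.single i 1) := by funext K; rw [act_X]
  rwa [e] at this

theorem expT_X (hT : ∀ i c, T (act (MvPolynomial.X i) c) = act (MvPolynomial.X i) (T c) + act (g i) c)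
    (hg : ∀ i c, T (act (g i) c) = act (g i) (T c)) (i : ι) {c : Fam ι} (hc : LN T c) :
    expT T (act (MvPolynomial.X i) c) = act (MvPolynomial.X i + g i) (expT T c) := by
  funext K
  -- finite truncation valid for all indices met by the polynomial
  have key : ∀ p : MvPolynomial ι ℂ, ∃ n0 : ℕ, ∀ n1, n0 ≤ n1 → act p (expT T c) K =
      ∑ n ∈ Finset.range n1, ((n.factorial : ℂ))⁻¹ * act p ((T ^ n) c) K := by
    intro p
    induction p using MvPolynomial.induction_on generalizing K with
    | C a =>
      obtain ⟨n0, h⟩ := hc K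
      refine ⟨n0, fun n1 hn1 => ?_⟩
      rw [act_C, expT_eq_sum T c K n1 (fun n hn => h n (hn1.trans hn)), Finset.mul_sum]
      apply Finset.sum_congr rfl
      intro n _
      rw [act_C]; ring
    | add p q hp hq =>
      obtain ⟨n, hn⟩ := hp K
      obtain ⟨m, hm⟩ := hq K
      refine ⟨max n m, fun k hk => ?_⟩
      rw [act_add, Pi.add_apply, hn k (le_trans (le_max_left _ _) hk),
        hm k (le_trans (le_max_right _ _) hk), ← Finset.sum_add_distrib]
      apply Finset.sum_congr rfl
      intro n _
      rw [act_add, Pi.add_apply]; ring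
    | mul_X p i hp =>
      obtain ⟨n, hn⟩ := hp (K + Pi.single i 1)
      refine ⟨n, fun k hk => ?_⟩
      rw [mul_comm, act_mul, act_X, hn k hk]
      apply Finset.sum_congr rfl
      intro n _
      rw [act_mul, act_X]
  obtain ⟨n1, h1⟩ := key (MvPolynomial.X i)
  obtain ⟨n2, h2⟩ := key (g i)
  obtain ⟨n3, h3⟩ := LN_X hT hg i hc K
  set n := max (max n1 n2) n3 with hn
  rw [act_add, Pi.add_apply, h1 (n + 1) (by omega), h2 n (by omega),
    expT_eq_sum T _ K (n + 1) (fun k hk => h3 k (by omega)), Finset.sum_range_succ',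
    Finset.sum_range_succ' _ n, add_right_comm, ← Finset.sum_add_distrib]
  simp only [pow_zero, Module.End.one_apply]
  congr 1
  apply Finset.sum_congr rfl
  intro k _
  rw [pow_X hT hg, Pi.add_apply, mul_add, Pi.smul_apply, smul_eq_mul, Nat.factorial_succ]
  congr 1
  have : ((k : ℂ) + 1) ≠ 0 := by exact_mod_cast Nat.succ_ne_zero k
  push_cast
  field_simp

/-- The exponential intertwines the actions of `p` and of its substitution. -/
theorem expT_act (hT : ∀ i c, T (act (MvPolynomial.X i) c) = act (MvPolynomial.X i) (T c) + act (g i) c)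
    (hg : ∀ i c, T (act (g i) c) = act (g i) (T c)) (p : MvPolynomial ι ℂ) {c : Fam ι}
    (hc : LN T c) :
    expT T (act p c) = act (MvPolynomial.aeval (fun i => MvPolynomial.X i + g i) p) (expT T c) := by
  induction p using MvPolynomial.induction_on generalizing c with
  | C a =>
    have e : ∀ d : Fam ι, act (MvPolynomial.C a) d = a • d := by
      intro d; funext K; rw [act_C]; rfl
    rw [MvPolynomial.aeval_C, MvPolynomial.algebraMap_eq, e, e, expT_smul]
  | add p q hp hq =>
    rw [act_add, expT_add (hc.act hT hg p) (hc.act hT hg q), hp hc, hq hc, map_add, act_add]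
  | mul_X p i hp =>
    rw [act_mul, hp (LN_X hT hg i hc), expT_X hT hg i hc, map_mul, MvPolynomial.aeval_X, act_mul]

theorem act_fam [Fintype ι] (p q : MvPolynomial ι ℂ) : act p (fam q) = fam (p * q) := by
  have hC : ∀ a : ℂ, ∀ q : MvPolynomial ι ℂ, act (MvPolynomial.C a) (fam q) = fam (MvPolynomial.C a * q) := by
    intro a q
    funext K
    rw [act_C]
    unfold fam
    split_ifs <;> simp [MvPolynomial.coeff_C_mul]
  have hadd : ∀ p q : MvPolynomial ι ℂ, fam (p + q) = fam p + fam q := by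
    intro p q
    funext K
    simp only [fam, Pi.add_apply, MvPolynomial.coeff_add]
    split_ifs <;> simp
  induction p using MvPolynomial.induction_on generalizing q with
  | C a => exact hC a q
  | add p p' hp hp' => rw [act_add, hp, hp', add_mul, hadd]
  | mul_X p i hp =>
    rw [act_mul]
    have : act (MvPolynomial.X i) (fam q) = fam (MvPolynomial.X i * q) := by
      funext K
      rw [act_X]
      unfold fam
      by_cases h : ∀ j, K j < 0
      · rw [if_pos h, MvPolynomial.coeff_X_mul']
        by_cases h1 : K i = -1
        · rw [if_neg, if_neg]
          · simp [h1]
          · intro hh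
            have := hh i
            simp [h1] at this
        · have hi := h i
          have h2 : ∀ j, (K + Pi.single i (1 : ℤ) : ι → ℤ) j < 0 := by
            intro j
            by_cases hj : j = i
            · subst hj; simp; omega
            · simp [hj, h j]
          rw [if_pos h2, if_pos (by simp; omega)]
          congr 1
          ext j
          by_cases hj : j = i
          · subst hj; simp; omega
          · simp [hj]
      · rw [if_neg h, if_neg]
        intro hh
        apply h
        intro j
        have := hh j
        by_cases hj : j = i
        · subst hj; simp at this; omega
        · simpa [hj] using this
    rw [this, hp, mul_assoc]

theorem expT_fam [Fintype ι]
    (hT : ∀ i c, T (act (MvPolynomial.X i) c) = act (MvPolynomial.X i) (T c) + act (g i) c)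
    (hg : ∀ i c, T (act (g i) c) = act (g i) (T c)) (h1 : T (fam 1) = 0) (p : MvPolynomial ι ℂ) :
    expT T (fam p) = fam (MvPolynomial.aeval (fun i => MvPolynomial.X i + g i) p) := by
  have hz : ∀ n : ℕ, 1 ≤ n → ∀ K, (T ^ n) (fam 1) K = 0 := by
    intro n hn K
    obtain ⟨n, rfl⟩ : ∃ m, n = m + 1 := ⟨n - 1, by omega⟩
    rw [pow_succ, Module.End.mul_apply, h1, map_zero]; rfl
  have h2 : expT T (fam 1) = fam 1 := by
    funext K
    rw [expT_eq_sum T _ K 1 (fun n hn => hz n hn K)]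
    simp
  have := expT_act hT hg p (c := fam 1) (fun K => ⟨1, fun n hn => hz n hn K⟩)
  rwa [act_fam, h2, act_fam, mul_one, mul_one] at this

theorem del_fam_one [Fintype ι] (i : ι) : del i (fam 1) = 0 := by
  funext K
  rw [del_apply]
  unfold fam
  by_cases hK : K i = 0
  · simp [hK]
  · split_ifs with h
    · rw [MvPolynomial.coeff_one, if_neg]
      · simp
      · intro hh
        have h3 := h i
        have h2 := DFunLike.congr_fun hh i
        simp at h2 h3
        omega
    · simp

end

section

open UnitAddTorus in
theorem mFourier_unique_of_orthonormal {ι : Type*} [Fintype ι] {H : Type*} [NormedAddCommGroup H]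
    [InnerProductSpace ℂ H] (L : C(UnitAddTorus ι, ℂ) →L[ℂ] H)
    (hL : Orthonormal ℂ fun n => L (mFourier n)) (a : (ι → ℤ) → ℂ) (hs : Summable fun n => ‖a n‖)
    (h0 : ∀ x : UnitAddTorus ι, HasSum (fun n => a n * mFourier n x) 0) : a = 0 := by
  have hsum : Summable fun n => a n • mFourier (d := ι) n := by
    apply Summable.of_norm
    simpa [norm_smul, mFourier_norm] using hs
  obtain ⟨F, hF⟩ := hsum
  have hF0 : F = 0 := by
    ext x
    have := (ContinuousMap.evalCLM ℂ x).hasSum hF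
    simp only [map_smul, smul_eq_mul] at this
    exact this.unique (h0 x)
  subst hF0
  have h2 := L.hasSum hF
  simp only [map_smul, map_zero] at h2
  funext m
  have h3 := (innerSL ℂ (L (mFourier m))).hasSum h2
  rw [map_zero] at h3
  have h4 : (fun n => innerSL ℂ (L (mFourier m)) (a n • L (mFourier n))) =
      fun n => if n = m then a m else 0 := by
    funext n
    rw [map_smul, innerSL_apply_apply, orthonormal_iff_ite.mp hL m n]
    by_cases h : n = m
    · subst h; simp
    · simp [h, Ne.symm h]
  rw [h4] at h3
  exact (hasSum_ite_eq m (a m)).unique h3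

open UnitAddTorus in
theorem mFourier_unique {ι : Type*} [Fintype ι] (a : (ι → ℤ) → ℂ) (hs : Summable fun n => ‖a n‖)
    (h0 : ∀ x : UnitAddTorus ι, HasSum (fun n => a n * mFourier n x) 0) : a = 0 := by
  have h := orthonormal_mFourier (d := ι)
  unfold mFourierLp at h
  exact mFourier_unique_of_orthonormal _ h a hs h0

theorem laurent_unique {ι : Type*} [Fintype ι] (r : ι → ℝ) (hr : ∀ i, 0 < r i) (c : Fam ι)
    (h : ∀ z : ι → ℂ, (∀ i, ‖z i‖ = r i) → AbsConvTo (fun K => c K * mono z K) 0) : c = 0 := by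
  let e : (ι → ℤ) ≃ (ι → ℤ) := Equiv.piCongrRight fun _ => (Equiv.neg ℤ).trans (Equiv.addRight (-1))
  have he : ∀ n i, -(e n i) - 1 = n i := by intro n i; simp [e]
  have key : (fun n => c (e n) * ∏ i, (r i : ℂ) ^ n i) = 0 := by
    apply mFourier_unique
    · have := (h (fun i => (r i : ℂ)) (fun i => by simp [abs_of_pos (hr i)])).1
      rw [← e.summable_iff] at this
      simpa [Function.comp_def, mono, he] using this
    · intro x
      have := (h (fun i => (r i : ℂ) * (AddCircle.toCircle (x i) : ℂ))
        (fun i => by rw [norm_mul, Circle.norm_coe]; simp [abs_of_pos (hr i)])).2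
      rw [← e.hasSum_iff] at this
      convert this using 1
      funext n
      simp only [Function.comp_def, mono, he, UnitAddTorus.mFourier, ContinuousMap.coe_mk, fourier_apply]
      rw [mul_assoc, ← Finset.prod_mul_distrib]
      congr 1
      apply Finset.prod_congr rfl
      intro i _
      rw [mul_zpow, AddCircle.toCircle_zsmul]
      simp
  funext K
  have := congrFun key (e.symm K)
  simp only [Equiv.apply_symm_apply, Pi.zero_apply, mul_eq_zero, Finset.prod_eq_zero_iff] at this
  rcases this with h | ⟨i, _, h⟩
  · exact h
  · exact absurd h (zpow_ne_zero _ (by exact_mod_cast (hr i).ne'))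

end

section

open MvPolynomial in
/-- The denominator polynomial of a rational function. -/
def RatFn.denP {ι : Type*} [Fintype ι] [DecidableEq ι] (R : RatFn ι) : MvPolynomial ι ℂ :=
  (∏ i, X i ^ R.a i) * ∏ q ∈ Finset.univ.offDiag, (X q.1 - X q.2) ^ R.b q.1 q.2

theorem RatFn.eval_eq {ι : Type*} [Fintype ι] [DecidableEq ι] (R : RatFn ι) (z : ι → ℂ) :
    R.eval z = MvPolynomial.eval z R.num / MvPolynomial.eval z R.denP := by
  simp [RatFn.eval, RatFn.denP]

theorem RatFn.denP_ne_zero {ι : Type*} [Fintype ι] [DecidableEq ι] (R : RatFn ι) (z : ι → ℂ)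
    (hz : ∀ i, z i ≠ 0) (hc : Conf z) : MvPolynomial.eval z R.denP ≠ 0 := by
  simp only [RatFn.denP, map_mul, map_prod, map_pow, map_sub, MvPolynomial.eval_X, ne_eq,
    mul_eq_zero, Finset.prod_eq_zero_iff, not_or, not_exists, not_and]
  refine ⟨fun i _ => pow_ne_zero _ (hz i), fun q hq => pow_ne_zero _ ?_⟩
  simp only [Finset.mem_offDiag] at hq
  exact sub_ne_zero.mpr (hc _ _ hq.2.2)

theorem RatFn.eval_mul {ι : Type*} [Fintype ι] [DecidableEq ι] (R : RatFn ι) (z : ι → ℂ)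
    (hz : ∀ i, z i ≠ 0) (hc : Conf z) :
    MvPolynomial.eval z R.denP * R.eval z = MvPolynomial.eval z R.num := by
  rw [R.eval_eq, mul_div_cancel₀ _ (R.denP_ne_zero z hz hc)]

theorem conf_two {z₁ z₂ : ℂ} (h : z₁ ≠ z₂) : Conf ![z₁, z₂] := by
  intro i j hij
  fin_cases i <;> fin_cases j <;> simp_all [Ne.symm h]

theorem poly_eq_of_annuli (p q : MvPolynomial (Fin 2) ℂ)
    (h : ∀ z₁ z₂ : ℂ, 0 < ‖z₂‖ → ‖z₂‖ < ‖z₁‖ →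
      MvPolynomial.eval ![z₁, z₂] p = MvPolynomial.eval ![z₁, z₂] q) : p = q := by
  refine MvPolynomial.funext_set
    ![(fun t : ℝ => (t : ℂ)) '' Set.Ioo 1 2, (fun t : ℝ => (t : ℂ)) '' Set.Ioo 0 1] ?_ ?_
  · intro i
    have hinj : Function.Injective (fun t : ℝ => (t : ℂ)) := Complex.ofReal_injective
    fin_cases i
    · exact (Set.Ioo_infinite (by norm_num)).image hinj.injOn
    · exact (Set.Ioo_infinite (by norm_num)).image hinj.injOn
  · intro x hx
    obtain ⟨s, hs, hs'⟩ := hx 0 (Set.mem_univ _)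
    obtain ⟨t, ht, ht'⟩ := hx 1 (Set.mem_univ _)
    have hx' : x = ![x 0, x 1] := by
      funext i; fin_cases i <;> rfl
    simp only [Set.mem_Ioo] at hs ht
    have hs0 : 0 < s := by linarith
    show MvPolynomial.eval x p = MvPolynomial.eval x q
    rw [hx']
    apply h
    · rw [← ht']; simpa using ht.1.ne'
    · rw [← ht', ← hs']
      simp only [Complex.norm_real, Real.norm_eq_abs, abs_of_pos ht.1, abs_of_pos hs0]
      linarith

/-- A doubly indexed sequence as a family. -/
def fam2 (f : ℤ → ℤ → ℂ) : Fam (Fin 2) := fun K => f (K 0) (K 1)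

theorem absConv_fam2 (f : ℤ → ℤ → ℂ) (z₁ z₂ s : ℂ) :
    AbsConvTo (fun k : ℤ × ℤ => f k.1 k.2 * z₁ ^ (-k.1 - 1) * z₂ ^ (-k.2 - 1)) s ↔
      AbsConvTo (fun K => fam2 f K * mono ![z₁, z₂] K) s := by
  have : (fun K => fam2 f K * mono ![z₁, z₂] K) =
      (fun k : ℤ × ℤ => f k.1 k.2 * z₁ ^ (-k.1 - 1) * z₂ ^ (-k.2 - 1)) ∘ finTwoArrowEquiv ℤ := by
    funext K
    simp [fam2, mono, Fin.prod_univ_two, finTwoArrowEquiv, mul_assoc]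
  rw [this]
  unfold AbsConvTo
  rw [(finTwoArrowEquiv ℤ).hasSum_iff, ← (finTwoArrowEquiv ℤ).summable_iff]
  rfl

/-- The operator `X₁ ∂₀`. -/
def T2 : Module.End ℂ (Fam (Fin 2)) := act (MvPolynomial.X 1) * del 0

/-- The increments of the substitution `X₀ ↦ X₀ + X₁`. -/
def g2 : Fin 2 → MvPolynomial (Fin 2) ℂ := ![MvPolynomial.X 1, 0]

theorem T2_X (i : Fin 2) (c : Fam (Fin 2)) :
    T2 (act (MvPolynomial.X i) c) = act (MvPolynomial.X i) (T2 c) + act (g2 i) c := by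
  simp only [T2, Module.End.mul_apply, del_X, map_add]
  rw [act_comm]
  fin_cases i <;> simp [g2]

theorem T2_g (i : Fin 2) (c : Fam (Fin 2)) : T2 (act (g2 i) c) = act (g2 i) (T2 c) := by
  fin_cases i
  · have := T2_X 1 c
    simpa [g2] using this
  · simp [g2]

theorem T2_fam_one : T2 (fam 1) = 0 := by
  rw [T2, Module.End.mul_apply, del_fam_one, map_zero]

theorem T2_pow (c : Fam (Fin 2)) (n : ℕ) (K : Fin 2 → ℤ) :
    (T2 ^ n) c K = (∏ m ∈ Finset.range n, (-((K 0 : ℂ) - m))) * c ![K 0 - n, K 1 + n] := by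
  induction n generalizing c K with
  | zero =>
    simp
    congr 1
    funext i; fin_cases i <;> rfl
  | succ n ih =>
    rw [pow_succ, Module.End.mul_apply, ih]
    have : ∀ K, T2 c K = -(K 0 : ℂ) * c ![K 0 - 1, K 1 + 1] := by
      intro K
      rw [T2, Module.End.mul_apply, act_X, del_apply]
      have e : (K + Pi.single 1 1 - Pi.single 0 1 : Fin 2 → ℤ) = ![K 0 - 1, K 1 + 1] := by
        funext i; fin_cases i <;> simp
      rw [e]
      simp
    rw [this, Finset.prod_range_succ, mul_assoc]
    congr 1
    simp
    left
    congr 1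
    funext i; fin_cases i <;> simp <;> ring

theorem LN_T2 (f : ℤ → ℤ → ℂ) (hf : ∃ N : ℤ, ∀ j k, N ≤ k → f j k = 0) : LN T2 (fam2 f) := by
  obtain ⟨N, hN⟩ := hf
  intro K
  refine ⟨(N - K 1).toNat, fun n hn => ?_⟩
  rw [T2_pow]
  have : fam2 f ![K 0 - n, K 1 + n] = 0 := hN _ _ (by simp; omega)
  rw [this, mul_zero]

theorem act_X_cancel {ι : Type*} [DecidableEq ι] (i : ι) (n : ℕ) (c : Fam ι)
    (h : act (MvPolynomial.X i ^ n) c = 0) : c = 0 := by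
  induction n with
  | zero => rwa [pow_zero, act_one] at h
  | succ n ih =>
    apply ih
    rw [pow_succ', act_mul] at h
    funext K
    have := congrFun h (K - Pi.single i 1)
    rw [act_X, sub_add_cancel] at this
    exact this

theorem act_eval_fam (c : Fam (Fin 2)) (p N : MvPolynomial (Fin 2) ℂ) (r : Fin 2 → ℝ)
    (hr : ∀ i, 0 < r i)
    (h : ∀ z : Fin 2 → ℂ, (∀ i, ‖z i‖ = r i) → ∃ s, AbsConvTo (fun K => c K * mono z K) s ∧
      MvPolynomial.eval z p * s = MvPolynomial.eval z N) : act p c = fam N := by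
  rw [← sub_eq_zero]
  apply laurent_unique r hr
  intro z hz
  obtain ⟨s, hs, he⟩ := h z hz
  have hNZ : NZ z c := by
    intro i hi
    have := hr i
    rw [← hz i, hi, norm_zero] at this
    exact absurd this (lt_irrefl _)
  have h1 := conv_act z p c hNZ s hs
  rw [he] at h1
  have h2 := fam_conv N z
  have e : (fun K => (act p c - fam N) K * mono z K) =
      fun K => act p c K * mono z K - fam N K * mono z K := by
    funext K; rw [Pi.sub_apply, sub_mul]
  rw [e]
  refine ⟨?_, ?_⟩
  · exact (h1.1.of_norm.sub h2.1.of_norm).norm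
  · simpa using h1.2.sub h2.2

theorem weak_assoc {P I : ℤ → ℤ → ℂ} (R R' : RatFn (Fin 2))
    (hP : ∀ z₁ z₂ : ℂ, ‖z₂‖ < ‖z₁‖ → 0 < ‖z₂‖ →
        AbsConvTo (fun k : ℤ × ℤ => P k.1 k.2 * z₁ ^ (-k.1 - 1) * z₂ ^ (-k.2 - 1))
          (R.eval ![z₁, z₂]))
    (hI : ∀ z₁ z₂ : ℂ, ‖z₁ - z₂‖ < ‖z₂‖ → 0 < ‖z₁ - z₂‖ →
        AbsConvTo (fun k : ℤ × ℤ => I k.1 k.2 * (z₁ - z₂) ^ (-k.1 - 1) * z₂ ^ (-k.2 - 1))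
          (R.eval ![z₁, z₂]))
    (hP' : ∀ z₁ z₂ : ℂ, ‖z₂‖ < ‖z₁‖ → 0 < ‖z₂‖ →
        AbsConvTo (fun k : ℤ × ℤ => P k.1 k.2 * z₁ ^ (-k.1 - 1) * z₂ ^ (-k.2 - 1))
          (R'.eval ![z₁, z₂]))
    (hPz : ∃ N : ℤ, ∀ j k, N ≤ k → P j k = 0) :
    act ((MvPolynomial.X 0 + MvPolynomial.X 1) ^ R'.a 0) (expT T2 (fam2 P) - fam2 I) = 0 := by
  have hdist : ∀ z₁ z₂ : ℂ, ‖z₂‖ < ‖z₁‖ → z₁ ≠ z₂ := by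
    rintro z₁ z₂ h rfl; exact lt_irrefl _ h
  have hnz : ∀ z₁ z₂ : ℂ, z₁ ≠ 0 → z₂ ≠ 0 → ∀ i, (![z₁, z₂] : Fin 2 → ℂ) i ≠ 0 := by
    intro z₁ z₂ h1 h2 i
    fin_cases i
    · exact h1
    · exact h2
  have hpoly : R.num * R'.denP = R'.num * R.denP := by
    apply poly_eq_of_annuli
    intro z₁ z₂ h2 h12
    have he := (hP z₁ z₂ h12 h2).unique (hP' z₁ z₂ h12 h2)
    have hz := hnz z₁ z₂ (norm_pos_iff.mp (h2.trans h12)) (norm_pos_iff.mp h2)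
    have hc := conf_two (hdist z₁ z₂ h12)
    rw [map_mul, map_mul, ← R.eval_mul _ hz hc, ← R'.eval_mul _ hz hc, he]
    ring
  have heval : ∀ z₁ z₂ : ℂ, z₁ ≠ 0 → z₂ ≠ 0 → z₁ ≠ z₂ → R.eval ![z₁, z₂] = R'.eval ![z₁, z₂] := by
    intro z₁ z₂ h1 h2 h12
    have hz := hnz z₁ z₂ h1 h2
    have hc := conf_two h12
    have := congrArg (MvPolynomial.eval ![z₁, z₂]) hpoly
    rw [map_mul, map_mul] at this
    rw [R.eval_eq, R'.eval_eq, div_eq_div_iff (R.denP_ne_zero _ hz hc) (R'.denP_ne_zero _ hz hc), this]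
  have hLN := LN_T2 P hPz
  -- the product family
  have h1 : act R'.denP (fam2 P) = fam R'.num := by
    apply act_eval_fam _ _ _ ![2, 1] (by intro i; fin_cases i <;> simp)
    intro z hz
    have hz0 : ‖z 0‖ = 2 := hz 0
    have hz1 : ‖z 1‖ = 1 := hz 1
    have hze : z = ![z 0, z 1] := by funext i; fin_cases i <;> rfl
    have hlt : ‖z 1‖ < ‖z 0‖ := by rw [hz0, hz1]; norm_num
    have hpos : 0 < ‖z 1‖ := by rw [hz1]; norm_num
    refine ⟨R'.eval ![z 0, z 1], ?_, ?_⟩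
    · have := (absConv_fam2 P _ _ _).mp (hP' (z 0) (z 1) hlt hpos)
      rwa [← hze] at this ⊢
    · rw [hze]
      exact R'.eval_mul _ (hnz _ _ (norm_pos_iff.mp (hpos.trans hlt)) (norm_pos_iff.mp hpos))
        (conf_two (hdist _ _ hlt))
  -- the iterate family
  let τ : MvPolynomial (Fin 2) ℂ →ₐ[ℂ] MvPolynomial (Fin 2) ℂ :=
    MvPolynomial.aeval fun i => MvPolynomial.X i + g2 i
  have hτ : ∀ (z : Fin 2 → ℂ) p, MvPolynomial.eval z (τ p) = MvPolynomial.eval ![z 0 + z 1, z 1] p := by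
    intro z p
    induction p using MvPolynomial.induction_on with
    | C a => simp [τ]
    | add p q hp hq => simp [hp, hq]
    | mul_X p i hp =>
      rw [map_mul, map_mul, map_mul, hp]
      fin_cases i <;> simp [τ, g2]
  have h2 : act (τ R'.denP) (fam2 I) = fam (τ R'.num) := by
    apply act_eval_fam _ _ _ ![1, 2] (by intro i; fin_cases i <;> simp)
    intro z hz
    have hz0 : ‖z 0‖ = 1 := hz 0
    have hz1 : ‖z 1‖ = 2 := hz 1
    have hze : z = ![z 0, z 1] := by funext i; fin_cases i <;> rfl
    have hlt : ‖z 0‖ < ‖z 1‖ := by rw [hz0, hz1]; norm_num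
    have hpos : 0 < ‖z 0‖ := by rw [hz0]; norm_num
    have hne : z 0 + z 1 ≠ 0 := by
      intro h
      have : z 0 = -z 1 := by linear_combination h
      rw [this, norm_neg] at hlt
      exact lt_irrefl _ hlt
    have hn1 : z 1 ≠ 0 := norm_pos_iff.mp (hpos.trans hlt)
    have hn12 : z 0 + z 1 ≠ z 1 := by
      intro h
      have : z 0 = 0 := by linear_combination h
      exact norm_pos_iff.mp hpos this
    refine ⟨R'.eval ![z 0 + z 1, z 1], ?_, ?_⟩
    · have := hI (z 0 + z 1) (z 1) (by rwa [add_sub_cancel_right]) (by rwa [add_sub_cancel_right])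
      rw [heval _ _ hne hn1 hn12, add_sub_cancel_right] at this
      have := (absConv_fam2 I _ _ _).mp this
      rwa [← hze] at this
    · rw [hτ, hτ]
      exact R'.eval_mul _ (hnz _ _ hne hn1) (conf_two hn12)
  have h3 : act (τ R'.denP) (expT T2 (fam2 P)) = fam (τ R'.num) := by
    rw [← expT_act T2_X T2_g _ hLN, h1, expT_fam T2_X T2_g T2_fam_one]
  have h4 : act (τ R'.denP) (expT T2 (fam2 P) - fam2 I) = 0 := by
    rw [map_sub, h2, h3, sub_self]
  set Δ := expT T2 (fam2 P) - fam2 I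
  have hoff : (Finset.univ.offDiag : Finset (Fin 2 × Fin 2)) = {(0, 1), (1, 0)} := by decide
  have hfac : τ R'.denP = MvPolynomial.C ((-1) ^ R'.b 1 0) *
      (MvPolynomial.X 0 ^ (R'.b 0 1 + R'.b 1 0) * (MvPolynomial.X 1 ^ R'.a 1 *
        (MvPolynomial.X 0 + MvPolynomial.X 1) ^ R'.a 0)) := by
    have e1 : τ (MvPolynomial.X 0) = MvPolynomial.X 0 + MvPolynomial.X 1 := by simp [τ, g2]
    have e2 : τ (MvPolynomial.X 1) = MvPolynomial.X 1 := by simp [τ, g2]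
    simp only [RatFn.denP, hoff, Fin.prod_univ_two, map_mul, map_prod, map_pow, map_sub]
    rw [Finset.prod_insert (by simp), Finset.prod_singleton, e1, e2]
    have e3 : (MvPolynomial.X 1 - (MvPolynomial.X 0 + MvPolynomial.X 1) : MvPolynomial (Fin 2) ℂ) =
      MvPolynomial.C (-1) * MvPolynomial.X 0 := by simp
    rw [e3, mul_pow]
    ring
  rw [hfac, act_mul] at h4
  have h5 : act (MvPolynomial.X 0 ^ (R'.b 0 1 + R'.b 1 0) * (MvPolynomial.X 1 ^ R'.a 1 *
        (MvPolynomial.X 0 + MvPolynomial.X 1) ^ R'.a 0)) Δ = 0 := by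
    funext K
    have := congrFun h4 K
    rw [act_C] at this
    simpa using this
  rw [act_mul] at h5
  have h6 := act_X_cancel _ _ _ h5
  rw [act_mul] at h6
  exact act_X_cancel _ _ _ h6

end

section

variable {ι : Type*} [Fintype ι] [DecidableEq ι]

/-- `f` does not depend on the index `i`. -/
def Ind {Z : Type*} (i : ι) (f : (ι → ℤ) → Z) : Prop := ∀ K, f (K + Pi.single i 1) = f K

theorem act_plane {i j : ι} (hij : i ≠ j) (G : (ι → ℤ) → ℤ → ℤ → ℂ) (hi : Ind i G) (hj : Ind j G)
    (n : ℕ) (K : ι → ℤ) :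
    act ((MvPolynomial.X i - MvPolynomial.X j) ^ n) (fun K => G K (K i) (K j)) K =
      act ((MvPolynomial.X 0 - MvPolynomial.X 1) ^ n) (fam2 (G K)) ![K i, K j] := by
  have e0 (K : ι → ℤ) : ![(K + Pi.single i 1 : ι → ℤ) i, (K + Pi.single i 1 : ι → ℤ) j] =
      ![K i, K j] + Pi.single 0 1 := by
    funext m; fin_cases m
    · simp
    · simp [hij.symm]
  have e1 (K : ι → ℤ) : ![(K + Pi.single j 1 : ι → ℤ) i, (K + Pi.single j 1 : ι → ℤ) j] =
      ![K i, K j] + Pi.single 1 1 := by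
    funext m; fin_cases m
    · simp [hij]
    · simp
  induction n generalizing K with
  | zero => simp only [pow_zero, act_one]; rfl
  | succ n ih =>
    rw [pow_succ', pow_succ', act_mul, act_mul, act_sub, act_sub, Pi.sub_apply, Pi.sub_apply,
      act_X, act_X, act_X, act_X, ih, ih, hi K, hj K, e0, e1]

/-- A system of mutually local left and right operators. -/
structure Sys (M : ι → ι → ℕ) (X : Type*) [AddCommGroup X] [Module ℂ X] where
  L : ι → ℤ → Module.End ℂ X
  S : ι → ℤ → Module.End ℂ X
  Du : (X →ₗ[ℂ] ℂ) → Prop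
  du_L : ∀ φ i k, Du φ → Du (φ ∘ₗ L i k)
  du_S : ∀ φ i k, Du φ → Du (φ ∘ₗ S i k)
  loc : ∀ φ, Du φ → ∀ (x : X) (i j : ι),
    act ((MvPolynomial.X 0 - MvPolynomial.X 1) ^ M i j)
      (fam2 fun a b => φ (L i a (S j b x)) - φ (S j b (L i a x))) = 0

/-- The word of operators with names prescribed by a list. -/
def word {X : Type*} [AddCommGroup X] [Module ℂ X] (op : ι → ℤ → Module.End ℂ X) (ℓ : List ι)
    (K : ι → ℤ) : Module.End ℂ X := (ℓ.map fun i => op i (K i)).prod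

variable {X : Type*} [AddCommGroup X] [Module ℂ X]

theorem word_nil (op : ι → ℤ → Module.End ℂ X) (K : ι → ℤ) (x : X) : word op [] K x = x := rfl

theorem word_cons (op : ι → ℤ → Module.End ℂ X) (i : ι) (ℓ : List ι) (K : ι → ℤ) (x : X) :
    word op (i :: ℓ) K x = op i (K i) (word op ℓ K x) := by
  simp [word]

theorem word_append (op : ι → ℤ → Module.End ℂ X) (ℓ ℓ' : List ι) (K : ι → ℤ) (x : X) :
    word op (ℓ ++ ℓ') K x = word op ℓ K (word op ℓ' K x) := by
  simp [word]

theorem Ind.word (op : ι → ℤ → Module.End ℂ X) {ℓ : List ι} {i : ι} (h : i ∉ ℓ) :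
    Ind i (VA.word op ℓ) := by
  intro K
  unfold VA.word
  congr 1
  apply List.map_congr_left
  intro j hj
  have : j ≠ i := by rintro rfl; exact h hj
  simp [this]

theorem Ind.comp_word (op : ι → ℤ → Module.End ℂ X) {ψ : (ι → ℤ) → (X →ₗ[ℂ] ℂ)} {ℓ : List ι} {i : ι}
    (hψ : Ind i ψ) (h : i ∉ ℓ) : Ind i fun K => ψ K ∘ₗ VA.word op ℓ K := by
  intro K
  simp only [hψ K, Ind.word op h K]

theorem Ind.word_apply (op : ι → ℤ → Module.End ℂ X) {x : (ι → ℤ) → X} {ℓ : List ι} {i : ι}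
    (hx : Ind i x) (h : i ∉ ℓ) : Ind i fun K => VA.word op ℓ K (x K) := by
  intro K
  simp only [hx K, Ind.word op h K]

variable {M : ι → ι → ℕ} (Y : Sys M X)

theorem Sys.du_word_L (φ : X →ₗ[ℂ] ℂ) (h : Y.Du φ) (ℓ : List ι) (K : ι → ℤ) :
    Y.Du (φ ∘ₗ word Y.L ℓ K) := by
  induction ℓ generalizing φ with
  | nil => exact h
  | cons i ℓ ih =>
    have := ih _ (Y.du_L φ i (K i) h)
    rw [word, List.map_cons, List.prod_cons]
    exact this

theorem Sys.du_word_S (φ : X →ₗ[ℂ] ℂ) (h : Y.Du φ) (ℓ : List ι) (K : ι → ℤ) :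
    Y.Du (φ ∘ₗ word Y.S ℓ K) := by
  induction ℓ generalizing φ with
  | nil => exact h
  | cons i ℓ ih =>
    have := ih _ (Y.du_S φ i (K i) h)
    rw [word, List.map_cons, List.prod_cons]
    exact this

theorem Sys.swap {i j : ι} (hij : i ≠ j) (ψ : (ι → ℤ) → (X →ₗ[ℂ] ℂ)) (x : (ι → ℤ) → X)
    (hψ : ∀ K, Y.Du (ψ K)) (hψi : Ind i ψ) (hψj : Ind j ψ) (hxi : Ind i x) (hxj : Ind j x) :
    act (den M) (fun K => ψ K (Y.S j (K j) (Y.L i (K i) (x K)))) =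
      act (den M) (fun K => ψ K (Y.L i (K i) (Y.S j (K j) (x K)))) := by
  obtain ⟨p, hp⟩ := den_dvd M hij
  rw [eq_comm, ← sub_eq_zero, ← map_sub, hp, act_mul]
  have : act ((MvPolynomial.X i - MvPolynomial.X j) ^ M i j)
      ((fun K => ψ K (Y.L i (K i) (Y.S j (K j) (x K)))) -
        fun K => ψ K (Y.S j (K j) (Y.L i (K i) (x K)))) = 0 := by
    funext K
    have h := act_plane hij (fun K a b => ψ K (Y.L i a (Y.S j b (x K))) -
      ψ K (Y.S j b (Y.L i a (x K)))) (by intro K; simp only [hψi K, hxi K])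
      (by intro K; simp only [hψj K, hxj K]) (M i j) K
    refine h.trans ?_
    rw [Y.loc (ψ K) (hψ K) (x K) i j]
    rfl
  rw [this, map_zero]

theorem Sys.swap_list {j : ι} {ℓ : List ι} (hn : ℓ.Nodup) (hj : j ∉ ℓ) (ψ : (ι → ℤ) → (X →ₗ[ℂ] ℂ))
    (x : (ι → ℤ) → X) (hψ : ∀ K, Y.Du (ψ K)) (hψj : Ind j ψ) (hψi : ∀ i ∈ ℓ, Ind i ψ)
    (hxj : Ind j x) (hxi : ∀ i ∈ ℓ, Ind i x) :
    act (den M) (fun K => ψ K (Y.S j (K j) (word Y.L ℓ K (x K)))) =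
      act (den M) (fun K => ψ K (word Y.L ℓ K (Y.S j (K j) (x K)))) := by
  induction ℓ generalizing ψ with
  | nil => rfl
  | cons i ℓ ih =>
    simp only [List.nodup_cons, List.mem_cons, not_or, forall_eq_or_imp] at hn hj hψi hxi
    have h1 := Y.swap (Ne.symm hj.1) ψ (fun K => word Y.L ℓ K (x K)) hψ hψi.1 hψj
      (hxi.1.word_apply Y.L hn.1) (hxj.word_apply Y.L hj.2)
    have h2 := ih hn.2 hj.2 (fun K => ψ K ∘ₗ word Y.L [i] K) (fun K => Y.du_word_L _ (hψ K) _ K)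
      (hψj.comp_word Y.L (by simp [hj.1]))
      (fun m hm => (hψi.2 m hm).comp_word Y.L (by
        simp only [List.mem_singleton]
        rintro rfl; exact hn.1 hm)) hxi.2
    simp only [LinearMap.comp_apply, word_cons, word_nil] at h2
    simp only [word_cons]
    rw [h1, h2]

theorem Sys.swap_lists {q ℓ : List ι} (hn : ℓ.Nodup) (hq : q.Nodup) (hd : ∀ j ∈ q, j ∉ ℓ)
    (ψ : (ι → ℤ) → (X →ₗ[ℂ] ℂ)) (x : (ι → ℤ) → X) (hψ : ∀ K, Y.Du (ψ K))
    (hψj : ∀ j ∈ q, Ind j ψ) (hψi : ∀ i ∈ ℓ, Ind i ψ)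
    (hxj : ∀ j ∈ q, Ind j x) (hxi : ∀ i ∈ ℓ, Ind i x) :
    act (den M) (fun K => ψ K (word Y.S q K (word Y.L ℓ K (x K)))) =
      act (den M) (fun K => ψ K (word Y.L ℓ K (word Y.S q K (x K)))) := by
  induction q generalizing ψ with
  | nil => rfl
  | cons j q ih =>
    simp only [List.nodup_cons, List.mem_cons, forall_eq_or_imp] at hq hd hψj hxj
    have h1 := Y.swap_list hn hd.1 ψ (fun K => word Y.S q K (x K)) hψ hψj.1 hψi
      (hxj.1.word_apply Y.S hq.1) (fun i hi => (hxi i hi).word_apply Y.S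
        (fun h => hd.2 i h hi))
    have h2 := ih hq.2 hd.2 (fun K => ψ K ∘ₗ word Y.S [j] K) (fun K => Y.du_word_S _ (hψ K) _ K)
      (fun m hm => (hψj.2 m hm).comp_word Y.S (by
        simp only [List.mem_singleton]
        rintro rfl; exact hq.1 hm))
      (fun m hm => (hψi m hm).comp_word Y.S (by
        simp only [List.mem_singleton]
        rintro rfl; exact hd.1 hm)) hxj.2
    simp only [LinearMap.comp_apply, word_cons, word_nil] at h2
    simp only [word_cons]
    rw [h2, h1]

/-- Reversal of a word applied to a vacuum. -/
theorem Sys.reversal (vac : X) (hv : ∀ i k, Y.S i k vac = Y.L i k vac) {ℓ : List ι} (hn : ℓ.Nodup)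
    (ψ : (ι → ℤ) → (X →ₗ[ℂ] ℂ)) (hψ : ∀ K, Y.Du (ψ K)) (hψi : ∀ i ∈ ℓ, Ind i ψ) :
    act (den M) (fun K => ψ K (word Y.L ℓ K vac)) =
      act (den M) (fun K => ψ K (word Y.S ℓ.reverse K vac)) := by
  induction ℓ generalizing ψ with
  | nil => rfl
  | cons i ℓ ih =>
    simp only [List.nodup_cons, List.mem_cons, forall_eq_or_imp] at hn hψi
    have h2 := ih hn.2 (fun K => ψ K ∘ₗ word Y.L [i] K) (fun K => Y.du_word_L _ (hψ K) _ K)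
      (fun m hm => (hψi.2 m hm).comp_word Y.L (by
        simp only [List.mem_singleton]
        rintro rfl; exact hn.1 hm))
    have h3 := Y.swap_lists (q := ℓ.reverse) (ℓ := [i]) (by simp) (by simpa using hn.2)
      (by
        intro j hj
        simp only [List.mem_reverse] at hj
        simp only [List.mem_singleton]
        rintro rfl
        exact hn.1 hj) ψ (fun _ => vac) hψ (by simpa using hψi.2) (by simpa using hψi.1)
      (fun _ _ _ => rfl) (fun _ _ _ => rfl)
    simp only [LinearMap.comp_apply, word_cons, word_nil] at h2 h3
    simp only [word_cons, List.reverse_cons, word_append, word_nil, hv]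
    rw [h2, ← h3]

/-- Vanishing at nonnegative values of the index `i`. -/
def NegAt (i : ι) (c : Fam ι) : Prop := ∀ K, 0 ≤ K i → c K = 0

theorem NegAt.act {i : ι} {c : Fam ι} (h : NegAt i c) (p : MvPolynomial ι ℂ) :
    NegAt i (VA.act p c) := by
  refine act_induction (NegAt i) ?_ ?_ ?_ p c h
  · intro c d hc hd K hK
    simp [hc K hK, hd K hK]
  · intro a c hc K hK
    simp [hc K hK]
  · intro j c hc K hK
    apply hc
    by_cases hij : i = j
    · subst hij; simp; omega
    · simp [hij, hK]

theorem Sys.negAt_word (vac : X) (hv : ∀ i k, Y.S i k vac = Y.L i k vac)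
    (hv0 : ∀ i k, 0 ≤ k → Y.L i k vac = 0) {ℓ : List ι} (hn : ℓ.Nodup)
    (ψ : (ι → ℤ) → (X →ₗ[ℂ] ℂ)) (hψ : ∀ K, Y.Du (ψ K)) (hψi : ∀ i ∈ ℓ, Ind i ψ) (i : ι) (hi : i ∈ ℓ) :
    NegAt i (act (den M) (fun K => ψ K (word Y.L ℓ K vac))) := by
  obtain ⟨pre, post, rfl⟩ := List.append_of_mem hi
  rw [List.nodup_append] at hn
  have h := Y.reversal vac hv hn.2.1 (fun K => ψ K ∘ₗ word Y.L pre K)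
    (fun K => Y.du_word_L _ (hψ K) _ K) (fun m hm => (hψi m (by simp [List.mem_cons.mp hm])).comp_word Y.L
      (fun h => hn.2.2 m h m hm rfl))
  simp only [LinearMap.comp_apply] at h
  simp only [word_append]
  rw [h]
  apply NegAt.act
  intro K hK
  simp only [List.reverse_cons, word_append, word_cons, word_nil]
  rw [hv, hv0 i _ hK]
  simp

end

section

variable {X : Type*} [AddCommGroup X] [Module ℂ X]
variable {X' : Type*} [AddCommGroup X'] [Module ℂ X']

theorem CGrading.proj_proj (G : CGrading X) (m n : ℂ) (x : X) :
    G.proj m (G.proj n x) = if m = n then G.proj n x else 0 := by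
  have h := congrArg (fun T : X →ₗ[ℂ] X => T x) (G.proj_comp m n)
  simp only [LinearMap.comp_apply] at h
  rw [h]
  split_ifs <;> rfl

theorem map_finsum_of_finite {ι : Type*} (f : X →ₗ[ℂ] X') {g : ι → X}
    (h : (Function.support g).Finite) : f (∑ᶠ i, g i) = ∑ᶠ i, f (g i) :=
  AddMonoidHom.map_finsum f.toAddMonoidHom h

/-- `O` changes weights only by elements of `S`. -/
def IsShift (G : CGrading X) (G' : CGrading X') (S : Set ℂ) (O : X → X') : Prop :=
  ∀ (m n : ℂ) (x : X), m - n ∉ S → G'.proj m (O (G.proj n x)) = 0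

theorem IsShift.mono {G : CGrading X} {G' : CGrading X'} {S T : Set ℂ} {O : X → X'}
    (h : IsShift G G' S O) (hST : S ⊆ T) : IsShift G G' T O :=
  fun m n x hm => h m n x fun hs => hm (hST hs)

theorem CGrading.eq_zero (G : CGrading X) {x : X} (h : ∀ n, G.proj n x = 0) : x = 0 := by
  rw [← G.proj_sum x]
  simp [h]

theorem CGrading.linear_ext (G : CGrading X) {f g : X →ₗ[ℂ] X'}
    (h : ∀ n x, f (G.proj n x) = g (G.proj n x)) : f = g := by
  ext x
  rw [← G.proj_sum x, map_finsum_of_finite f (G.proj_finite x),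
    map_finsum_of_finite g (G.proj_finite x)]
  exact finsum_congr fun n => h n x

theorem IsShift.eq_zero {G : CGrading X} {G' : CGrading X'} {S : Set ℂ} {O : X →ₗ[ℂ] X'}
    (h : IsShift G G' S O) (φ : X' →ₗ[ℂ] ℂ) (n : ℂ) (hS : ∀ m, φ ∘ₗ G'.proj m ≠ 0 → m - n ∉ S) :
    φ ∘ₗ O ∘ₗ G.proj n = 0 := by
  ext x
  simp only [LinearMap.comp_apply, LinearMap.zero_apply]
  rw [← G'.proj_sum (O (G.proj n x)), map_finsum_of_finite φ (G'.proj_finite _)]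
  rw [finsum_eq_zero_of_forall_eq_zero]
  intro m
  by_cases hm : φ ∘ₗ G'.proj m = 0
  · exact LinearMap.congr_fun hm _
  · rw [h m n x (hS m hm), map_zero]

theorem IsShift.dual {G : CGrading X} {G' : CGrading X'} {S : Set ℂ} (hS : S.Finite)
    {O : X →ₗ[ℂ] X'} (h : IsShift G G' S O) {φ : X' →ₗ[ℂ] ℂ} (hφ : InGradedDual G'.proj φ) :
    InGradedDual G.proj (φ ∘ₗ O) := by
  have hfin : (Set.image2 (fun m s => m - s) (Function.support fun m => φ ∘ₗ G'.proj m) S).Finite :=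
    Set.Finite.image2 _ hφ hS
  refine hfin.subset ?_
  intro n hn
  by_contra hcon
  apply hn
  show (φ ∘ₗ O) ∘ₗ G.proj n = 0
  rw [LinearMap.comp_assoc]
  apply h.eq_zero φ n
  intro m hm hs
  exact hcon ⟨m, hm, m - n, hs, by simp⟩

theorem exists_vanish (G : CGrading X) (G' : CGrading X') {φ : X' →ₗ[ℂ] ℂ}
    (hφ : InGradedDual G'.proj φ) : ∃ r : ℝ, ∀ (O : X →ₗ[ℂ] X') (S : Set ℂ), IsShift G G' S O →
      (∀ s ∈ S, r < s.re) → φ ∘ₗ O = 0 := by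
  obtain ⟨B, hB⟩ := G.lower_bound
  obtain ⟨M, hM⟩ := (hφ.image Complex.re).bddAbove
  refine ⟨M - B, fun O S hO hS => ?_⟩
  apply G.linear_ext
  intro n x
  by_cases hn : n.re < B
  · rw [hB n hn]; simp
  · refine LinearMap.congr_fun (hO.eq_zero φ n ?_) x
    intro m hm hs
    have h1 := hS _ hs
    have h2 : m.re ≤ M := hM ⟨m, hm, rfl⟩
    rw [Complex.sub_re] at h1
    linarith [not_lt.mp hn]

theorem IsShift.comp {X'' : Type*} [AddCommGroup X''] [Module ℂ X''] {G : CGrading X}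
    {G' : CGrading X'} {G'' : CGrading X''} {S T : Set ℂ} {O : X → X'} {O' : X' →ₗ[ℂ] X''}
    (h' : IsShift G' G'' T O') (h : IsShift G G' S O) :
    IsShift G G'' (Set.image2 (· + ·) S T) (fun x => O' (O x)) := by
  intro m n x hm
  show G''.proj m (O' (O (G.proj n x))) = 0
  rw [← G'.proj_sum (O (G.proj n x)), map_finsum_of_finite O' (G'.proj_finite _),
    map_finsum_of_finite (G''.proj m) ?_]
  · rw [finsum_eq_zero_of_forall_eq_zero]
    intro p
    by_cases hp : p - n ∈ S
    · apply h' m p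
      intro hmp
      exact hm ⟨_, hp, _, hmp, by ring⟩
    · rw [h p n x hp, map_zero, map_zero]
  · refine (G'.proj_finite (O (G.proj n x))).subset ?_
    intro p hp h0
    simp only [Function.mem_support] at hp
    exact hp (by rw [show G'.proj p (O (G.proj n x)) = 0 from h0, map_zero])

theorem IsShift.pow {G : CGrading X} {D : Module.End ℂ X} (h : IsShift G G {1} D) (n : ℕ) :
    IsShift G G {(n : ℂ)} ⇑(D ^ n) := by
  induction n with
  | zero =>
    intro m n x hm
    have : m ≠ n := by rintro rfl; simp at hm
    rw [pow_zero, Module.End.one_apply, G.proj_proj, if_neg this]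
  | succ n ih =>
    have := h.comp ih
    rw [pow_succ']
    refine this.mono ?_
    simp

theorem exists_pow_vanish {G : CGrading X} {D : Module.End ℂ X} (h : IsShift G G {1} D)
    {φ : X →ₗ[ℂ] ℂ} (hφ : InGradedDual G.proj φ) : ∃ n0 : ℕ, ∀ n, n0 ≤ n → φ ∘ₗ D ^ n = 0 := by
  obtain ⟨r, hr⟩ := exists_vanish G G hφ
  obtain ⟨n0, hn0⟩ := exists_nat_gt r
  refine ⟨n0, fun n hn => hr _ _ (h.pow n) ?_⟩
  intro s hs
  rw [Set.mem_singleton_iff] at hs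
  rw [hs, Complex.natCast_re]
  exact hn0.trans_le (by exact_mod_cast hn)

/-- The set of weights `T - k`. -/
def wts (T : Finset ℂ) (k : ℤ) : Set ℂ := (fun t => t - (k : ℂ)) '' (T : Set ℂ)

theorem wts_finite (T : Finset ℂ) (k : ℤ) : (wts T k).Finite := T.finite_toSet.image _

theorem exists_mode_vanish (G : CGrading X) (G' : CGrading X') {φ : X' →ₗ[ℂ] ℂ}
    (hφ : InGradedDual G'.proj φ) (T : Finset ℂ) : ∃ k0 : ℤ, ∀ k < k0, ∀ O : X →ₗ[ℂ] X',
      IsShift G G' (wts T k) O → φ ∘ₗ O = 0 := by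
  obtain ⟨r, hr⟩ := exists_vanish G G' hφ
  obtain ⟨B, hB⟩ := (T.finite_toSet.image Complex.re).bddBelow
  obtain ⟨k0, hk0⟩ := exists_int_lt (B - r)
  refine ⟨k0, fun k hk O hO => hr O _ hO ?_⟩
  rintro _ ⟨t, ht, rfl⟩
  have h1 : B ≤ t.re := hB ⟨t, ht, rfl⟩
  have h2 : (k : ℝ) < k0 := by exact_mod_cast hk
  simp only [Complex.sub_re, Complex.intCast_re]
  linarith

theorem CGrading.d_proj (G : CGrading X) (n : ℂ) (x : X) : G.d (G.proj n x) = n • G.proj n x := by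
  unfold CGrading.d
  rw [finsum_eq_single _ n]
  · rw [G.proj_proj, if_pos rfl]
  · intro m hm
    rw [G.proj_proj, if_neg hm, smul_zero]

theorem CGrading.proj_d (G : CGrading X) (n : ℂ) (x : X) : G.proj n (G.d x) = n • G.proj n x := by
  unfold CGrading.d
  rw [map_finsum_of_finite, finsum_eq_single _ n]
  · rw [map_smul, G.proj_proj, if_pos rfl]
  · intro m hm
    rw [map_smul, G.proj_proj, if_neg (Ne.symm hm), smul_zero]
  · refine (G.proj_finite x).subset ?_
    intro p hp h0
    simp only [Function.mem_support] at hp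
    exact hp (by rw [show G.proj p x = 0 from h0, smul_zero])

/-- A bilinear mode map satisfying a `d`-commutator formula shifts weights by finitely many values. -/
theorem isShift_of_d_comm {U : Type*} [AddCommGroup U] [Module ℂ U] (GU : CGrading U)
    (G : CGrading X) (G' : CGrading X') (O : U →ₗ[ℂ] X →ₗ[ℂ] (ℤ → X'))
    (h : ∀ u x k, G'.d (O u x k) = O (GU.d u) x k + (-(k : ℂ) - 1) • O u x k + O u (G.d x) k)
    (u : U) : ∃ T : Finset ℂ, ∀ k, IsShift G G' (wts T k) fun x => O u x k := by
  classical
  refine ⟨(GU.proj_finite u).toFinset.image fun j => j - 1, fun k m n x hm => ?_⟩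
  have hlin : ∀ (f : U →ₗ[ℂ] X'), f u = ∑ᶠ j, f (GU.proj j u) := by
    intro f
    conv_lhs => rw [← GU.proj_sum u]
    rw [map_finsum_of_finite f (GU.proj_finite u)]
  have h2 := hlin (G'.proj m ∘ₗ LinearMap.proj k ∘ₗ O.flip (G.proj n x))
  simp only [LinearMap.comp_apply, LinearMap.flip_apply, LinearMap.proj_apply] at h2
  rw [h2, finsum_eq_zero_of_forall_eq_zero]
  intro j
  by_cases hj : GU.proj j u = 0
  · rw [hj]; simp
  · have h3 := congrArg (G'.proj m) (h (GU.proj j u) (G.proj n x) k)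
    rw [G'.proj_d, GU.d_proj, G.d_proj] at h3
    simp only [map_smul, LinearMap.smul_apply, Pi.smul_apply, map_add] at h3
    rw [← add_smul, ← add_smul, ← sub_eq_zero, ← sub_smul, smul_eq_zero] at h3
    refine h3.resolve_left fun h4 => hm ?_
    refine ⟨j - 1, ?_, ?_⟩
    · simp only [Finset.coe_image, Set.Finite.coe_toFinset]
      exact ⟨j, hj, rfl⟩
    · simp only
      linear_combination -h4

/-- A `ℤ`-grading as a `ℂ`-grading. -/
def ZGrading.toC (G : ZGrading X) : CGrading X where
  proj n := open Classical in if h : ∃ k : ℤ, (k : ℂ) = n then G.proj h.choose else 0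
  proj_comp m n := by
    by_cases hn : ∃ k : ℤ, (k : ℂ) = n
    · by_cases hm : ∃ k : ℤ, (k : ℂ) = m
      · rw [dif_pos hn, dif_pos hm, G.proj_comp]
        have h1 := hn.choose_spec
        have h2 := hm.choose_spec
        by_cases hmn : m = n
        · subst hmn; simp
        · rw [if_neg hmn, if_neg]
          intro h
          exact hmn (by rw [← h1, ← h2, h])
      · rw [dif_neg hm, if_neg]
        · simp
        · rintro rfl; exact hm hn
    · rw [dif_neg hn]
      simp
  proj_finite w := by
    refine ((G.proj_finite w).image (fun k : ℤ => (k : ℂ))).subset ?_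
    intro n hn
    simp only [Function.mem_support] at hn
    split_ifs at hn with h
    · exact ⟨_, hn, h.choose_spec⟩
    · simp at hn
  proj_sum w := by
    conv_rhs => rw [← G.proj_sum w]
    rw [← finsum_mem_univ (f := fun k => G.proj k w),
      finsum_mem_eq_of_bijOn (g := fun n : ℂ => (open Classical in if h : ∃ k : ℤ, (k : ℂ) = n then G.proj h.choose else 0 : X →ₗ[ℂ] X) w)
        (t := Set.range (fun k : ℤ => (k : ℂ))) (fun k : ℤ => (k : ℂ))]
    · rw [finsum_mem_def]
      apply finsum_congr
      intro n
      by_cases h : ∃ k : ℤ, (k : ℂ) = n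
      · rw [Set.indicator_of_mem]
        exact h
      · rw [Set.indicator_of_notMem, dif_neg h]
        · rfl
        · exact h
    · rw [← Set.image_univ]
      exact (Int.cast_injective.injOn).bijOn_image
    · intro k _
      have h : ∃ k' : ℤ, (k' : ℂ) = k := ⟨k, rfl⟩
      rw [dif_pos h]
      congr 1
      have := h.choose_spec
      congr 1
      exact_mod_cast this.symm
  lower_bound := by
    obtain ⟨B, hB⟩ := G.lower_bound
    refine ⟨B, fun n hn => ?_⟩
    split_ifs with h
    · apply hB
      have := h.choose_spec
      rw [← this] at hn
      exact_mod_cast hn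
    · rfl

theorem ZGrading.toC_proj (G : ZGrading X) (k : ℤ) : G.toC.proj k = G.proj k := by
  have h : ∃ k' : ℤ, (k' : ℂ) = k := ⟨k, rfl⟩
  unfold ZGrading.toC
  simp only
  rw [dif_pos h]
  congr 1
  exact_mod_cast h.choose_spec

theorem ZGrading.toC_proj_eq_zero (G : ZGrading X) (n : ℂ) (h : ¬ ∃ k : ℤ, (k : ℂ) = n) :
    G.toC.proj n = 0 := dif_neg h

theorem ZGrading.dual_toC (G : ZGrading X) (φ : X →ₗ[ℂ] ℂ) :
    InGradedDual G.toC.proj φ ↔ InGradedDual G.proj φ := by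
  constructor
  · intro h
    refine (h.preimage (f := fun k : ℤ => (k : ℂ)) Int.cast_injective.injOn).subset ?_
    intro k hk
    simpa [G.toC_proj] using hk
  · intro h
    refine (h.image (fun k : ℤ => (k : ℂ))).subset ?_
    intro n hn
    by_cases hk : ∃ k : ℤ, (k : ℂ) = n
    · obtain ⟨k, rfl⟩ := hk
      rw [Function.mem_support, G.toC_proj] at hn
      exact ⟨k, hn, rfl⟩
    · rw [Function.mem_support, G.toC_proj_eq_zero n hk] at hn
      simp at hn

theorem ZGrading.finsum_toC {Z : Type*} [AddCommMonoid Z] (G : ZGrading X) (x : X) (f : ℂ → X → Z)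
    (hf : ∀ n, f n 0 = 0) : ∑ᶠ n, f n (G.toC.proj n x) = ∑ᶠ k : ℤ, f k (G.proj k x) := by
  rw [← finsum_mem_univ (f := fun k : ℤ => f k (G.proj k x)),
      finsum_mem_eq_of_bijOn (g := fun n : ℂ => f n (G.toC.proj n x))
        (t := Set.range (fun k : ℤ => (k : ℂ))) (fun k : ℤ => (k : ℂ))]
  · rw [finsum_mem_def]
    apply finsum_congr
    intro n
    by_cases h : ∃ k : ℤ, (k : ℂ) = n
    · rw [Set.indicator_of_mem]
      exact h
    · rw [Set.indicator_of_notMem, G.toC_proj_eq_zero n h]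
      · exact hf n
      · exact h
  · rw [← Set.image_univ]
    exact (Int.cast_injective.injOn).bijOn_image
  · intro k _
    rw [G.toC_proj]

theorem ZGrading.d_toC (G : ZGrading X) (x : X) : G.toC.d x = G.d x :=
  G.finsum_toC x (fun n y => n • y) (by simp)

/-- Graded-dual functionals separate points. -/
theorem CGrading.separate (G : CGrading X) {x y : X}
    (h : ∀ φ, InGradedDual G.proj φ → φ x = φ y) : x = y := by
  rw [← sub_eq_zero]
  apply G.eq_zero
  intro n
  by_contra hne
  obtain ⟨ψ, hψ⟩ : ∃ ψ : X →ₗ[ℂ] ℂ, ψ (G.proj n (x - y)) ≠ 0 := by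
    by_contra hcon
    push Not at hcon
    exact hne ((Module.forall_dual_apply_eq_zero_iff ℂ _).mp hcon)
  apply hψ
  have := h (ψ ∘ₗ G.proj n) (by
    refine (Set.finite_singleton n).subset ?_
    intro m hm
    by_contra hmn
    apply hm
    ext z
    simp only [LinearMap.comp_apply]
    rw [G.proj_proj, if_neg (fun h => hmn h.symm)]
    simp)
  simp only [LinearMap.comp_apply] at this
  rw [map_sub, map_sub, this, sub_self]

end

section

variable {U : Type*} {X : Type*} [AddCommGroup X] [Module ℂ X]

/-- Left and right modes on a graded space satisfying associativity with a uniform pole order. -/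
structure Modes (U : Type*) (X : Type*) [AddCommGroup X] [Module ℂ X] where
  G : CGrading X
  L : U → ℤ → Module.End ℂ X
  R : U → ℤ → Module.End ℂ X
  D : Module.End ℂ X
  wtL : ∀ u, ∃ T : Finset ℂ, ∀ k, IsShift G G (wts T k) (L u k)
  wtR : ∀ u, ∃ T : Finset ℂ, ∀ k, IsShift G G (wts T k) (R u k)
  wtD : IsShift G G {1} D
  truncR : ∀ u x, ∃ N : ℤ, ∀ k, N ≤ k → R u k x = 0
  D_comm : ∀ u k x, D (L u k x) - L u k (D x) = (-(k : ℂ)) • L u (k - 1) x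
  C : U → U → ℕ
  assoc : ∀ (φ : X →ₗ[ℂ] ℂ), InGradedDual G.proj φ → ∀ (u v : U) (x : X),
    ∃ Q Q' : RatFn (Fin 2), Q'.a 0 ≤ C u v ∧
      (∀ z₁ z₂ : ℂ, ‖z₂‖ < ‖z₁‖ → 0 < ‖z₂‖ →
        AbsConvTo (fun k : ℤ × ℤ =>
            φ (L u k.1 (R v k.2 x)) * z₁ ^ (-k.1 - 1) * z₂ ^ (-k.2 - 1)) (Q.eval ![z₁, z₂])) ∧
      (∀ z₁ z₂ : ℂ, ‖z₁ - z₂‖ < ‖z₂‖ → 0 < ‖z₁ - z₂‖ →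
        AbsConvTo (fun k : ℤ × ℤ =>
            φ (R v k.2 (L u k.1 x)) * (z₁ - z₂) ^ (-k.1 - 1) * z₂ ^ (-k.2 - 1))
          (Q.eval ![z₁, z₂])) ∧
      (∀ z₁ z₂ : ℂ, ‖z₂‖ < ‖z₁‖ → 0 < ‖z₂‖ →
        AbsConvTo (fun k : ℤ × ℤ =>
            φ (L u k.1 (R v k.2 x)) * z₁ ^ (-k.1 - 1) * z₂ ^ (-k.2 - 1)) (Q'.eval ![z₁, z₂]))

/-- The scalar in the `m`-th term of the opposite modes. -/
def opc (k : ℤ) (m : ℕ) : ℂ := ((-1 : ℂ) ^ (k + (m : ℤ) + 1)) * ((m.factorial : ℂ))⁻¹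

theorem opc_succ (k : ℤ) (m : ℕ) : opc (k + 1) m = - opc k m := by
  unfold opc
  rw [show k + 1 + (m : ℤ) + 1 = (k + m + 1) + 1 by ring, zpow_add₀ (by norm_num)]
  ring

namespace Modes
variable (Y : Modes U X)

theorem op_support (u : U) (k : ℤ) (x : X) :
    (Function.support fun m : ℕ => opc k m • (Y.D ^ m) (Y.R u (k + m) x)).Finite := by
  obtain ⟨N, hN⟩ := Y.truncR u x
  refine (Set.finite_lt_nat (N - k).toNat).subset ?_
  intro m hm
  by_contra hcon
  apply hm
  simp only [Set.mem_ofPred_eq, not_lt] at hcon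
  show opc k m • (Y.D ^ m) (Y.R u (k + m) x) = 0
  rw [hN _ (by omega), map_zero, smul_zero]

/-- The modes of the opposite right vertex operators. -/
def S (u : U) (k : ℤ) : Module.End ℂ X where
  toFun x := ∑ᶠ m : ℕ, opc k m • (Y.D ^ m) (Y.R u (k + m) x)
  map_add' x y := by
    rw [← finsum_add_distrib (Y.op_support u k x) (Y.op_support u k y)]
    apply finsum_congr
    intro m
    rw [map_add, map_add, smul_add]
  map_smul' a x := by
    rw [RingHom.id_apply, smul_finsum]
    apply finsum_congr
    intro m
    rw [map_smul, map_smul, smul_comm]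

theorem S_apply (u : U) (k : ℤ) (x : X) :
    Y.S u k x = ∑ᶠ m : ℕ, opc k m • (Y.D ^ m) (Y.R u (k + m) x) := rfl

theorem map_S {Z : Type*} [AddCommGroup Z] [Module ℂ Z] (f : X →ₗ[ℂ] Z) (u : U) (k : ℤ) (x : X) :
    f (Y.S u k x) = ∑ᶠ m : ℕ, opc k m • f ((Y.D ^ m) (Y.R u (k + m) x)) := by
  rw [S_apply, map_finsum_of_finite f (Y.op_support u k x)]
  simp only [map_smul]

theorem map_S_eq_sum (φ : X →ₗ[ℂ] ℂ) (n0 : ℕ) (h : ∀ n, n0 ≤ n → φ ∘ₗ Y.D ^ n = 0)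
    (u : U) (k : ℤ) (x : X) :
    φ (Y.S u k x) = ∑ n ∈ Finset.range n0, opc k n * (φ ∘ₗ Y.D ^ n) (Y.R u (k + n) x) := by
  rw [map_S]
  apply finsum_eq_sum_of_support_subset
  intro n hn
  simp only [Finset.coe_range, Set.mem_Iio]
  by_contra hcon
  apply hn
  have := LinearMap.congr_fun (h n (not_lt.mp hcon)) (Y.R u (k + n) x)
  simp only [LinearMap.comp_apply, LinearMap.zero_apply] at this
  simp only [this, smul_zero]

theorem wtS (u : U) : ∃ T : Finset ℂ, ∀ k, IsShift Y.G Y.G (wts T k) (Y.S u k) := by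
  obtain ⟨T, hT⟩ := Y.wtR u
  refine ⟨T, fun k m n x hm => ?_⟩
  rw [map_S]
  apply finsum_eq_zero_of_forall_eq_zero
  intro p
  have := (Y.wtD.pow p).comp (hT (k + p))
  rw [this m n x, smul_zero]
  rintro ⟨s, ⟨t, ht, rfl⟩, q, hq, he⟩
  rw [Set.mem_singleton_iff] at hq
  subst hq
  apply hm
  refine ⟨t, ht, ?_⟩
  rw [← he]
  push_cast
  ring

theorem dual_L {φ : X →ₗ[ℂ] ℂ} (h : InGradedDual Y.G.proj φ) (u : U) (k : ℤ) :
    InGradedDual Y.G.proj (φ ∘ₗ Y.L u k) := by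
  obtain ⟨T, hT⟩ := Y.wtL u
  exact (hT k).dual (wts_finite T k) h

theorem dual_S {φ : X →ₗ[ℂ] ℂ} (h : InGradedDual Y.G.proj φ) (u : U) (k : ℤ) :
    InGradedDual Y.G.proj (φ ∘ₗ Y.S u k) := by
  obtain ⟨T, hT⟩ := Y.wtS u
  exact (hT k).dual (wts_finite T k) h

theorem dual_D {φ : X →ₗ[ℂ] ℂ} (h : InGradedDual Y.G.proj φ) (n : ℕ) :
    InGradedDual Y.G.proj (φ ∘ₗ Y.D ^ n) :=
  (Y.wtD.pow n).dual (Set.finite_singleton _) h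

theorem exists_D_vanish {φ : X →ₗ[ℂ] ℂ} (h : InGradedDual Y.G.proj φ) :
    ∃ n0 : ℕ, ∀ n, n0 ≤ n → φ ∘ₗ Y.D ^ n = 0 := exists_pow_vanish Y.wtD h

theorem exists_L_vanish {φ : X →ₗ[ℂ] ℂ} (h : InGradedDual Y.G.proj φ) (u : U) :
    ∃ k0 : ℤ, ∀ k < k0, φ ∘ₗ Y.L u k = 0 := by
  obtain ⟨T, hT⟩ := Y.wtL u
  obtain ⟨k0, h0⟩ := exists_mode_vanish Y.G Y.G h T
  exact ⟨k0, fun k hk => h0 k hk _ (hT k)⟩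

theorem exists_S_vanish {φ : X →ₗ[ℂ] ℂ} (h : InGradedDual Y.G.proj φ) (u : U) :
    ∃ k0 : ℤ, ∀ k < k0, φ ∘ₗ Y.S u k = 0 := by
  obtain ⟨T, hT⟩ := Y.wtS u
  obtain ⟨k0, h0⟩ := exists_mode_vanish Y.G Y.G h T
  exact ⟨k0, fun k hk => h0 k hk _ (hT k)⟩

/-- The falling factorial with the sign coming from formal differentiation. -/
def fall (j : ℤ) (m : ℕ) : ℂ := ∏ i ∈ Finset.range m, (-((j : ℂ) - i))

theorem L_D (u : U) (j : ℤ) (x : X) : Y.L u j (Y.D x) = Y.D (Y.L u j x) + (j : ℂ) • Y.L u (j - 1) x := by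
  have := Y.D_comm u j x
  rw [sub_eq_iff_eq_add] at this
  rw [this]
  module

theorem L_D_pow (u : U) (p : ℕ) (j : ℤ) (x : X) :
    ((p.factorial : ℂ))⁻¹ • Y.L u j ((Y.D ^ p) x) = ∑ a ∈ Finset.HasAntidiagonal.antidiagonal p,
      (((-1) ^ a.1 * fall j a.1 * ((a.1.factorial : ℂ))⁻¹) * ((a.2.factorial : ℂ))⁻¹) •
        (Y.D ^ a.2) (Y.L u (j - a.1) x) := by
  induction p generalizing x with
  | zero => simp [fall]
  | succ p ih =>
    have key : ((p + 1 : ℕ) : ℂ) • (((p + 1).factorial : ℂ)⁻¹ • Y.L u j ((Y.D ^ (p + 1)) x)) =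
      ((p + 1 : ℕ) : ℂ) • ∑ a ∈ Finset.HasAntidiagonal.antidiagonal (p + 1),
      (((-1) ^ a.1 * fall j a.1 * ((a.1.factorial : ℂ))⁻¹) * ((a.2.factorial : ℂ))⁻¹) •
        (Y.D ^ a.2) (Y.L u (j - a.1) x) := by
      have hp : ((p + 1 : ℕ) : ℂ) ≠ 0 := by exact_mod_cast p.succ_ne_zero
      rw [smul_smul, Nat.factorial_succ, Nat.cast_mul, mul_inv, ← mul_assoc, mul_inv_cancel₀ hp,
        one_mul, pow_succ, Module.End.mul_apply, ih (Y.D x), Finset.smul_sum]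
      have e : ∀ a ∈ Finset.HasAntidiagonal.antidiagonal (p + 1), ((p + 1 : ℕ) : ℂ) •
          (((-1) ^ a.1 * fall j a.1 * ((a.1.factorial : ℂ))⁻¹) * ((a.2.factorial : ℂ))⁻¹) •
          (Y.D ^ a.2) (Y.L u (j - a.1) x) =
          ((((-1) ^ a.1 * fall j a.1 * ((a.1.factorial : ℂ))⁻¹) * ((a.2 : ℂ) * (a.2.factorial : ℂ)⁻¹)) •
          (Y.D ^ a.2) (Y.L u (j - a.1) x)) +
          ((((-1) ^ a.1 * fall j a.1 * ((a.1 : ℂ) * (a.1.factorial : ℂ)⁻¹)) * (a.2.factorial : ℂ)⁻¹) •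
          (Y.D ^ a.2) (Y.L u (j - a.1) x)) := by
        intro a ha
        rw [Finset.HasAntidiagonal.mem_antidiagonal] at ha
        rw [smul_smul, ← add_smul, ← ha]
        congr 1
        push_cast
        ring
      rw [Finset.sum_congr rfl e, Finset.sum_add_distrib, Finset.Nat.sum_antidiagonal_succ',
        Finset.Nat.sum_antidiagonal_succ (n := p)]
      simp only [Nat.cast_zero, zero_mul, mul_zero, zero_smul, zero_add]
      rw [← Finset.sum_add_distrib]
      apply Finset.sum_congr rfl
      intro a _
      have h1 (n : ℕ) : ((n + 1 : ℕ) : ℂ) * ((n + 1).factorial : ℂ)⁻¹ = (n.factorial : ℂ)⁻¹ := by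
        rw [Nat.factorial_succ, Nat.cast_mul, mul_inv, ← mul_assoc, mul_inv_cancel₀, one_mul]
        exact_mod_cast n.succ_ne_zero
      rw [h1, h1, Y.L_D, map_add, smul_add, map_smul, smul_smul, pow_succ Y.D, Module.End.mul_apply]
      congr 2
      · rw [fall, fall, Finset.prod_range_succ]
        push_cast
        ring
      · push_cast
        congr 2
        ring_nf
    have hp : ((p + 1 : ℕ) : ℂ) ≠ 0 := by exact_mod_cast p.succ_ne_zero
    exact smul_right_injective _ hp key

end Modes

theorem sum_antidiagonal_eq_rect {Z : Type*} [AddCommMonoid Z] (f : ℕ → ℕ → Z) (N n0 m0 : ℕ)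
    (hN : ∀ m n, N ≤ m + n → f m n = 0) (hn : ∀ m n, n0 ≤ n → f m n = 0)
    (hm : N ≤ m0) :
    ∑ p ∈ Finset.range N, ∑ a ∈ Finset.HasAntidiagonal.antidiagonal p, f a.1 a.2 =
      ∑ n ∈ Finset.range n0, ∑ m ∈ Finset.range m0, f m n := by
  rw [Finset.sum_sigma', Finset.sum_sigma']
  apply Finset.sum_bij_ne_zero (fun a _ _ => ⟨a.2.2, a.2.1⟩)
  · rintro ⟨p, m, n⟩ h1 h2
    simp only [Finset.mem_sigma, Finset.mem_range, Finset.HasAntidiagonal.mem_antidiagonal] at h1 ⊢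
    refine ⟨?_, by omega⟩
    by_contra hcon
    exact h2 (hn _ _ (not_lt.mp hcon))
  · rintro ⟨p, m, n⟩ h1 h2 ⟨p', m', n'⟩ h1' h2' h
    simp only [Finset.mem_sigma, Finset.mem_range, Finset.HasAntidiagonal.mem_antidiagonal] at h1 h1'
    simp only [Sigma.mk.injEq, heq_eq_eq] at h
    obtain ⟨rfl, rfl⟩ := h
    obtain ⟨_, rfl⟩ := h1
    obtain ⟨_, rfl⟩ := h1'
    rfl
  · rintro ⟨n, m⟩ h1 h2
    refine ⟨⟨m + n, m, n⟩, ?_, h2, rfl⟩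
    simp only [Finset.mem_sigma, Finset.mem_range, Finset.HasAntidiagonal.mem_antidiagonal, and_true]
    by_contra hcon
    exact h2 (hN _ _ (not_lt.mp hcon))
  · rintro ⟨p, m, n⟩ _ _
    rfl

end

section

variable {U : Type*} {X : Type*} [AddCommGroup X] [Module ℂ X]

/-- The alternating combination of a sequence of families entering the opposite modes. -/
def altSum (n0 : ℕ) (c : ℕ → Fam (Fin 2)) : Fam (Fin 2) := fun K =>
  ∑ n ∈ Finset.range n0, opc (K 1) n * c n ![K 0, K 1 + n]

theorem altSum_act (n0 : ℕ) (c : ℕ → Fam (Fin 2)) :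
    act (MvPolynomial.X 0 - MvPolynomial.X 1) (altSum n0 c) =
      altSum n0 fun n => act (MvPolynomial.X 0 + MvPolynomial.X 1) (c n) := by
  funext K
  rw [act_sub, Pi.sub_apply, act_X, act_X]
  simp only [altSum, act_add, Pi.add_apply, act_X]
  rw [← Finset.sum_sub_distrib]
  apply Finset.sum_congr rfl
  intro n _
  have e0 : (![K 0 + 1, K 1 + n] : Fin 2 → ℤ) = ![K 0, K 1 + n] + Pi.single 0 1 := by
    funext m; fin_cases m <;> simp
  have e1 : (![K 0, K 1 + 1 + n] : Fin 2 → ℤ) = ![K 0, K 1 + n] + Pi.single 1 1 := by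
    funext m; fin_cases m
    · simp
    · simp; ring
  simp only [Pi.single_eq_same, ne_eq, one_ne_zero, not_false_eq_true, Pi.single_eq_of_ne,
    zero_ne_one, add_zero, opc_succ]
  rw [e0, e1]
  ring

theorem altSum_act_pow (n0 : ℕ) (c : ℕ → Fam (Fin 2)) (N : ℕ)
    (h : ∀ n, act ((MvPolynomial.X 0 + MvPolynomial.X 1) ^ N) (c n) = 0) :
    act ((MvPolynomial.X 0 - MvPolynomial.X 1) ^ N) (altSum n0 c) = 0 := by
  have : ∀ N (c : ℕ → Fam (Fin 2)), act ((MvPolynomial.X 0 - MvPolynomial.X 1) ^ N) (altSum n0 c) =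
      altSum n0 fun n => act ((MvPolynomial.X 0 + MvPolynomial.X 1) ^ N) (c n) := by
    intro N
    induction N with
    | zero => intro c; simp only [pow_zero, act_one]
    | succ N ih =>
      intro c
      rw [pow_succ, act_mul, altSum_act, ih]
      simp only [pow_succ, act_mul]
  rw [this]
  simp only [h]
  funext K
  simp [altSum]

theorem opc_add (k : ℤ) (m n : ℕ) :
    opc k (m + n) * ((m + n).factorial : ℂ) * (-1) ^ m = opc k n * (n.factorial : ℂ) := by
  unfold opc
  have h1 : ((m + n).factorial : ℂ) ≠ 0 := by exact_mod_cast (m + n).factorial_ne_zero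
  have h2 : (n.factorial : ℂ) ≠ 0 := by exact_mod_cast n.factorial_ne_zero
  rw [mul_assoc, mul_assoc, inv_mul_cancel_left₀ h1, mul_assoc, inv_mul_cancel₀ h2]
  rw [show k + ((m + n : ℕ) : ℤ) + 1 = (k + n + 1) + m by push_cast; ring,
    zpow_add₀ (by norm_num), zpow_natCast, mul_assoc, ← pow_add, ← two_mul, pow_mul]
  simp

namespace Modes
variable (Y : Modes U X)

/-- The family of matrix coefficients of a product of a left and a right mode. -/
def famP (φ : X →ₗ[ℂ] ℂ) (u v : U) (x : X) : Fam (Fin 2) := fam2 fun a b => φ (Y.L u a (Y.R v b x))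

/-- The family of matrix coefficients of an iterate of a left and a right mode. -/
def famI (φ : X →ₗ[ℂ] ℂ) (u v : U) (x : X) : Fam (Fin 2) := fam2 fun a b => φ (Y.R v b (Y.L u a x))

theorem trunc_famP (φ : X →ₗ[ℂ] ℂ) (v u : U) (x : X) :
    ∃ N : ℤ, ∀ j k, N ≤ k → φ (Y.L u j (Y.R v k x)) = 0 := by
  obtain ⟨N, hN⟩ := Y.truncR v x
  exact ⟨N, fun j k hk => by rw [hN k hk, map_zero, map_zero]⟩

theorem L_S_apply (φ : X →ₗ[ℂ] ℂ) (n0 : ℕ) (h0 : ∀ n, n0 ≤ n → φ ∘ₗ Y.D ^ n = 0)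
    (u v : U) (j k : ℤ) (x : X) : φ (Y.L u j (Y.S v k x)) =
      ∑ n ∈ Finset.range n0, opc k n *
        expT T2 (Y.famP (φ ∘ₗ Y.D ^ n) u v x) ![j, k + n] := by
  obtain ⟨N, hN⟩ := Y.truncR v x
  set N' := (N - k).toNat with hN'
  have hexp : ∀ n : ℕ, expT T2 (Y.famP (φ ∘ₗ Y.D ^ n) u v x) ![j, k + n] =
      ∑ m ∈ Finset.range N', ((m.factorial : ℂ))⁻¹ *
        (fall j m * φ ((Y.D ^ n) (Y.L u (j - m) (Y.R v (k + (m + n : ℕ)) x)))) := by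
    intro n
    have hT : ∀ m : ℕ, (T2 ^ m) (Y.famP (φ ∘ₗ Y.D ^ n) u v x) ![j, k + n] =
        fall j m * φ ((Y.D ^ n) (Y.L u (j - m) (Y.R v (k + (m + n : ℕ)) x))) := by
      intro m
      rw [T2_pow]
      simp only [famP, fam2, Matrix.cons_val_zero, Matrix.cons_val_one, fall, LinearMap.comp_apply]
      rw [show k + (n : ℤ) + m = k + (m + n : ℕ) by push_cast; ring]
    rw [expT_eq_sum _ _ _ N']
    · simp only [hT]
    · intro m hm
      rw [hT, hN _ (by push_cast; omega), map_zero, map_zero, map_zero, mul_zero]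
  have e1 : φ (Y.L u j (Y.S v k x)) = ∑ p ∈ Finset.range N',
      ∑ a ∈ Finset.HasAntidiagonal.antidiagonal p, opc k a.2 * (((a.1.factorial : ℂ))⁻¹ *
        (fall j a.1 * φ ((Y.D ^ a.2) (Y.L u (j - a.1) (Y.R v (k + (a.1 + a.2 : ℕ)) x))))) := by
    rw [← LinearMap.comp_apply, Y.map_S]
    rw [finsum_eq_sum_of_support_subset (s := Finset.range N')]
    · apply Finset.sum_congr rfl
      intro p _
      have hp : (p.factorial : ℂ) ≠ 0 := by exact_mod_cast p.factorial_ne_zero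
      rw [LinearMap.comp_apply]
      have := congrArg φ (Y.L_D_pow u p j (Y.R v (k + p) x))
      rw [map_smul, map_sum, smul_eq_mul, inv_mul_eq_iff_eq_mul₀ hp] at this
      rw [this, smul_eq_mul, Finset.mul_sum, Finset.mul_sum]
      apply Finset.sum_congr rfl
      rintro ⟨m, n⟩ hmn
      rw [Finset.HasAntidiagonal.mem_antidiagonal] at hmn
      simp only at hmn ⊢
      subst hmn
      have h2 : (n.factorial : ℂ) ≠ 0 := by exact_mod_cast n.factorial_ne_zero
      rw [map_smul, smul_eq_mul]
      have := opc_add k m n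
      rw [← mul_inv_cancel_right₀ h2 (opc k n), ← this]
      ring
    · intro p hp
      simp only [Finset.coe_range, Set.mem_Iio]
      by_contra hcon
      apply hp
      simp only
      rw [hN _ (by omega), map_zero, map_zero, smul_zero]
  rw [e1]
  simp only [hexp, Finset.mul_sum]
  apply sum_antidiagonal_eq_rect (fun m n => opc k n * (((m.factorial : ℂ))⁻¹ *
        (fall j m * φ ((Y.D ^ n) (Y.L u (j - m) (Y.R v (k + (m + n : ℕ)) x))))))
  · intro m n hmn
    rw [hN _ (by omega)]
    simp
  · intro m n hn
    have := LinearMap.congr_fun (h0 n hn) (Y.L u (j - m) (Y.R v (k + (m + n : ℕ)) x))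
    simp only [LinearMap.comp_apply, LinearMap.zero_apply] at this
    rw [this]
    simp
  · exact le_rfl

theorem locality {φ : X →ₗ[ℂ] ℂ} (hφ : InGradedDual Y.G.proj φ) (u v : U) (x : X) (N : ℕ)
    (hN : Y.C u v ≤ N) :
    act ((MvPolynomial.X 0 - MvPolynomial.X 1) ^ N)
      (fam2 fun a b => φ (Y.L u a (Y.S v b x)) - φ (Y.S v b (Y.L u a x))) = 0 := by
  obtain ⟨n0, h0⟩ := Y.exists_D_vanish hφ
  have e : (fam2 fun a b => φ (Y.L u a (Y.S v b x)) - φ (Y.S v b (Y.L u a x))) =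
      altSum n0 fun n => expT T2 (Y.famP (φ ∘ₗ Y.D ^ n) u v x) - Y.famI (φ ∘ₗ Y.D ^ n) u v x := by
    funext K
    simp only [fam2, altSum]
    rw [Y.L_S_apply φ n0 h0, Y.map_S_eq_sum φ n0 h0, ← Finset.sum_sub_distrib]
    apply Finset.sum_congr rfl
    intro n _
    rw [Pi.sub_apply, mul_sub]
    simp only [famI, fam2, Matrix.cons_val_zero, Matrix.cons_val_one]
  rw [e]
  apply altSum_act_pow
  intro n
  obtain ⟨Q, Q', hC, h1, h2, h3⟩ := Y.assoc _ (Y.dual_D hφ n) u v x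
  have := weak_assoc (P := fun a b => (φ ∘ₗ Y.D ^ n) (Y.L u a (Y.R v b x)))
    (I := fun a b => (φ ∘ₗ Y.D ^ n) (Y.R v b (Y.L u a x))) Q Q' h1 h2 h3 (Y.trunc_famP _ v u x)
  obtain ⟨d, hd⟩ := Nat.exists_eq_add_of_le (hC.trans hN)
  rw [hd, pow_add, mul_comm, act_mul]
  rw [famP, famI, this, map_zero]

/-- The system of mutually local operators indexed by `ι` with names `u i`. -/
def sys {ι : Type*} [Fintype ι] [DecidableEq ι] (u : ι → U) (M : ι → ι → ℕ)
    (hM : ∀ i j, Y.C (u i) (u j) ≤ M i j) : Sys M X where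
  L i k := Y.L (u i) k
  S i k := Y.S (u i) k
  Du φ := InGradedDual Y.G.proj φ
  du_L _ _ _ h := Y.dual_L h _ _
  du_S _ _ _ h := Y.dual_S h _ _
  loc _ h x i j := Y.locality h _ _ x _ (hM i j)

end Modes

end

section

variable {V : Type*} [AddCommGroup V] [Module ℂ V]
variable {W : Type*} [AddCommGroup W] [Module ℂ W] {A : MOSVA V}

theorem isShift_of_d {X X' : Type*} [AddCommGroup X] [Module ℂ X] [AddCommGroup X'] [Module ℂ X']
    (G : CGrading X) (G' : CGrading X') (O : X →ₗ[ℂ] X') (s : ℂ)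
    (h : ∀ x, G'.d (O x) = O (G.d x) + s • O x) : IsShift G G' {s} O := by
  intro m n x hm
  have h1 := congrArg (G'.proj m) (h (G.proj n x))
  rw [G'.proj_d, G.d_proj, map_smul, map_add, map_smul, map_smul, ← add_smul, ← sub_eq_zero,
    ← sub_smul, smul_eq_zero] at h1
  refine h1.resolve_left fun h2 => hm ?_
  rw [Set.mem_singleton_iff]
  linear_combination h2

theorem MOSVA.d_vac (A : MOSVA V) : A.gr.d A.vac = 0 := by
  have h := A.d_comm A.vac A.vac (-1)
  rw [A.creation_lim, A.creation_lim, A.identity, if_pos rfl] at h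
  simpa using h

/-- The modes of a MOSVA acting on itself. -/
def MOSVA.modes (A : MOSVA V) (hA : A.PoleOrder) : Modes V V where
  G := A.gr.toC
  L u k := LinearMap.proj k ∘ₗ A.Y u
  R v k := LinearMap.proj k ∘ₗ A.Y.flip v
  D := LinearMap.proj (-2) ∘ₗ A.Y.flip A.vac
  wtL u := isShift_of_d_comm A.gr.toC A.gr.toC A.gr.toC A.Y (by
    intro u x k
    simp only [ZGrading.d_toC]
    exact A.d_comm u x k) u
  wtR v := isShift_of_d_comm A.gr.toC A.gr.toC A.gr.toC A.Y.flip (by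
    intro u x k
    simp only [ZGrading.d_toC, LinearMap.flip_apply]
    rw [A.d_comm x u k]
    abel) v
  wtD := isShift_of_d _ _ _ _ (by
    intro x
    simp only [ZGrading.d_toC, LinearMap.comp_apply, LinearMap.proj_apply, LinearMap.flip_apply]
    rw [A.d_comm, A.d_vac]
    norm_num)
  truncR v x := A.trunc x v
  D_comm u k x := A.D_comm u x k
  C u v := (hA u v).choose
  assoc φ hφ u v x := by
    rw [ZGrading.dual_toC] at hφ
    obtain ⟨Q, h1, h2⟩ := A.associativity u x v φ hφ
    obtain ⟨Q', hC, h3⟩ := (hA u v).choose_spec φ hφ x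
    exact ⟨Q, Q', hC, h1, h2, h3⟩

/-- The modes of a bimodule. -/
def Bimod.modes (B : Bimod A W) (hB : B.PoleOrder) : Modes V W where
  G := B.gr
  L u k := LinearMap.proj k ∘ₗ B.YL u
  R v k := LinearMap.proj k ∘ₗ B.YR.flip v
  D := B.DW
  wtL u := isShift_of_d_comm A.gr.toC B.gr B.gr B.YL (by
    intro u x k
    simp only [ZGrading.d_toC]
    exact B.d_commL u x k) u
  wtR v := isShift_of_d_comm A.gr.toC B.gr B.gr B.YR.flip (by
    intro u x k
    simp only [ZGrading.d_toC, LinearMap.flip_apply]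
    rw [B.d_commR x u k]
    abel) v
  wtD := by
    intro m n x hm
    have := LinearMap.congr_fun (B.DW_wt n) x
    simp only [LinearMap.comp_apply] at this
    rw [this, B.gr.proj_proj, if_neg]
    rintro rfl
    exact hm (by simp)
  truncR v x := B.truncR x v
  D_comm u k x := B.D_commL u x k
  C u v := (hB.2.2 u v).choose
  assoc φ hφ u v x := by
    obtain ⟨Q, h1, h2⟩ := B.compatAssoc u v x φ hφ
    obtain ⟨Q', hC, h3⟩ := (hB.2.2 u v).choose_spec φ hφ x
    exact ⟨Q, Q', hC, h1, h2, h3⟩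

namespace Modes
variable {U X : Type*} [AddCommGroup X] [Module ℂ X] (Y : Modes U X)

theorem L_nonneg (u : U) (x : X) (hD : Y.D x = 0) (ht : ∃ N : ℤ, ∀ k, N ≤ k → Y.L u k x = 0) (k : ℤ)
    (hk : 0 ≤ k) : Y.L u k x = 0 := by
  obtain ⟨N, hN⟩ := ht
  have : ∀ n : ℕ, ∀ k : ℤ, 0 ≤ k → N ≤ k + n → Y.L u k x = 0 := by
    intro n
    induction n with
    | zero => intro k _ h; exact hN k (by simpa using h)
    | succ n ih =>
      intro k hk h
      have h1 := Y.D_comm u (k + 1) x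
      rw [hD, map_zero, sub_zero, ih (k + 1) (by omega) (by push_cast at h; omega), map_zero,
        add_sub_cancel_right, eq_comm, smul_eq_zero] at h1
      refine h1.resolve_left ?_
      rw [neg_eq_zero]
      exact_mod_cast (by omega : k + 1 ≠ 0)
  exact this (N - k).toNat k hk (by omega)

theorem L_neg (u : U) (x : X) (hD : Y.D x = 0) (n : ℕ) :
    Y.L u (-1 - n) x = (n.factorial : ℂ)⁻¹ • (Y.D ^ n) (Y.L u (-1) x) := by
  induction n with
  | zero => simp
  | succ n ih =>
    have h1 := Y.D_comm u (-1 - n) x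
    rw [hD, map_zero, sub_zero, ih, map_smul] at h1
    rw [show (-1 - ((n + 1 : ℕ) : ℤ)) = -1 - n - 1 by push_cast; ring, pow_succ',
      Module.End.mul_apply, Nat.factorial_succ, Nat.cast_mul, mul_inv, mul_smul, h1, smul_smul]
    have : (((n + 1 : ℕ) : ℂ)) ≠ 0 := by exact_mod_cast n.succ_ne_zero
    rw [show -((-1 - (n : ℤ) : ℤ) : ℂ) = ((n + 1 : ℕ) : ℂ) by push_cast; ring, inv_mul_cancel₀ this,
      one_smul]

theorem S_nonneg (u : U) (x : X) (hR : ∀ k, k ≠ -1 → Y.R u k x = 0) (k : ℤ) (hk : 0 ≤ k) :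
    Y.S u k x = 0 := by
  rw [Y.S_apply]
  apply finsum_eq_zero_of_forall_eq_zero
  intro m
  rw [hR _ (by omega), map_zero, smul_zero]

theorem S_neg (u : U) (x : X) (hR : ∀ k, k ≠ -1 → Y.R u k x = 0) (n : ℕ) :
    Y.S u (-1 - n) x = (n.factorial : ℂ)⁻¹ • (Y.D ^ n) (Y.R u (-1) x) := by
  rw [Y.S_apply, finsum_eq_single _ n]
  · rw [sub_add_cancel, opc, sub_add_cancel]
    simp
  · intro m hm
    rw [hR _ (by omega), map_zero, smul_zero]

end Modes

theorem int_cases (k : ℤ) : 0 ≤ k ∨ ∃ n : ℕ, k = -1 - n := by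
  rcases le_or_gt 0 k with h | h
  · exact Or.inl h
  · exact Or.inr ⟨(-1 - k).toNat, by omega⟩

theorem MOSVA.D_vac (A : MOSVA V) (hA : A.PoleOrder) : (A.modes hA).D A.vac = 0 := by
  show A.Y A.vac A.vac (-2) = 0
  rw [A.identity, if_neg (by norm_num)]

theorem MOSVA.S_vac (A : MOSVA V) (hA : A.PoleOrder) (u : V) (k : ℤ) :
    (A.modes hA).S u k A.vac = (A.modes hA).L u k A.vac := by
  have hR : ∀ k, k ≠ -1 → (A.modes hA).R u k A.vac = 0 := by
    intro k hk
    show A.Y A.vac u k = 0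
    rw [A.identity, if_neg hk]
  rcases int_cases k with h | ⟨n, rfl⟩
  · rw [(A.modes hA).S_nonneg u _ hR k h]
    exact (A.creation u k h).symm
  · rw [(A.modes hA).S_neg u _ hR, (A.modes hA).L_neg u _ (A.D_vac hA)]
    congr 2
    show A.Y A.vac u (-1) = A.Y u A.vac (-1)
    rw [A.identity, if_pos rfl, A.creation_lim]

/-- The map `v ↦ (Y_W^L)_{-1}(v)w`. -/
def Bimod.fL (B : Bimod A W) (w : W) : V →ₗ[ℂ] W := LinearMap.proj (-1) ∘ₗ B.YL.flip w

/-- The map `v ↦ (Y_W^R)_{-1}(w)v`. -/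
def Bimod.fR (B : Bimod A W) (w : W) : V →ₗ[ℂ] W := LinearMap.proj (-1) ∘ₗ B.YR w

section VacuumLike
variable (B : Bimod A W) (w : W) (hwD : B.DW w = 0)
include hwD

theorem Bimod.YL_nonneg (hB : B.PoleOrder) (v : V) (k : ℤ) (hk : 0 ≤ k) : B.YL v w k = 0 :=
  (B.modes hB).L_nonneg v w hwD (B.truncL v w) k hk

theorem Bimod.YL_neg (hB : B.PoleOrder) (v : V) (n : ℕ) :
    B.YL v w (-1 - n) = (n.factorial : ℂ)⁻¹ • (B.DW ^ n) (B.fL w v) :=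
  (B.modes hB).L_neg v w hwD n

theorem Bimod.YR_eq_zero (v : V) (k : ℤ) (hk : k ≠ -1) : B.YR w v k = 0 := by
  have h := B.D_derivR w v (k + 1)
  rw [hwD, map_zero, add_sub_cancel_right, eq_comm] at h
  simp only [LinearMap.zero_apply, Pi.zero_apply, smul_eq_zero] at h
  refine h.resolve_left ?_
  rw [neg_eq_zero]
  exact_mod_cast (by omega : k + 1 ≠ 0)

theorem Bimod.YsR_nonneg (hB : B.PoleOrder) (v : V) (k : ℤ) (hk : 0 ≤ k) : B.YsR v w k = 0 :=
  (B.modes hB).S_nonneg v w (B.YR_eq_zero w hwD v) k hk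

theorem Bimod.YsR_neg (hB : B.PoleOrder) (v : V) (n : ℕ) :
    B.YsR v w (-1 - n) = (n.factorial : ℂ)⁻¹ • (B.DW ^ n) (B.fR w v) :=
  (B.modes hB).S_neg v w (B.YR_eq_zero w hwD v) n

theorem Bimod.fL_D (hB : B.PoleOrder) (v : V) : B.fL w (A.D v) = B.DW (B.fL w v) := by
  have h := B.YL_neg w hwD hB v 1
  have h2 := B.D_derivL v w (-1)
  simp only [Nat.factorial_one, Nat.cast_one, inv_one, one_smul, pow_one] at h
  rw [← h]
  show B.YL (A.D v) w (-1) = _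
  rw [h2]
  simp

theorem Bimod.fR_D (v : V) : B.fR w (A.D v) = B.DW (B.fR w v) := by
  have h := B.D_commR w v (-1)
  rw [B.YR_eq_zero w hwD v (-1 - 1) (by norm_num), smul_zero, sub_eq_zero] at h
  exact h.symm

omit hwD in
theorem Bimod.fL_vac : B.fL w A.vac = w := by
  show B.YL A.vac w (-1) = w
  rw [B.identityL, if_pos rfl]

omit hwD in
theorem Bimod.fR_vac : B.fR w A.vac = w := B.creationR_lim w

end VacuumLike

section Weight
variable (B : Bimod A W) (w : W) (hw0 : B.gr.proj 0 w = w)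
include hw0

theorem Bimod.d_eq_zero : B.gr.d w = 0 := by
  rw [← hw0, B.gr.d_proj, zero_smul]

theorem Bimod.fL_shift : IsShift A.gr.toC B.gr {0} (B.fL w) := by
  apply isShift_of_d
  intro x
  rw [ZGrading.d_toC]
  have := B.d_commL x w (-1)
  rw [B.d_eq_zero w hw0] at this
  show B.gr.d (B.YL x w (-1)) = B.YL (A.gr.d x) w (-1) + (0 : ℂ) • B.YL x w (-1)
  simpa using this

theorem Bimod.fR_shift : IsShift A.gr.toC B.gr {0} (B.fR w) := by
  apply isShift_of_d
  intro x
  rw [ZGrading.d_toC]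
  have := B.d_commR w x (-1)
  rw [B.d_eq_zero w hw0] at this
  show B.gr.d (B.YR w x (-1)) = B.YR w (A.gr.d x) (-1) + (0 : ℂ) • B.YR w x (-1)
  simpa using this

end Weight

theorem act_add_cancel_right (N : ℕ) (c : Fam (Fin 2)) (h : ∃ k0 : ℤ, ∀ K : Fin 2 → ℤ, k0 ≤ K 1 → c K = 0)
    (h0 : act ((MvPolynomial.X 0 + MvPolynomial.X 1) ^ N) c = 0) : c = 0 := by
  induction N generalizing c with
  | zero => rwa [pow_zero, act_one] at h0
  | succ N ih =>
    obtain ⟨k0, hk⟩ := h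
    have h1 : act (MvPolynomial.X 0 + MvPolynomial.X 1) c = 0 := by
      apply ih
      · refine ⟨k0, fun K hK => ?_⟩
        rw [act_add, Pi.add_apply, act_X, act_X, hk _ (by simpa using hK), hk _ (by simp; omega),
          add_zero]
      · rwa [← act_mul, ← pow_succ]
    have : ∀ n : ℕ, ∀ K : Fin 2 → ℤ, k0 - n ≤ K 1 → c K = 0 := by
      intro n
      induction n with
      | zero => intro K hK; exact hk K (by simpa using hK)
      | succ n ihn =>
        intro K hK
        have h2 := congrFun h1 (K - Pi.single 0 1)
        rw [act_add, Pi.add_apply, act_X, act_X, sub_add_cancel,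
          ihn (K - Pi.single 0 1 + Pi.single 1 1) (by simp; push_cast at hK; omega), add_zero] at h2
        exact h2
    funext K
    exact this (k0 - K 1).toNat K (by omega)

theorem act_add_cancel_left (N : ℕ) (c : Fam (Fin 2)) (h : ∃ k0 : ℤ, ∀ K : Fin 2 → ℤ, K 0 < k0 → c K = 0)
    (h0 : act ((MvPolynomial.X 0 + MvPolynomial.X 1) ^ N) c = 0) : c = 0 := by
  induction N generalizing c with
  | zero => rwa [pow_zero, act_one] at h0
  | succ N ih =>
    obtain ⟨k0, hk⟩ := h
    have h1 : act (MvPolynomial.X 0 + MvPolynomial.X 1) c = 0 := by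
      apply ih
      · refine ⟨k0 - 1, fun K hK => ?_⟩
        rw [act_add, Pi.add_apply, act_X, act_X, hk _ (by simp; omega), hk _ (by simp; omega),
          add_zero]
      · rwa [← act_mul, ← pow_succ]
    have : ∀ n : ℕ, ∀ K : Fin 2 → ℤ, K 0 < k0 + n → c K = 0 := by
      intro n
      induction n with
      | zero => intro K hK; exact hk K (by simpa using hK)
      | succ n ihn =>
        intro K hK
        have h2 := congrFun h1 (K - Pi.single 0 1)
        rw [act_add, Pi.add_apply, act_X, act_X, sub_add_cancel,
          ihn (K - Pi.single 0 1 + Pi.single 1 1) (by simp; push_cast at hK; omega), add_zero] at h2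
        exact h2
    funext K
    exact this (K 0 - k0 + 1).toNat K (by omega)

theorem expT_T2_apply (c : Fam (Fin 2)) (K : Fin 2 → ℤ)
    (h : ∀ m : ℕ, m ≠ 0 → (T2 ^ m) c K = 0) : expT T2 c K = c K := by
  rw [expT_eq_sum _ _ _ 1 (fun n hn => h n (by omega))]
  simp

section Intertwine
variable (B : Bimod A W) (w : W) (hwD : B.DW w = 0)
include hwD

theorem Bimod.fL_Y (hB : B.PoleOrder) (u v : V) (k : ℤ) : B.fL w (A.Y u v k) = B.YL u (B.fL w v) k := by
  apply B.gr.separate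
  intro φ hφ
  obtain ⟨Q, h1, h2⟩ := B.associativityL u v w φ hφ
  have hz := fun (v : V) (k : ℤ) (hk : 0 ≤ k) => B.YL_nonneg w hwD hB v k hk
  have h := weak_assoc (P := fun a b => φ (B.YL u (B.YL v w b) a))
    (I := fun a b => φ (B.YL (A.Y u v a) w b)) Q Q h1 h2 h1
    ⟨0, fun j k hk => by simp [hz v k hk]⟩
  have hT : ∀ K : Fin 2 → ℤ, -1 ≤ K 1 →
      expT T2 (fam2 fun a b => φ (B.YL u (B.YL v w b) a)) K = φ (B.YL u (B.YL v w (K 1)) (K 0)) := by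
    intro K hK
    rw [expT_T2_apply]
    · rfl
    · intro m hm
      rw [T2_pow, fam2]
      simp only [Matrix.cons_val_one, Matrix.cons_val_zero]
      rw [hz v _ (by omega)]
      simp
  have h0 := act_add_cancel_right _ _ ⟨0, fun K hK => by
    rw [Pi.sub_apply, hT K (by omega), fam2, hz v _ hK, hz _ _ hK]
    simp⟩ h
  have := congrFun h0 ![k, -1]
  rw [Pi.sub_apply, hT _ (by simp), Pi.zero_apply, sub_eq_zero] at this
  exact this.symm

theorem Bimod.fR_Y (u v : V) (k : ℤ) : B.fR w (A.Y u v k) = B.YR (B.fR w u) v k := by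
  apply B.gr.separate
  intro φ hφ
  obtain ⟨Q, h1, h2⟩ := B.associativityR w u v φ hφ
  have hz := B.YR_eq_zero w hwD
  have h := weak_assoc (P := fun a b => φ (B.YR w (A.Y u v b) a))
    (I := fun a b => φ (B.YR (B.YR w u a) v b)) Q Q h1 h2 h1 (by
      obtain ⟨N, hN⟩ := A.trunc u v
      exact ⟨N, fun j k hk => by simp [hN k hk]⟩)
  have hT : ∀ K : Fin 2 → ℤ,
      expT T2 (fam2 fun a b => φ (B.YR w (A.Y u v b) a)) K = φ (B.YR w (A.Y u v (K 1)) (K 0)) := by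
    intro K
    rw [expT_T2_apply]
    · rfl
    · intro m hm
      rw [T2_pow, fam2]
      simp only [Matrix.cons_val_one, Matrix.cons_val_zero]
      by_cases hK : K 0 - m = -1
      · have : ∏ i ∈ Finset.range m, (-((K 0 : ℂ) - i)) = 0 := by
          apply Finset.prod_eq_zero (i := m - 1) (by simp; omega)
          rw [show K 0 = (m : ℤ) - 1 by omega, Nat.cast_sub (by omega)]
          push_cast
          ring
        rw [this, zero_mul]
      · rw [hz _ _ hK]
        simp
  have h0 := act_add_cancel_left _ _ ⟨-1, fun K hK => by
    rw [Pi.sub_apply, hT K, fam2, hz _ _ (by omega), hz _ _ (by omega)]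
    simp⟩ h
  have := congrFun h0 ![-1, k]
  rw [Pi.sub_apply, hT _, Pi.zero_apply, sub_eq_zero] at this
  exact this

theorem Bimod.fR_S (hA : A.PoleOrder) (hB : B.PoleOrder) (u v : V) (k : ℤ) :
    (B.modes hB).S v k (B.fR w u) = B.fR w ((A.modes hA).S v k u) := by
  rw [(A.modes hA).map_S, Modes.S_apply]
  apply finsum_congr
  intro m
  have hD : ∀ (n : ℕ) (x : V), B.fR w (((A.modes hA).D ^ n) x) = (B.DW ^ n) (B.fR w x) := by
    intro n
    induction n with
    | zero => intro x; rfl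
    | succ n ih =>
      intro x
      rw [pow_succ, Module.End.mul_apply, ih, pow_succ, Module.End.mul_apply]
      exact congrArg _ (B.fR_D w hwD x)
  rw [hD]
  exact congrArg _ (congrArg _ (B.fR_Y w hwD u v (k + m)).symm)

end Intertwine

end

section

section Chain
variable {V : Type*} [AddCommGroup V] [Module ℂ V]
variable {W : Type*} [AddCommGroup W] [Module ℂ W] {A : MOSVA V}
variable {ι : Type*} [Fintype ι] [DecidableEq ι]

variable (B : Bimod A W) (w : W) (hA : A.PoleOrder) (hB : B.PoleOrder)
  (hw0 : B.gr.proj 0 w = w) (hwD : B.DW w = 0) (u : ι → V)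

/-- Left words over the MOSVA. -/
def MOSVA.wordL (A : MOSVA V) (hA : A.PoleOrder) (u : ι → V) (ℓ : List ι) (K : ι → ℤ) :
    Module.End ℂ V := word (fun i => (A.modes hA).L (u i)) ℓ K

/-- Opposite right words over the MOSVA. -/
def MOSVA.wordS (A : MOSVA V) (hA : A.PoleOrder) (u : ι → V) (ℓ : List ι) (K : ι → ℤ) :
    Module.End ℂ V := word (fun i => (A.modes hA).S (u i)) ℓ K

/-- Left words over the bimodule. -/
def Bimod.wordL (B : Bimod A W) (hB : B.PoleOrder) (u : ι → V) (ℓ : List ι) (K : ι → ℤ) :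
    Module.End ℂ W := word (fun i => (B.modes hB).L (u i)) ℓ K

/-- Opposite right words over the bimodule. -/
def Bimod.wordS (B : Bimod A W) (hB : B.PoleOrder) (u : ι → V) (ℓ : List ι) (K : ι → ℤ) :
    Module.End ℂ W := word (fun i => (B.modes hB).S (u i)) ℓ K

include hwD in
theorem Bimod.fL_wordL (ℓ : List ι) (K : ι → ℤ) :
    B.fL w (A.wordL hA u ℓ K A.vac) = B.wordL hB u ℓ K w := by
  unfold MOSVA.wordL Bimod.wordL
  induction ℓ with
  | nil => rw [word_nil, word_nil, B.fL_vac]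
  | cons i ℓ ih =>
    rw [word_cons, word_cons, ← ih]
    exact B.fL_Y w hwD hB _ _ _

include hwD in
theorem Bimod.fR_wordS (ℓ : List ι) (K : ι → ℤ) :
    B.fR w (A.wordS hA u ℓ K A.vac) = B.wordS hB u ℓ K w := by
  unfold MOSVA.wordS Bimod.wordS
  induction ℓ with
  | nil => rw [word_nil, word_nil, B.fR_vac]
  | cons i ℓ ih =>
    rw [word_cons, word_cons, ← ih]
    exact (B.fR_S w hwD hA hB _ _ _).symm

variable (M : ι → ι → ℕ) (hMV : ∀ i j, (A.modes hA).C (u i) (u j) ≤ M i j)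
  (hMW : ∀ i j, (B.modes hB).C (u i) (u j) ≤ M i j)
  (φ : W →ₗ[ℂ] ℂ) (hφ : InGradedDual B.gr.proj φ)

include hw0 in
theorem Bimod.dual_fL {ψ : W →ₗ[ℂ] ℂ} (hψ : InGradedDual B.gr.proj ψ) :
    InGradedDual A.gr.toC.proj (ψ ∘ₗ B.fL w) :=
  (B.fL_shift w hw0).dual (Set.finite_singleton _) hψ

include hw0 in
theorem Bimod.dual_fR {ψ : W →ₗ[ℂ] ℂ} (hψ : InGradedDual B.gr.proj ψ) :
    InGradedDual A.gr.toC.proj (ψ ∘ₗ B.fR w) :=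
  (B.fR_shift w hw0).dual (Set.finite_singleton _) hψ

include hφ hMW in
theorem Bimod.dual_wordL (ℓ : List ι) (K : ι → ℤ) :
    InGradedDual B.gr.proj (φ ∘ₗ B.wordL hB u ℓ K) :=
  ((B.modes hB).sys u M hMW).du_word_L φ hφ ℓ K

include hφ hMW in
theorem Bimod.dual_wordS (ℓ : List ι) (K : ι → ℤ) :
    InGradedDual B.gr.proj (φ ∘ₗ B.wordS hB u ℓ K) :=
  ((B.modes hB).sys u M hMW).du_word_S φ hφ ℓ K

theorem Ind.comp {Z Z' : Type*} {i : ι} {f : (ι → ℤ) → Z} (hf : Ind i f) (g : Z → Z') :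
    Ind i fun K => g (f K) := fun K => by simp only [hf K]

include hφ hMV hMW hw0 hwD in
theorem Bimod.negAt_LS {P Q : List ι} (hP : P.Nodup) (hQ : Q.Nodup) (hd : ∀ j ∈ Q, j ∉ P) (i : ι)
    (hi : i ∈ P ∨ i ∈ Q) :
    NegAt i (act (den M) fun K => φ (B.wordL hB u P K (B.wordS hB u Q K w))) := by
  rcases hi with hi | hi
  · have h := ((B.modes hB).sys u M hMW).swap_lists hP hQ hd (fun _ => φ) (fun _ => w)
      (fun _ => hφ) (fun _ _ _ => rfl) (fun _ _ _ => rfl) (fun _ _ _ => rfl) (fun _ _ _ => rfl)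
    have h2 := ((A.modes hA).sys u M hMV).negAt_word A.vac (fun i k => A.S_vac hA (u i) k)
      (fun i k hk => A.creation (u i) k hk) hP (fun K => (φ ∘ₗ B.wordS hB u Q K) ∘ₗ B.fL w)
      (fun K => B.dual_fL w hw0 (B.dual_wordS hB u M hMW φ hφ Q K))
      (fun j hj => (Ind.comp_word (ψ := fun _ => φ) _ (fun _ => rfl)
        (fun h => hd j h hj)).comp (fun g => g ∘ₗ B.fL w)) i hi
    have e : (fun K => ((φ ∘ₗ B.wordS hB u Q K) ∘ₗ B.fL w)
        (word ((A.modes hA).sys u M hMV).L P K A.vac)) =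
        fun K => φ (B.wordS hB u Q K (B.wordL hB u P K w)) := by
      funext K
      rw [← B.fL_wordL w hA hB hwD u]
      rfl
    rw [e] at h2
    refine Eq.subst (motive := NegAt i) ?_ h2
    exact h
  · have h1 := ((A.modes hA).sys u M hMV).reversal A.vac (fun i k => A.S_vac hA (u i) k)
      (List.nodup_reverse.mpr hQ) (fun K => (φ ∘ₗ B.wordL hB u P K) ∘ₗ B.fR w)
      (fun K => B.dual_fR w hw0 (B.dual_wordL hB u M hMW φ hφ P K))
      (fun j hj => (Ind.comp_word (ψ := fun _ => φ) _ (fun _ => rfl)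
        (hd j (List.mem_reverse.mp hj))).comp (fun g => g ∘ₗ B.fR w))
    have h2 := ((A.modes hA).sys u M hMV).negAt_word A.vac (fun i k => A.S_vac hA (u i) k)
      (fun i k hk => A.creation (u i) k hk) (List.nodup_reverse.mpr hQ)
      (fun K => (φ ∘ₗ B.wordL hB u P K) ∘ₗ B.fR w)
      (fun K => B.dual_fR w hw0 (B.dual_wordL hB u M hMW φ hφ P K))
      (fun j hj => (Ind.comp_word (ψ := fun _ => φ) _ (fun _ => rfl)
        (hd j (List.mem_reverse.mp hj))).comp (fun g => g ∘ₗ B.fR w)) i (List.mem_reverse.mpr hi)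
    have e : (fun K => ((φ ∘ₗ B.wordL hB u P K) ∘ₗ B.fR w)
        (word ((A.modes hA).sys u M hMV).S Q K A.vac)) =
        fun K => φ (B.wordL hB u P K (B.wordS hB u Q K w)) := by
      funext K
      rw [← B.fR_wordS w hA hB hwD u]
      rfl
    rw [List.reverse_reverse, e] at h1
    rwa [h1] at h2

include hφ hMW hwD in
theorem Bimod.act_fL {p q a : List ι} (hq : q.Nodup) (ha : a.Nodup) (hqa : ∀ j ∈ q, j ∉ a)
    (hpq : ∀ j ∈ q, j ∉ p) (hpa : ∀ j ∈ a, j ∉ p) :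
    act (den M) (fun K => φ (B.wordL hB u p K (B.wordS hB u q K (B.fL w (A.wordL hA u a K A.vac))))) =
      act (den M) (fun K => φ (B.wordL hB u (p ++ a) K (B.wordS hB u q K w))) := by
  have h := ((B.modes hB).sys u M hMW).swap_lists ha hq hqa (fun K => φ ∘ₗ B.wordL hB u p K)
    (fun _ => w) (fun K => B.dual_wordL hB u M hMW φ hφ p K)
    (fun j hj => (Ind.comp_word (ψ := fun _ => φ) _ (fun _ => rfl) (hpq j hj)))
    (fun j hj => (Ind.comp_word (ψ := fun _ => φ) _ (fun _ => rfl) (hpa j hj)))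
    (fun _ _ _ => rfl) (fun _ _ _ => rfl)
  simp only [B.fL_wordL w hA hB hwD u]
  refine h.trans ?_
  unfold Bimod.wordL
  simp only [word_append]
  rfl

include hφ hMV hMW hw0 hwD in
theorem Bimod.act_fR {p q a : List ι} (ha : a.Nodup) (hqa : ∀ j ∈ a, j ∉ q)
    (hpa : ∀ j ∈ a, j ∉ p) :
    act (den M) (fun K => φ (B.wordL hB u p K (B.wordS hB u q K (B.fR w (A.wordL hA u a K A.vac))))) =
      act (den M) (fun K => φ (B.wordL hB u p K (B.wordS hB u (q ++ a.reverse) K w))) := by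
  have h := ((A.modes hA).sys u M hMV).reversal A.vac (fun i k => A.S_vac hA (u i) k) ha
    (fun K => ((φ ∘ₗ B.wordL hB u p K) ∘ₗ B.wordS hB u q K) ∘ₗ B.fR w)
    (fun K => B.dual_fR w hw0 (B.dual_wordS hB u M hMW _ (B.dual_wordL hB u M hMW φ hφ p K) q K))
    (fun j hj => (Ind.comp_word (ψ := fun K => φ ∘ₗ B.wordL hB u p K) _
      (Ind.comp_word (ψ := fun _ => φ) _ (fun _ => rfl) (hpa j hj)) (hqa j hj)).comp
        (fun g => g ∘ₗ B.fR w))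
  refine h.trans ?_
  congr 1
  funext K
  rw [show B.wordS hB u (q ++ a.reverse) K w = B.wordS hB u q K (B.wordS hB u a.reverse K w) from
    word_append _ _ _ _ _, ← B.fR_wordS w hA hB hwD u]
  rfl

/-- The `1`-cochain coefficient map `v ↦ (Y_W^L)_{-1}(v)w - (Y_W^R)_{-1}(w)v`. -/
def Bimod.fD (B : Bimod A W) (w : W) : V →ₗ[ℂ] W := B.fL w - B.fR w

/-- Matrix coefficients of a product of groups of vertex operators, inner group centred at zero. -/
def Bimod.coef (p q a : List ι) : Fam ι := fun K =>
  φ (B.wordL hB u p K (B.wordS hB u q K (B.fD w (A.wordL hA u a K A.vac))))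

include hφ hMV hMW hw0 hwD in
theorem Bimod.act_coef {p q a : List ι} (hn : (p ++ q ++ a).Nodup) :
    act (den M) (B.coef w hA hB u φ p q a) =
      act (den M) (fun K => φ (B.wordL hB u (p ++ a) K (B.wordS hB u q K w))) -
      act (den M) (fun K => φ (B.wordL hB u p K (B.wordS hB u (q ++ a.reverse) K w))) := by
  simp only [List.nodup_append, List.mem_append] at hn
  obtain ⟨⟨hp, hq, hpq⟩, ha, hpqa⟩ := hn
  rw [← B.act_fL w hA hB hwD u M hMW φ hφ hq ha (fun j hj hj' => hpqa j (Or.inr hj) j hj' rfl)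
    (fun j hj hj' => hpq j hj' j hj rfl) (fun j hj hj' => hpqa j (Or.inl hj') j hj rfl),
    ← B.act_fR w hA hB hw0 hwD u M hMV hMW φ hφ ha (fun j hj hj' => hpqa j (Or.inr hj') j hj rfl)
    (fun j hj hj' => hpqa j (Or.inl hj') j hj rfl), ← map_sub]
  congr 1
  funext K
  simp [Bimod.coef, Bimod.fD]

include hφ hMV hMW hw0 hwD in
theorem Bimod.neg_coef {p q a : List ι} (hn : (p ++ q ++ a).Nodup) (hmem : ∀ i, i ∈ p ++ q ++ a) :
    NegOrthant (act (den M) (B.coef w hA hB u φ p q a)) := by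
  intro K i hK
  rw [B.act_coef w hA hB hw0 hwD u M hMV hMW φ hφ hn]
  have hm := hmem i
  simp only [List.nodup_append, List.mem_append] at hn hm
  obtain ⟨⟨hp, hq, hpq⟩, ha, hpqa⟩ := hn
  rw [Pi.sub_apply, B.negAt_LS w hA hB hw0 hwD u M hMV hMW φ hφ _ hq _ i _ K hK,
    B.negAt_LS w hA hB hw0 hwD u M hMV hMW φ hφ hp _ _ i _ K hK, sub_zero]
  · rw [List.nodup_append]
    exact ⟨hq, List.nodup_reverse.mpr ha, fun x hx y hy => hpqa x (Or.inr hx) y (List.mem_reverse.mp hy)⟩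
  · intro j hj hj'
    simp only [List.mem_append, List.mem_reverse] at hj
    rcases hj with hj | hj
    · exact hpq j hj' j hj rfl
    · exact hpqa j (Or.inl hj') j hj rfl
  · simp only [List.mem_append, List.mem_reverse]; tauto
  · rw [List.nodup_append]
    exact ⟨hp, ha, fun x hx y hy => hpqa x (Or.inl hx) y hy⟩
  · intro j hj hj'
    simp only [List.mem_append] at hj'
    rcases hj' with hj' | hj'
    · exact hpq j hj' j hj rfl
    · exact hpqa j (Or.inr hj) j hj' rfl
  · simp only [List.mem_append]; tauto

end Chain

end

section

section Chain
variable {V : Type*} [AddCommGroup V] [Module ℂ V]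
variable {W : Type*} [AddCommGroup W] [Module ℂ W] {A : MOSVA V}
variable {ι : Type*} [Fintype ι] [DecidableEq ι]

/-- The translation derivation in the variables belonging to `s`. -/
def delS (s : Finset ι) (ζ : ℂ) : Module.End ℂ (Fam ι) := ζ • ∑ i ∈ s, del i

theorem delS_apply (s : Finset ι) (ζ : ℂ) (c : Fam ι) (K : ι → ℤ) :
    delS s ζ c K = ζ * ∑ i ∈ s, -(K i : ℂ) * c (K - Pi.single i 1) := by
  simp [delS, LinearMap.sum_apply, Finset.sum_apply, del_apply]

/-- The centres of the variables. -/
def cenS (s : Finset ι) (ζ : ℂ) : ι → ℂ := fun i => if i ∈ s then ζ else 0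

theorem delS_X (s : Finset ι) (ζ : ℂ) (j : ι) (c : Fam ι) :
    delS s ζ (act (MvPolynomial.X j) c) =
      act (MvPolynomial.X j) (delS s ζ c) + act (MvPolynomial.C (cenS s ζ j)) c := by
  have : act (MvPolynomial.C (cenS s ζ j)) c = cenS s ζ j • c := by
    funext K; rw [act_C]; rfl
  rw [this, delS, LinearMap.smul_apply, LinearMap.smul_apply, LinearMap.sum_apply,
    LinearMap.sum_apply, map_smul, map_sum, Finset.sum_congr rfl fun i _ => del_X i j c,
    Finset.sum_add_distrib, smul_add]
  congr 1
  rw [Finset.sum_ite_eq']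
  unfold cenS
  split_ifs <;> simp

theorem delS_C (s : Finset ι) (ζ a : ℂ) (c : Fam ι) :
    delS s ζ (act (MvPolynomial.C a) c) = act (MvPolynomial.C a) (delS s ζ c) := by
  have : ∀ d : Fam ι, act (MvPolynomial.C a) d = a • d := by
    intro d; funext K; rw [act_C]; rfl
  rw [this, this, map_smul]

theorem delS_fam_one (s : Finset ι) (ζ : ℂ) : delS s ζ (fam 1) = 0 := by
  rw [delS, LinearMap.smul_apply, LinearMap.sum_apply, Finset.sum_eq_zero fun i _ => del_fam_one i,
    smul_zero]

theorem Ind.sub {Z : Type*} {i : ι} {f : (ι → ℤ) → Z} (hf : Ind i f) (K : ι → ℤ) :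
    f (K - Pi.single i 1) = f K := by
  rw [← hf (K - Pi.single i 1), sub_add_cancel]

namespace Modes
variable {U X : Type*} [AddCommGroup X] [Module ℂ X] (Y : Modes U X)

theorem D_word (u : ι → U) {ℓ : List ι} (hn : ℓ.Nodup) (K : ι → ℤ) (x : X) :
    Y.D (word (fun i => Y.L (u i)) ℓ K x) - word (fun i => Y.L (u i)) ℓ K (Y.D x) =
      ∑ i ∈ ℓ.toFinset, -(K i : ℂ) • word (fun i => Y.L (u i)) ℓ (K - Pi.single i 1) x := by
  induction ℓ with
  | nil => simp [word_nil]
  | cons j ℓ ih =>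
    rw [List.nodup_cons] at hn
    rw [List.toFinset_cons, Finset.sum_insert (by simpa using hn.1)]
    have e : ∀ i ∈ ℓ.toFinset, -(K i : ℂ) • word (fun i => Y.L (u i)) (j :: ℓ) (K - Pi.single i 1) x =
        Y.L (u j) (K j) (-(K i : ℂ) • word (fun i => Y.L (u i)) ℓ (K - Pi.single i 1) x) := by
      intro i hi
      have : j ≠ i := by rintro rfl; exact hn.1 (by simpa using hi)
      rw [word_cons, map_smul]
      simp [this]
    rw [Finset.sum_congr rfl e, ← map_sum, ← ih hn.2, word_cons, word_cons, word_cons,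
      (Ind.word _ hn.1).sub]
    have := Y.D_comm (u j) (K j) (word (fun i => Y.L (u i)) ℓ K x)
    simp only [Pi.sub_apply, Pi.single_eq_same]
    rw [← this, map_sub]
    abel

theorem delS_word (u : ι → U) {ℓ : List ι} (hn : ℓ.Nodup) (vac : X) (hv : Y.D vac = 0) (ζ : ℂ)
    (n : ℕ) (ψ : (ι → ℤ) → (X →ₗ[ℂ] ℂ)) (hψ : ∀ i ∈ ℓ, Ind i ψ) :
    (delS ℓ.toFinset ζ ^ n) (fun K => ψ K (word (fun i => Y.L (u i)) ℓ K vac)) =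
      fun K => ζ ^ n * ψ K ((Y.D ^ n) (word (fun i => Y.L (u i)) ℓ K vac)) := by
  induction n generalizing ψ with
  | zero => funext K; simp
  | succ n ih =>
    have : delS ℓ.toFinset ζ (fun K => ψ K (word (fun i => Y.L (u i)) ℓ K vac)) =
        ζ • fun K => (ψ K ∘ₗ Y.D) (word (fun i => Y.L (u i)) ℓ K vac) := by
      funext K
      have h := Y.D_word u hn K vac
      rw [hv, map_zero, sub_zero] at h
      rw [delS_apply, Pi.smul_apply, LinearMap.comp_apply, h, map_sum, smul_eq_mul]
      congr 1
      apply Finset.sum_congr rfl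
      intro i hi
      rw [map_smul, (hψ i (by simpa using hi)).sub, smul_eq_mul]
    rw [pow_succ, Module.End.mul_apply, this, map_smul,
      ih _ (fun i hi => (hψ i hi).comp fun g => g ∘ₗ Y.D)]
    funext K
    simp only [Pi.smul_apply, smul_eq_mul, LinearMap.comp_apply, pow_succ' Y.D, Module.End.mul_apply]
    ring

end Modes

theorem word_congr {X : Type*} [AddCommGroup X] [Module ℂ X] (op : ι → ℤ → Module.End ℂ X)
    (ℓ : List ι) (K K' : ι → ℤ) (h : ∀ m ∈ ℓ, K' m = K m) : word op ℓ K' = word op ℓ K := by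
  unfold word
  congr 1
  apply List.map_congr_left
  intro j hj
  rw [h j hj]

/-- Lower truncation of a word of operators tested on functionals. -/
theorem word_trunc {X : Type*} [AddCommGroup X] [Module ℂ X] (op : ι → ℤ → Module.End ℂ X)
    (pre₀ pre : List ι) (i : ι) (post : List ι) (Ψ : (ι → ℤ) → (X →ₗ[ℂ] ℂ))
    (hΨ : ∀ K K', (∀ m ∈ pre₀, K' m = K m) → Ψ K' = Ψ K) (K : ι → ℤ)
    (hvan : ∃ k0 : ℤ, ∀ k < k0, (Ψ K ∘ₗ word op pre K) ∘ₗ op i k = 0) :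
    ∃ k0 : ℤ, ∀ K' : ι → ℤ, (∀ m ∈ pre₀ ++ pre, K' m = K m) → K' i < k0 →
      Ψ K' ∘ₗ word op (pre ++ i :: post) K' = 0 := by
  obtain ⟨k0, h0⟩ := hvan
  refine ⟨k0, fun K' hK hk => LinearMap.ext fun x => ?_⟩
  have := LinearMap.congr_fun (h0 _ hk) (word op post K' x)
  simp only [LinearMap.comp_apply] at this ⊢
  rw [word_append, word_cons, hΨ K K' fun m hm => hK m (by simp [hm]),
    word_congr op pre K K' fun m hm => hK m (by simp [hm])]
  exact this

theorem BddL.append {ℓ ℓ' : List ι} {c : Fam ι}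
    (h : ∀ pre i post, ℓ = pre ++ i :: post → ∀ K : ι → ℤ, ∃ k0 : ℤ, ∀ K' : ι → ℤ,
      (∀ m ∈ pre, K' m = K m) → K' i < k0 → c K' = 0)
    (h' : ∀ pre i post, ℓ' = pre ++ i :: post → ∀ K : ι → ℤ, ∃ k0 : ℤ, ∀ K' : ι → ℤ,
      (∀ m ∈ ℓ ++ pre, K' m = K m) → K' i < k0 → c K' = 0) : BddL (ℓ ++ ℓ') c := by
  intro pre i post he
  rcases List.append_eq_append_iff.mp he with ⟨s, h1, h2⟩ | ⟨s, h1, h2⟩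
  · rw [h1]; exact h' s i post h2
  · rcases s with _ | ⟨j, s⟩
    · simp only [List.append_nil] at h1
      simp only [List.nil_append] at h2
      rw [← h1]
      simpa using h' [] i post (by simp [h2])
    · simp only [List.cons_append, List.cons.injEq] at h2
      rw [h2.1]
      exact h pre j s h1

variable (B : Bimod A W) (w : W) (hA : A.PoleOrder) (hB : B.PoleOrder)
  (hw0 : B.gr.proj 0 w = w) (hwD : B.DW w = 0) (u : ι → V)

/-- The functional `v ↦ ⟨ψ, e^{ζD} f(v)⟩`. -/
def Bimod.chi (ζ : ℂ) (ψ : W →ₗ[ℂ] ℂ) : V →ₗ[ℂ] ℂ :=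
  ∑ᶠ n : ℕ, (ζ ^ n * ((n.factorial : ℂ))⁻¹) • (ψ ∘ₗ (B.DW ^ n) ∘ₗ B.fD w)

theorem Bimod.chi_eq_sum (ζ : ℂ) (ψ : W →ₗ[ℂ] ℂ) (n0 : ℕ) (h : ∀ n, n0 ≤ n → ψ ∘ₗ B.DW ^ n = 0) :
    B.chi w ζ ψ = ∑ n ∈ Finset.range n0, (ζ ^ n * ((n.factorial : ℂ))⁻¹) •
      (ψ ∘ₗ (B.DW ^ n) ∘ₗ B.fD w) := by
  apply finsum_eq_sum_of_support_subset
  intro n hn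
  simp only [Function.mem_support] at hn
  simp only [Finset.coe_range, Set.mem_Iio]
  by_contra hcon
  exact hn (by rw [← LinearMap.comp_assoc, h n (not_lt.mp hcon), LinearMap.zero_comp, smul_zero])

theorem Bimod.chi_zero (ζ : ℂ) : B.chi w ζ 0 = 0 := by
  rw [B.chi_eq_sum w ζ 0 0 (by simp)]
  simp

theorem Bimod.fD_vac : B.fD w A.vac = 0 := by
  rw [Bimod.fD, LinearMap.sub_apply, B.fL_vac, B.fR_vac, sub_self]

theorem Bimod.chi_vac (hB : B.PoleOrder) (ζ : ℂ) (ψ : W →ₗ[ℂ] ℂ) (hψ : InGradedDual B.gr.proj ψ) :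
    B.chi w ζ ψ A.vac = 0 := by
  obtain ⟨n0, h0⟩ := (B.modes hB).exists_D_vanish hψ
  rw [B.chi_eq_sum w ζ ψ n0 h0, LinearMap.sum_apply]
  apply Finset.sum_eq_zero
  intro n _
  simp [B.fD_vac w]

include hwD in
theorem Bimod.fD_D (hB : B.PoleOrder) (n : ℕ) (v : V) : B.fD w (((A.modes hA).D ^ n) v) = (B.DW ^ n) (B.fD w v) := by
  induction n generalizing v with
  | zero => rfl
  | succ n ih =>
    rw [pow_succ, Module.End.mul_apply, ih, pow_succ, Module.End.mul_apply]
    congr 1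
    rw [Bimod.fD, LinearMap.sub_apply, LinearMap.sub_apply, map_sub]
    congr 1
    · exact B.fL_D w hwD hB v
    · exact B.fR_D w hwD v

theorem InGradedDual.add {κ M : Type*} [AddCommGroup M] [Module ℂ M] {proj : κ → M →ₗ[ℂ] M}
    {φ ψ : M →ₗ[ℂ] ℂ} (h : InGradedDual proj φ) (h' : InGradedDual proj ψ) :
    InGradedDual proj (φ + ψ) := by
  refine (Set.Finite.union h h').subset fun i hi => ?_
  by_contra hcon
  simp only [Set.mem_union, Function.mem_support, not_or, not_not] at hcon hi
  exact hi (by rw [LinearMap.add_comp, hcon.1, hcon.2, add_zero])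

theorem InGradedDual.smul {κ M : Type*} [AddCommGroup M] [Module ℂ M] {proj : κ → M →ₗ[ℂ] M}
    {φ : M →ₗ[ℂ] ℂ} (h : InGradedDual proj φ) (a : ℂ) : InGradedDual proj (a • φ) := by
  refine Set.Finite.subset h fun i hi => ?_
  simp only [Function.mem_support] at hi ⊢
  intro hcon
  exact hi (by rw [LinearMap.smul_comp, hcon, smul_zero])

theorem InGradedDual.zero {κ M : Type*} [AddCommGroup M] [Module ℂ M] (proj : κ → M →ₗ[ℂ] M) :
    InGradedDual proj (0 : M →ₗ[ℂ] ℂ) := by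
  simp [InGradedDual]

theorem InGradedDual.sum {κ M σ : Type*} [AddCommGroup M] [Module ℂ M] {proj : κ → M →ₗ[ℂ] M}
    (s : Finset σ) (φ : σ → (M →ₗ[ℂ] ℂ)) (h : ∀ i ∈ s, InGradedDual proj (φ i)) :
    InGradedDual proj (∑ i ∈ s, φ i) :=
  Finset.sum_induction _ _ (fun _ _ => InGradedDual.add) (InGradedDual.zero proj) h

include hw0 in
theorem Bimod.dual_fD {ψ : W →ₗ[ℂ] ℂ} (hψ : InGradedDual B.gr.proj ψ) :
    InGradedDual A.gr.toC.proj (ψ ∘ₗ B.fD w) := by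
  have := (B.dual_fL w hw0 hψ).add ((B.dual_fR w hw0 hψ).smul (-1))
  convert this using 1
  ext x
  simp [Bimod.fD, sub_eq_add_neg]

include hw0 in
theorem Bimod.chi_dual (hB : B.PoleOrder) (ζ : ℂ) {ψ : W →ₗ[ℂ] ℂ} (hψ : InGradedDual B.gr.proj ψ) :
    InGradedDual A.gr.toC.proj (B.chi w ζ ψ) := by
  obtain ⟨n0, h0⟩ := (B.modes hB).exists_D_vanish hψ
  rw [B.chi_eq_sum w ζ ψ n0 h0]
  apply InGradedDual.sum
  intro n _
  exact (B.dual_fD w hw0 ((B.modes hB).dual_D hψ n)).smul _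

variable (M : ι → ι → ℕ) (hMV : ∀ i j, (A.modes hA).C (u i) (u j) ≤ M i j)
  (hMW : ∀ i j, (B.modes hB).C (u i) (u j) ≤ M i j)
  (φ : W →ₗ[ℂ] ℂ) (hφ : InGradedDual B.gr.proj φ)

/-- The functional applied after the outer operators. -/
def Bimod.outer (p q : List ι) (K : ι → ℤ) : W →ₗ[ℂ] ℂ :=
  (φ ∘ₗ B.wordL hB u p K) ∘ₗ B.wordS hB u q K

/-- Matrix coefficients of a product of groups of vertex operators, inner group centred at `ζ`. -/
def Bimod.coefZ (ζ : ℂ) (p q a : List ι) : Fam ι := fun K =>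
  B.chi w ζ (B.outer hB u φ p q K) (A.wordL hA u a K A.vac)

include hMW hφ in
theorem Bimod.outer_dual (p q : List ι) (K : ι → ℤ) :
    InGradedDual B.gr.proj (B.outer hB u φ p q K) :=
  B.dual_wordS hB u M hMW _ (B.dual_wordL hB u M hMW φ hφ p K) q K

theorem Bimod.outer_congr (p q : List ι) (K K' : ι → ℤ) (h : ∀ m ∈ p ++ q, K' m = K m) :
    B.outer hB u φ p q K' = B.outer hB u φ p q K := by
  unfold Bimod.outer Bimod.wordL Bimod.wordS
  rw [word_congr _ p K K' fun m hm => h m (by simp [hm]),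
    word_congr _ q K K' fun m hm => h m (by simp [hm])]

include hMW hφ hw0 in
theorem Bimod.bdd_coefZ (ζ : ℂ) (p q a : List ι) :
    BddL (p ++ q ++ a) (B.coefZ w hA hB u φ ζ p q a) := by
  have hout : ∀ K, B.outer hB u φ p q K = 0 → B.coefZ w hA hB u φ ζ p q a K = 0 := by
    intro K hK
    rw [Bimod.coefZ, hK, B.chi_zero, LinearMap.zero_apply]
  refine BddL.append (BddL.append ?_ ?_) ?_
  · rintro pre i post rfl K
    obtain ⟨k0, h0⟩ := word_trunc (fun i => (B.modes hB).L (u i)) [] pre i post (fun _ => φ)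
      (fun _ _ _ => rfl) K ((B.modes hB).exists_L_vanish (B.dual_wordL hB u M hMW φ hφ pre K) (u i))
    refine ⟨k0, fun K' hK hk => hout _ ?_⟩
    have := h0 K' hK hk
    unfold Bimod.outer Bimod.wordL
    rw [this, LinearMap.zero_comp]
  · rintro pre i post rfl K
    obtain ⟨k0, h0⟩ := word_trunc (fun i => (B.modes hB).S (u i)) p pre i post
      (fun K => φ ∘ₗ B.wordL hB u p K)
      (fun K K' h => by simp only [Bimod.wordL, word_congr _ p K K' h]) K
      ((B.modes hB).exists_S_vanish (B.dual_wordS hB u M hMW _ (B.dual_wordL hB u M hMW φ hφ p K) pre K) (u i))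
    exact ⟨k0, fun K' hK hk => hout _ (h0 K' hK hk)⟩
  · rintro pre i post rfl K
    obtain ⟨k0, h0⟩ := word_trunc (fun i => (A.modes hA).L (u i)) (p ++ q) pre i post
      (fun K => B.chi w ζ (B.outer hB u φ p q K))
      (fun K K' h => by simp only [B.outer_congr hB u φ p q K K' h]) K
      ((A.modes hA).exists_L_vanish
        (((A.modes hA).sys u _ (fun _ _ => le_rfl)).du_word_L _
          (B.chi_dual w hw0 hB ζ (B.outer_dual hB u M hMW φ hφ p q K)) pre K) (u i))
    exact ⟨k0, fun K' hK hk => LinearMap.congr_fun (h0 K' hK hk) A.vac⟩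

end Chain

end

section

section Chain
variable {V : Type*} [AddCommGroup V] [Module ℂ V]
variable {W : Type*} [AddCommGroup W] [Module ℂ W] {A : MOSVA V}
variable {ι : Type*} [Fintype ι] [DecidableEq ι]
variable (B : Bimod A W) (w : W) (hA : A.PoleOrder) (hB : B.PoleOrder)
  (hw0 : B.gr.proj 0 w = w) (hwD : B.DW w = 0) (u : ι → V)
variable (M : ι → ι → ℕ) (hMV : ∀ i j, (A.modes hA).C (u i) (u j) ≤ M i j)
  (hMW : ∀ i j, (B.modes hB).C (u i) (u j) ≤ M i j)
  (φ : W →ₗ[ℂ] ℂ) (hφ : InGradedDual B.gr.proj φ)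

theorem Bimod.ind_outer {p q : List ι} {i : ι} (hp : i ∉ p) (hq : i ∉ q) :
    Ind i (B.outer hB u φ p q) :=
  Ind.comp_word (ψ := fun K => φ ∘ₗ B.wordL hB u p K) _
    (Ind.comp_word (ψ := fun _ => φ) _ (fun _ => rfl) hp) hq

include hwD in
theorem Bimod.delS_coef {p q a : List ι} (hn : (p ++ q ++ a).Nodup) (ζ : ℂ) (n : ℕ) (K : ι → ℤ) :
    (delS a.toFinset ζ ^ n) (B.coef w hA hB u φ p q a) K =
      ζ ^ n * B.outer hB u φ p q K ((B.DW ^ n) (B.fD w (A.wordL hA u a K A.vac))) := by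
  rw [List.nodup_append] at hn
  have h := (A.modes hA).delS_word u hn.2.1 A.vac (A.D_vac hA) ζ n
    (fun K => B.outer hB u φ p q K ∘ₗ B.fD w)
    (fun i hi => (B.ind_outer hB u φ (fun h => hn.2.2 i (by simp [h]) i hi rfl)
      (fun h => hn.2.2 i (by simp [h]) i hi rfl)).comp fun g => g ∘ₗ B.fD w)
  refine (congrFun h K).trans ?_
  simp only [LinearMap.comp_apply]
  rw [B.fD_D w hA hwD hB]
  rfl

include hwD hMW hφ in
theorem Bimod.LN_coef {p q a : List ι} (hn : (p ++ q ++ a).Nodup) (ζ : ℂ) :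
    LN (delS a.toFinset ζ) (B.coef w hA hB u φ p q a) := by
  intro K
  obtain ⟨n0, h0⟩ := (B.modes hB).exists_D_vanish (B.outer_dual hB u M hMW φ hφ p q K)
  refine ⟨n0, fun n hnn => ?_⟩
  rw [B.delS_coef w hA hB hwD u φ hn]
  have := LinearMap.congr_fun (h0 n hnn) (B.fD w (A.wordL hA u a K A.vac))
  simp only [LinearMap.comp_apply] at this
  rw [show (B.outer hB u φ p q K) ((B.DW ^ n) (B.fD w (A.wordL hA u a K A.vac))) = 0 from this, mul_zero]

include hwD hMW hφ in
theorem Bimod.expT_coef {p q a : List ι} (hn : (p ++ q ++ a).Nodup) (ζ : ℂ) :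
    expT (delS a.toFinset ζ) (B.coef w hA hB u φ p q a) = B.coefZ w hA hB u φ ζ p q a := by
  funext K
  obtain ⟨n0, h0⟩ := (B.modes hB).exists_D_vanish (B.outer_dual hB u M hMW φ hφ p q K)
  rw [expT_eq_sum _ _ _ n0, Bimod.coefZ, B.chi_eq_sum w ζ _ n0 h0, LinearMap.sum_apply]
  · apply Finset.sum_congr rfl
    intro n _
    rw [B.delS_coef w hA hB hwD u φ hn]
    simp only [LinearMap.smul_apply, LinearMap.comp_apply, smul_eq_mul]
    ring
  · intro n hnn
    rw [B.delS_coef w hA hB hwD u φ hn]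
    have := LinearMap.congr_fun (h0 n hnn) (B.fD w (A.wordL hA u a K A.vac))
    simp only [LinearMap.comp_apply] at this
    rw [show (B.outer hB u φ p q K) ((B.DW ^ n) (B.fD w (A.wordL hA u a K A.vac))) = 0 from this,
      mul_zero]

theorem Region.ne_zero {cen x : ι → ℂ} {ℓ : List ι} (h : Region cen x ℓ) {i j : ι} {pre post : List ι}
    (he : ℓ = pre ++ i :: post) (hj : j ∈ post) : x i ≠ 0 := by
  subst he
  unfold Region at h
  rw [List.pairwise_append] at h
  have := (List.pairwise_cons.mp h.2.1).1 j hj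
  intro h0
  rw [h0, norm_zero] at this
  have h1 := norm_nonneg (x j)
  have h2 := norm_nonneg (cen j - cen i)
  linarith

include hφ hMW in
theorem Bimod.NZ_coefZ {p q a : List ι} (hn : (p ++ q ++ a).Nodup) (hmem : ∀ i, i ∈ p ++ q ++ a)
    (ζ : ℂ) (cen x : ι → ℂ) (h : Region cen x (p ++ q ++ a)) :
    NZ x (B.coefZ w hA hB u φ ζ p q a) := by
  intro i hi K hK
  rcases List.eq_nil_or_concat a with rfl | ⟨b, j, rfl⟩
  · exact B.chi_vac w hB ζ _ (B.outer_dual hB u M hMW φ hφ p q K)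
  · by_cases hij : i = j
    · subst hij
      unfold Bimod.coefZ MOSVA.wordL
      rw [List.concat_eq_append, word_append, word_cons, word_nil,
        show ((A.modes hA).L (u i) (K i)) A.vac = 0 from A.creation _ _ hK, map_zero, map_zero]
    · exfalso
      have hm := hmem i
      rw [List.concat_eq_append, ← List.append_assoc] at hm h
      have hm' : i ∈ p ++ q ++ b := by
        rw [List.mem_append] at hm
        simpa [hij] using hm
      obtain ⟨pre, post, he⟩ := List.append_of_mem hm'
      rw [he, List.append_assoc, List.cons_append] at h
      exact h.ne_zero (j := j) rfl (by simp) hi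

include hφ hMV hMW hw0 hwD in
theorem Bimod.chain {p q a : List ι} (hn : (p ++ q ++ a).Nodup) (hmem : ∀ i, i ∈ p ++ q ++ a)
    {N : MvPolynomial ι ℂ} (hN : act (den M) (B.coef w hA hB u φ p q a) = fam N) (ζ : ℂ) (x : ι → ℂ)
    (h : Region (cenS a.toFinset ζ) x (p ++ q ++ a)) :
    AbsConvTo (fun K => B.coefZ w hA hB u φ ζ p q a K * mono x K)
      (MvPolynomial.eval (fun i => x i + cenS a.toFinset ζ i) N /
        MvPolynomial.eval (fun i => x i + cenS a.toFinset ζ i) (den M)) := by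
  apply conv_main hn hmem M _ (B.bdd_coefZ w hA hB hw0 u M hMW φ hφ ζ p q a) _ x h
    (B.NZ_coefZ w hA hB u M hMW φ hφ hn hmem ζ _ x h)
  have h1 := expT_act (delS_X a.toFinset ζ) (fun i c => delS_C a.toFinset ζ _ c) (den M)
    (B.LN_coef w hA hB hwD u M hMW φ hφ hn ζ)
  rw [hN, expT_fam (delS_X a.toFinset ζ) (fun i c => delS_C a.toFinset ζ _ c)
    (delS_fam_one a.toFinset ζ), B.expT_coef w hA hB hwD u M hMW φ hφ hn] at h1
  exact h1.symm

include hφ hMV hMW hw0 hwD in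
theorem Bimod.exists_num {p q a : List ι} (hn : (p ++ q ++ a).Nodup) (hmem : ∀ i, i ∈ p ++ q ++ a) :
    ∃ N : MvPolynomial ι ℂ, act (den M) (B.coef w hA hB u φ p q a) = fam N := by
  have hb : BddL (p ++ q ++ a) (B.coef w hA hB u φ p q a) := by
    have := B.bdd_coefZ w hA hB hw0 u M hMW φ hφ 0 p q a
    rw [← B.expT_coef w hA hB hwD u M hMW φ hφ hn] at this
    convert this using 1
    funext K
    rw [expT_eq_sum _ _ _ 1]
    · simp
    · intro n hn'
      rw [B.delS_coef w hA hB hwD u φ hn, zero_pow (by omega), zero_mul]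
  obtain ⟨N, hN⟩ := fam_of_neg hmem (hb.act (den M)) (B.neg_coef w hA hB hw0 hwD u M hMV hMW φ hφ hn hmem)
  exact ⟨N, hN.symm⟩

end Chain

section Pair
variable {V : Type*} [AddCommGroup V] [Module ℂ V]
variable {W : Type*} [AddCommGroup W] [Module ℂ W] {A : MOSVA V}

/-- The finite set of weights on which a functional in the graded dual is nonzero. -/
def InGradedDual.supp {κ : Type*} {proj : κ → W →ₗ[ℂ] W} {φ : W →ₗ[ℂ] ℂ} (h : InGradedDual proj φ) :
    Finset κ := Set.Finite.toFinset (s := Function.support fun i => φ ∘ₗ proj i) h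

theorem InGradedDual.mem_supp {κ : Type*} {proj : κ → W →ₗ[ℂ] W} {φ : W →ₗ[ℂ] ℂ}
    (h : InGradedDual proj φ) (n : κ) : n ∈ h.supp ↔ φ ∘ₗ proj n ≠ 0 :=
  Set.Finite.mem_toFinset _

theorem CGrading.pair_eq_sum (G : CGrading W) {φ : W →ₗ[ℂ] ℂ} (hφ : InGradedDual G.proj φ)
    (f : G.Comp) : G.pair φ f = ∑ n ∈ hφ.supp, φ (f.1 n) := by
  apply finsum_eq_sum_of_support_subset
  intro n hn
  simp only [Function.mem_support] at hn
  rw [Finset.mem_coe, hφ.mem_supp]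
  intro h0
  apply hn
  rw [← f.2 n]
  exact LinearMap.congr_fun h0 _

theorem CGrading.pair_add (G : CGrading W) {φ : W →ₗ[ℂ] ℂ} (hφ : InGradedDual G.proj φ)
    (f g : G.Comp) : G.pair φ (f + g) = G.pair φ f + G.pair φ g := by
  simp only [G.pair_eq_sum hφ, ← Finset.sum_add_distrib]
  simp

theorem CGrading.pair_smul (G : CGrading W) {φ : W →ₗ[ℂ] ℂ} (hφ : InGradedDual G.proj φ) (c : ℂ)
    (f : G.Comp) : G.pair φ (c • f) = c * G.pair φ f := by
  simp only [G.pair_eq_sum hφ, Finset.mul_sum]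
  simp

theorem CGrading.dual_proj (G : CGrading W) (φ : W →ₗ[ℂ] ℂ) (n : ℂ) :
    InGradedDual G.proj (φ ∘ₗ G.proj n) := by
  refine (Set.finite_singleton n).subset fun m hm => ?_
  simp only [Function.mem_support] at hm
  by_contra h
  apply hm
  rw [LinearMap.comp_assoc, G.proj_comp, if_neg (Ne.symm h), LinearMap.comp_zero]

theorem CGrading.pair_proj (G : CGrading W) (φ : W →ₗ[ℂ] ℂ) (n : ℂ) (f : G.Comp) :
    G.pair (φ ∘ₗ G.proj n) f = φ (f.1 n) := by
  unfold CGrading.pair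
  rw [finsum_eq_single _ n]
  · rw [LinearMap.comp_apply, f.2 n]
  · intro m hm
    rw [← f.2 m, LinearMap.comp_apply, G.proj_proj, if_neg (Ne.symm hm), map_zero]

theorem CGrading.comp_ext (G : CGrading W) {f g : G.Comp}
    (h : ∀ φ, InGradedDual G.proj φ → G.pair φ f = G.pair φ g) : f = g := by
  apply Subtype.ext
  funext n
  apply G.separate
  intro φ _
  rw [← G.pair_proj, ← G.pair_proj, h _ (G.dual_proj φ n)]

theorem CGrading.pair_ext (G : CGrading W) {φ : W →ₗ[ℂ] ℂ} (hφ : InGradedDual G.proj φ)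
    {S : Set ℂ} (hS : S.Finite) (O : W →ₗ[ℂ] W) (hO : IsShift G G S O) (f : G.Comp) :
    G.pair φ (G.ext (⇑O) f) = G.pair (φ ∘ₗ O) f := by
  classical
  have hfin : ∀ m, (Function.support fun n => G.proj m (O (f.1 n))).Finite := by
    intro m
    refine (hS.image fun s => m - s).subset fun n hn => ?_
    simp only [Function.mem_support] at hn
    by_contra h
    apply hn
    rw [← f.2 n]
    apply hO
    intro hmem
    exact h ⟨m - n, hmem, by ring⟩
  have hd : InGradedDual G.proj (φ ∘ₗ O) := hO.dual hS hφ
  rw [G.pair_eq_sum hφ, G.pair_eq_sum hd]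
  set T : Finset ℂ := hd.supp ∪ hφ.supp.biUnion fun m => (hfin m).toFinset with hT
  have e1 : ∀ m ∈ hφ.supp, φ ((G.ext (⇑O) f).1 m) = ∑ n ∈ T, φ (G.proj m (O (f.1 n))) := by
    intro m hm
    show φ (∑ᶠ n, G.proj m (O (f.1 n))) = _
    rw [finsum_eq_sum_of_support_subset (s := T), map_sum]
    intro n hn
    simp only [hT, Finset.coe_union, Set.mem_union, Finset.mem_coe, Finset.mem_biUnion]
    exact Or.inr ⟨m, hm, by simpa using hn⟩
  rw [Finset.sum_congr rfl e1, Finset.sum_comm]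
  have e2 : ∀ x : W, ∑ m ∈ hφ.supp, φ (G.proj m x) = φ x := by
    intro x
    conv_rhs => rw [← G.proj_sum x, map_finsum φ (G.proj_finite x)]
    symm
    apply finsum_eq_sum_of_support_subset
    intro n hn
    simp only [Function.mem_support] at hn
    rw [Finset.mem_coe, hφ.mem_supp]
    intro h0
    exact hn (LinearMap.congr_fun h0 x)
  simp only [e2]
  symm
  apply Finset.sum_subset Finset.subset_union_left
  intro n _ hn
  rw [hd.mem_supp, not_not] at hn
  rw [← f.2 n]
  exact LinearMap.congr_fun hn _

end Pair

end

section

section Main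
variable {V : Type*} [AddCommGroup V] [Module ℂ V]
variable {W : Type*} [AddCommGroup W] [Module ℂ W] {A : MOSVA V}

theorem compApply_eq {X : Type*} [AddCommGroup X] [Module ℂ X] (n : ℕ) (O : Fin n → Module.End ℂ X)
    (x : X) : compApply n (fun j => ⇑(O j)) x = ((List.finRange n).map O).prod x := by
  induction n with
  | zero => rfl
  | succ n ih =>
    rw [compApply, ih, List.finRange_succ, List.map_cons, List.prod_cons, List.map_map]
    rfl

theorem CGrading.pair_compApply (G : CGrading W) (n : ℕ) (O : Fin n → Module.End ℂ W)
    (hO : ∀ j, ∃ S : Set ℂ, S.Finite ∧ IsShift G G S (O j)) {φ : W →ₗ[ℂ] ℂ}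
    (hφ : InGradedDual G.proj φ) (F : G.Comp) :
    G.pair φ (compApply n (fun j => G.ext (⇑(O j))) F) =
      G.pair (φ ∘ₗ ((List.finRange n).map O).prod) F := by
  induction n generalizing φ with
  | zero => rfl
  | succ n ih =>
    obtain ⟨S, hS, h⟩ := hO 0
    rw [compApply, G.pair_ext hφ hS _ h, ih (fun j => O j.succ) (fun j => hO j.succ) (h.dual hS hφ),
      List.finRange_succ, List.map_cons, List.prod_cons, List.map_map]
    rfl

theorem AbsConvTo.equiv {κ κ' : Type*} {f : κ → ℂ} {s : ℂ} (h : AbsConvTo f s) (e : κ' ≃ κ) :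
    AbsConvTo (fun k => f (e k)) s :=
  ⟨(e.summable_iff (f := fun k => ‖f k‖)).mpr h.1, (e.hasSum_iff (f := f)).mpr h.2⟩

variable (B : Bimod A W) (w : W) (hA : A.PoleOrder) (hB : B.PoleOrder)
  (hw0 : B.gr.proj 0 w = w) (hwD : B.DW w = 0)
  (Φ : (Fin 1 → V) → (Fin 1 → ℂ) → B.gr.Comp)
  (hΦ : ∀ (v : Fin 1 → V) (φ : W →ₗ[ℂ] ℂ), InGradedDual B.gr.proj φ → ∀ z : Fin 1 → ℂ,
    AbsConvTo (fun k : ℤ => φ (B.YL (v 0) w k - B.YsR (v 0) w k) * z 0 ^ (-k - 1))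
      (B.gr.pair φ (Φ v z)))

include hwD in
theorem Bimod.diff_neg (hB : B.PoleOrder) (v : V) (n : ℕ) :
    B.YL v w (-1 - n) - B.YsR v w (-1 - n) = (n.factorial : ℂ)⁻¹ • (B.DW ^ n) (B.fD w v) := by
  rw [B.YL_neg w hwD hB, B.YsR_neg w hwD hB, ← smul_sub, ← map_sub]
  rfl

include hwD hB hΦ in
theorem Bimod.pair_cochain {φ : W →ₗ[ℂ] ℂ} (hφ : InGradedDual B.gr.proj φ) (v : Fin 1 → V)
    (z : Fin 1 → ℂ) : B.gr.pair φ (Φ v z) = B.chi w (z 0) φ (v 0) := by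
  have h := (hΦ v φ hφ z).2
  obtain ⟨n0, h0⟩ := (B.modes hB).exists_D_vanish hφ
  have hinj : Function.Injective fun n : ℕ => (-1 - n : ℤ) := by
    intro a b hab
    simp only at hab
    omega
  rw [← hinj.hasSum_iff] at h
  · refine h.unique ?_
    have e : ((fun k : ℤ => φ (B.YL (v 0) w k - B.YsR (v 0) w k) * z 0 ^ (-k - 1)) ∘
        fun n : ℕ => (-1 - n : ℤ)) = fun n : ℕ => ((z 0 ^ n * ((n.factorial : ℂ))⁻¹) •
          (φ ∘ₗ (B.DW ^ n) ∘ₗ B.fD w)) (v 0) := by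
      funext n
      simp only [Function.comp_apply]
      rw [B.diff_neg w hwD hB, map_smul, show -(-1 - (n : ℤ)) - 1 = n by ring, zpow_natCast]
      simp only [LinearMap.smul_apply, LinearMap.comp_apply, smul_eq_mul]
      ring
    rw [e, B.chi_eq_sum w _ _ n0 h0, LinearMap.sum_apply]
    apply hasSum_sum_of_ne_finset_zero
    intro n hn
    have := h0 n (by simpa using hn)
    rw [← LinearMap.comp_assoc, show φ ∘ₗ B.DW ^ n = 0 from this, LinearMap.zero_comp, smul_zero,
      LinearMap.zero_apply]
  · intro k hk
    rcases int_cases k with h' | ⟨n, rfl⟩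
    · rw [B.YL_nonneg w hwD hB _ _ h', B.YsR_nonneg w hwD hB _ _ h', sub_self, map_zero, zero_mul]
    · exact absurd ⟨n, rfl⟩ hk

/-- Bounds for the pole orders. -/
def Bimod.bound (u v : V) : ℕ := (A.modes hA).C u v + (B.modes hB).C u v

theorem Bimod.bound_left (u v : V) : (A.modes hA).C u v ≤ B.bound hA hB u v := Nat.le_add_right _ _

theorem Bimod.bound_right (u v : V) : (B.modes hB).C u v ≤ B.bound hA hB u v := Nat.le_add_left _ _

/-- The operator in an outer group: left if `b`, opposite right otherwise. -/
def Bimod.outOp (hB : B.PoleOrder) (b : Prop) [Decidable b] (v : V) (k : ℤ) : Module.End ℂ W :=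
  if b then (B.modes hB).L v k else (B.modes hB).S v k

theorem Bimod.outOp_shift (b : Prop) [Decidable b] (v : V) (k : ℤ) :
    ∃ S : Set ℂ, S.Finite ∧ IsShift B.gr B.gr S (B.outOp hB b v k) := by
  unfold Bimod.outOp
  split_ifs
  · obtain ⟨T, hT⟩ := (B.modes hB).wtL v
    exact ⟨_, wts_finite T k, hT k⟩
  · obtain ⟨T, hT⟩ := (B.modes hB).wtS v
    exact ⟨_, wts_finite T k, hT k⟩

theorem Bimod.outer_eq {ι : Type*} [Fintype ι] [DecidableEq ι] (u : ι → V) (φ : W →ₗ[ℂ] ℂ) (n l : ℕ)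
    (e : Fin n → ι) (K : ι → ℤ) :
    B.outer hB u φ (((List.finRange n).take l).map e) (((List.finRange n).drop l).map e) K =
      φ ∘ₗ ((List.finRange n).map fun j : Fin n => B.outOp hB ((j : ℕ) < l) (u (e j)) (K (e j))).prod := by
  conv_rhs => rw [← List.take_append_drop l (List.finRange n)]
  rw [List.map_append, List.prod_append, Bimod.outer, LinearMap.comp_assoc]
  congr 1
  unfold Bimod.wordL Bimod.wordS word
  rw [List.map_map, List.map_map, ← Module.End.mul_eq_comp]
  congr 2
  · apply List.map_congr_left
    intro j hj
    obtain ⟨i, hi, rfl⟩ := List.mem_iff_getElem.mp hj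
    simp only [List.length_take, List.length_finRange, lt_inf_iff] at hi
    simp only [Function.comp_apply, List.getElem_take, List.getElem_finRange, Fin.val_cast]
    rw [Bimod.outOp, if_pos hi.1]
  · apply List.map_congr_left
    intro j hj
    obtain ⟨i, hi, rfl⟩ := List.mem_iff_getElem.mp hj
    simp only [Function.comp_apply, List.getElem_drop, List.getElem_finRange, Fin.val_cast]
    rw [Bimod.outOp, if_neg (by simp)]

include hw0 hwD hA hB hΦ in
theorem Bimod.composable (m : ℕ) : ComposableWith A B 1 m Φ := by
  refine ⟨B.bound hA hB, fun α hα l hl u φ hφ => ?_⟩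
  let ι := (i : Fin (1+1)) × Fin (α i)
  let u' : ι → V := fun q => u q.1 q.2
  let M : ι → ι → ℕ := fun i j => B.bound hA hB (u' i) (u' j)
  let e0 : Fin (α 0) → ι := fun j => ⟨0, j⟩
  let e1 : Fin (α (0 : Fin 1).succ) → ι := fun j => ⟨(0 : Fin 1).succ, j⟩
  have he0 : Function.Injective e0 := fun i j h => eq_of_heq (Sigma.mk.inj h).2
  have he1 : Function.Injective e1 := fun i j h => eq_of_heq (Sigma.mk.inj h).2
  set p := ((List.finRange (α 0)).take l).map e0 with hp
  set q := ((List.finRange (α 0)).drop l).map e0 with hq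
  set a := (List.finRange (α (0 : Fin 1).succ)).map e1 with ha
  have hpq : p ++ q = (List.finRange (α 0)).map e0 := by
    rw [hp, hq, ← List.map_append, List.take_append_drop]
  have hma (i : Fin (1 + 1)) (s : Fin (α i)) : (⟨i, s⟩ : ι) ∈ a.toFinset ↔ i = (0 : Fin 1).succ := by
    rw [List.mem_toFinset, ha, List.mem_map]
    constructor
    · rintro ⟨j, _, hj⟩
      exact (congrArg Sigma.fst hj).symm
    · rintro rfl
      exact ⟨s, List.mem_finRange s, rfl⟩
  have hn : (p ++ q ++ a).Nodup := by
    rw [hpq, List.nodup_append]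
    refine ⟨(List.nodup_finRange _).map he0, (List.nodup_finRange _).map he1, ?_⟩
    simp only [ha, List.mem_map]
    rintro x ⟨i, _, rfl⟩ y ⟨j, _, rfl⟩ h
    exact absurd (congrArg Sigma.fst h) (by simp [e0, e1])
  have hmem : ∀ i : ι, i ∈ p ++ q ++ a := by
    rintro ⟨i, s⟩
    rw [hpq, List.mem_append]
    refine Fin.cases (motive := fun i => ∀ s : Fin (α i), (⟨i, s⟩ : ι) ∈ _ ∨ (⟨i, s⟩ : ι) ∈ _) ?_ ?_ i s
    · intro s
      exact Or.inl (List.mem_map.mpr ⟨s, List.mem_finRange s, rfl⟩)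
    · intro i s
      obtain rfl := Subsingleton.elim i 0
      exact Or.inr (List.mem_map.mpr ⟨s, List.mem_finRange s, rfl⟩)
  have hMV : ∀ i j, (A.modes hA).C (u' i) (u' j) ≤ M i j := fun i j => B.bound_left hA hB _ _
  have hMW : ∀ i j, (B.modes hB).C (u' i) (u' j) ≤ M i j := fun i j => B.bound_right hA hB _ _
  obtain ⟨N, hN⟩ := B.exists_num w hA hB hw0 hwD u' M hMV hMW φ hφ hn hmem
  refine ⟨⟨N, M⟩, fun _ _ => le_rfl, ?_⟩
  intro z ζ hz0 hz01 hz1 _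
  set cen := cenS a.toFinset (ζ 0) with hcen
  have hc0 (j) : cen (e0 j) = 0 := by
    rw [hcen, cenS, if_neg]
    rw [hma]
    exact (Fin.succ_ne_zero _).symm
  have hc1 (j) : cen (e1 j) = ζ 0 := by
    rw [hcen, cenS, if_pos]
    rw [hma]
  let x : ι → ℂ := fun q => z q.1 q.2 - cen q
  have hreg : Region cen x (p ++ q ++ a) := by
    unfold Region
    rw [hpq, List.pairwise_append]
    refine ⟨?_, ?_, ?_⟩
    · rw [List.pairwise_map]
      refine (List.pairwise_lt_finRange _).imp fun {i j} hij => ?_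
      simp only [x, hc0, sub_zero, norm_zero, add_zero]
      exact hz0 i j hij
    · rw [ha, List.pairwise_map]
      refine (List.pairwise_lt_finRange _).imp fun {i j} hij => ?_
      simp only [x, hc1, sub_self, norm_zero, add_zero]
      exact hz1 0 i j hij
    · simp only [ha, List.mem_map]
      rintro _ ⟨i, _, rfl⟩ _ ⟨j, _, rfl⟩
      simp only [x, hc0, hc1, sub_zero]
      rw [add_comm]
      exact hz01 i 0 j
  have h := (B.chain w hA hB hw0 hwD u' M hMV hMW φ hφ hn hmem hN (ζ 0) x hreg).equiv
    (Equiv.piCurry (fun (i : Fin (1+1)) (_ : Fin (α i)) => ℤ)).symm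
  convert h using 1
  · funext K
    set K' : ι → ℤ := (Equiv.piCurry (fun (i : Fin (1+1)) (_ : Fin (α i)) => ℤ)).symm K with hK'
    rw [mul_assoc]
    congr 1
    · have e : (fun j : Fin (α 0) => B.gr.ext (fun x =>
          if (j : ℕ) < l then B.YL (u 0 j) x (K 0 j) else B.YsR (u 0 j) x (K 0 j))) =
          fun j : Fin (α 0) => B.gr.ext
            (⇑(B.outOp hB ((j : ℕ) < l) (u' (e0 j)) (K' (e0 j)))) := by
        funext j
        congr 1
        funext y
        unfold Bimod.outOp
        split_ifs <;> rfl
      rw [e, B.gr.pair_compApply _ _ (fun j => B.outOp_shift hB _ _ _) hφ,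
        ← B.outer_eq hB u' φ (α 0) l e0 K', B.pair_cochain w hB hwD Φ hΦ
          (B.outer_dual hB u' M hMW φ hφ p q K')]
      unfold Bimod.coefZ
      congr 1
      refine (compApply_eq (α (0 : Fin 1).succ) (fun s => (A.modes hA).L (u' (e1 s)) (K' (e1 s))) A.vac).trans ?_
      unfold MOSVA.wordL word
      rw [ha, List.map_map]
      rfl
    · unfold mono
      rw [Fintype.prod_sigma]
      refine Eq.symm ((Fin.prod_univ_succ (n := 1) _).trans ?_)
      refine congrArg₂ (· * ·) ?_ ?_
      · apply Finset.prod_congr rfl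
        intro j _
        have e : x ⟨0, j⟩ = z 0 j := by
          simp only [x]
          rw [show cen ⟨0, j⟩ = 0 from hc0 j, sub_zero]
        rw [e]
        rfl
      · apply Finset.prod_congr rfl
        intro i _
        obtain rfl := Subsingleton.elim i 0
        apply Finset.prod_congr rfl
        intro j _
        have e : x ⟨(0 : Fin 1).succ, j⟩ = z (0 : Fin 1).succ j - ζ 0 := by
          simp only [x]
          rw [show cen ⟨(0 : Fin 1).succ, j⟩ = ζ 0 from hc1 j]
        rw [e]
        rfl
  · have hx : (fun i => x i + cenS a.toFinset (ζ 0) i) = fun q => z q.1 q.2 := by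
      funext i
      exact sub_add_cancel _ _
    rw [hx]
    unfold DiagRatFn.eval
    rw [eval_den]

end Main

end

section

section Main

theorem AbsConvTo.comp_inj {κ κ' : Type*} {f : κ → ℂ} {s : ℂ} (h : AbsConvTo f s) {g : κ' → κ}
    (hg : Function.Injective g) (h0 : ∀ x, x ∉ Set.range g → f x = 0) : AbsConvTo (f ∘ g) s :=
  ⟨h.1.comp_injective hg, (hg.hasSum_iff h0).mpr h.2⟩

theorem mergeAt_fin_one {X : Type*} (f : Fin 2 → X) (a : X) : mergeAt (0 : Fin 1) f a = fun _ => a := by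
  funext i
  obtain rfl := Subsingleton.elim i 0
  rfl

theorem DiagRatFn.eval_eq_of_annuli (R : DiagRatFn (Fin 2)) (N : MvPolynomial (Fin 2) ℂ)
    (M : Fin 2 → Fin 2 → ℕ)
    (h : ∀ z : Fin 2 → ℂ, Conf z → 0 < ‖z 1‖ → ‖z 1‖ < ‖z 0‖ →
      R.eval z = MvPolynomial.eval z N / MvPolynomial.eval z (den M))
    (z : Fin 2 → ℂ) (hz : Conf z) :
    R.eval z = MvPolynomial.eval z N / MvPolynomial.eval z (den M) := by
  have hp : R.num * den M = N * den R.b := by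
    refine poly_eq_of_annuli _ _ fun z₁ z₂ h2 h12 => ?_
    have hc : Conf ![z₁, z₂] := conf_two (by rintro rfl; exact lt_irrefl _ h12)
    have := h ![z₁, z₂] hc h2 h12
    rw [DiagRatFn.eval, ← eval_den, div_eq_div_iff (eval_den_ne_zero _ _ hc) (eval_den_ne_zero _ _ hc)] at this
    rw [map_mul, map_mul, this]
  rw [DiagRatFn.eval, ← eval_den, div_eq_div_iff (eval_den_ne_zero _ _ hz) (eval_den_ne_zero _ _ hz),
    ← map_mul, ← map_mul, hp]

theorem DiagRatFn.eval_eq_of_annuli_swap (R : DiagRatFn (Fin 2)) (N : MvPolynomial (Fin 2) ℂ)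
    (M : Fin 2 → Fin 2 → ℕ)
    (h : ∀ z : Fin 2 → ℂ, Conf z → 0 < ‖z 0‖ → ‖z 0‖ < ‖z 1‖ →
      R.eval z = MvPolynomial.eval z N / MvPolynomial.eval z (den M))
    (z : Fin 2 → ℂ) (hz : Conf z) :
    R.eval z = MvPolynomial.eval z N / MvPolynomial.eval z (den M) := by
  have hp : R.num * den M = N * den R.b := by
    apply MvPolynomial.rename_injective _ (Equiv.swap (0 : Fin 2) 1).injective
    refine poly_eq_of_annuli _ _ fun z₁ z₂ h2 h12 => ?_
    have hs : ![z₁, z₂] ∘ Equiv.swap (0 : Fin 2) 1 = ![z₂, z₁] := by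
      funext i
      fin_cases i <;> simp
    have hc : Conf ![z₂, z₁] := conf_two (by rintro rfl; exact lt_irrefl _ h12)
    have := h ![z₂, z₁] hc h2 h12
    rw [DiagRatFn.eval, ← eval_den, div_eq_div_iff (eval_den_ne_zero _ _ hc) (eval_den_ne_zero _ _ hc)] at this
    rw [MvPolynomial.eval_rename, MvPolynomial.eval_rename, hs, map_mul, map_mul, this]
  rw [DiagRatFn.eval, ← eval_den, div_eq_div_iff (eval_den_ne_zero _ _ hz) (eval_den_ne_zero _ _ hz),
    ← map_mul, ← map_mul, hp]

variable {V : Type*} [AddCommGroup V] [Module ℂ V]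
variable {W : Type*} [AddCommGroup W] [Module ℂ W] {A : MOSVA V}
variable (B : Bimod A W) (w : W) (hA : A.PoleOrder) (hB : B.PoleOrder)
  (hw0 : B.gr.proj 0 w = w) (hwD : B.DW w = 0)
  (Φ : (Fin 1 → V) → (Fin 1 → ℂ) → B.gr.Comp)
  (hΦ : ∀ (v : Fin 1 → V) (φ : W →ₗ[ℂ] ℂ), InGradedDual B.gr.proj φ → ∀ z : Fin 1 → ℂ,
    AbsConvTo (fun k : ℤ => φ (B.YL (v 0) w k - B.YsR (v 0) w k) * z 0 ^ (-k - 1))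
      (B.gr.pair φ (Φ v z)))

section
variable (v : Fin 2 → V) (M : Fin 2 → Fin 2 → ℕ)
  (hMV : ∀ i j, (A.modes hA).C (v i) (v j) ≤ M i j)
  (hMW : ∀ i j, (B.modes hB).C (v i) (v j) ≤ M i j)
  {φ : W →ₗ[ℂ] ℂ} (hφ : InGradedDual B.gr.proj φ) {N : MvPolynomial (Fin 2) ℂ}

include hw0 hwD hΦ hMV hMW hφ in
theorem Bimod.left_series (hN : act (den M) (B.coef w hA hB v φ [0] [] [1]) = fam N) (z : Fin 2 → ℂ)
    (hz : ‖z 1‖ < ‖z 0‖) :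
    AbsConvTo (fun k : ℤ => B.gr.pair φ (B.gr.ext (fun x => B.YL (v 0) x k)
        (Φ (fun _ => v 1) fun _ => z 1)) * z 0 ^ (-k - 1))
      (MvPolynomial.eval z N / MvPolynomial.eval z (den M)) := by
  have hreg : Region (cenS ([1] : List (Fin 2)).toFinset (z 1)) ![z 0, 0] ([0] ++ [] ++ [1]) := by
    simpa [Region, cenS] using hz
  have h := B.chain w hA hB hw0 hwD v M hMV hMW φ hφ (by decide) (by decide) hN (z 1) _ hreg
  have he : (fun i => ![z 0, 0] i + cenS ([1] : List (Fin 2)).toFinset (z 1) i) = z := by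
    funext i
    fin_cases i <;> simp [cenS]
  rw [he] at h
  have h' := h.comp_inj (g := fun k : ℤ => ![k, -1])
    (fun a b hab => by simpa using congrFun hab 0) ?_
  · convert h' using 1
    funext k
    rw [Function.comp_apply, mono, Fin.prod_univ_two, show (fun x => B.YL (v 0) x k) =
      ⇑(B.outOp hB True (v 0) k) from rfl]
    obtain ⟨S, hS, hO⟩ := B.outOp_shift hB True (v 0) k
    rw [B.gr.pair_ext hφ hS _ hO, B.pair_cochain w hB hwD Φ hΦ (hO.dual hS hφ)]
    have e1 : A.wordL hA v [1] ![k, -1] A.vac = v 1 := A.creation_lim (v 1)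
    unfold Bimod.coefZ
    rw [e1]
    simp
    left
    rfl
  · intro K hK
    have h1 : K 1 ≠ -1 := by
      intro h1
      apply hK
      refine ⟨K 0, ?_⟩
      funext i
      fin_cases i
      · rfl
      · exact h1.symm
    rw [mono, Fin.prod_univ_two]
    simp only [Matrix.cons_val_one, Matrix.cons_val_zero]
    rw [zero_zpow _ (by omega), mul_zero, mul_zero]

include hw0 hwD hΦ hMV hMW hφ in
theorem Bimod.right_series (hN : act (den M) (B.coef w hA hB v φ [] [1] [0]) = fam N) (z : Fin 2 → ℂ)
    (hz : ‖z 0‖ < ‖z 1‖) :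
    AbsConvTo (fun k : ℤ => B.gr.pair φ (B.gr.ext (fun x => B.YsR (v 1) x k)
        (Φ (fun _ => v 0) fun _ => z 0)) * z 1 ^ (-k - 1))
      (MvPolynomial.eval z N / MvPolynomial.eval z (den M)) := by
  have hreg : Region (cenS ([0] : List (Fin 2)).toFinset (z 0)) ![0, z 1] ([] ++ [1] ++ [0]) := by
    simpa [Region, cenS] using hz
  have h := B.chain w hA hB hw0 hwD v M hMV hMW φ hφ (by decide) (by decide) hN (z 0) _ hreg
  have he : (fun i => ![0, z 1] i + cenS ([0] : List (Fin 2)).toFinset (z 0) i) = z := by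
    funext i
    fin_cases i <;> simp [cenS]
  rw [he] at h
  have h' := h.comp_inj (g := fun k : ℤ => ![-1, k])
    (fun a b hab => by simpa using congrFun hab 1) ?_
  · convert h' using 1
    funext k
    rw [Function.comp_apply, mono, Fin.prod_univ_two, show (fun x => B.YsR (v 1) x k) =
      ⇑(B.outOp hB False (v 1) k) from rfl]
    obtain ⟨S, hS, hO⟩ := B.outOp_shift hB False (v 1) k
    rw [B.gr.pair_ext hφ hS _ hO, B.pair_cochain w hB hwD Φ hΦ (hO.dual hS hφ)]
    have e1 : A.wordL hA v [0] ![-1, k] A.vac = v 0 := A.creation_lim (v 0)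
    unfold Bimod.coefZ
    rw [e1]
    simp
    left
    rfl
  · intro K hK
    have h1 : K 0 ≠ -1 := by
      intro h1
      apply hK
      refine ⟨K 1, ?_⟩
      funext i
      fin_cases i
      · exact h1.symm
      · rfl
    rw [mono, Fin.prod_univ_two]
    simp only [Matrix.cons_val_one, Matrix.cons_val_zero]
    rw [zero_zpow _ (by omega), zero_mul, mul_zero]

include hw0 hwD hΦ hMV hMW hφ in
theorem Bimod.circ_series (hN : act (den M) (B.coef w hA hB v φ [] [] [0, 1]) = fam N) (z : Fin 2 → ℂ)
    (hz : ‖z 1‖ < ‖z 0‖) :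
    AbsConvTo (fun k : ℤ × ℤ => B.gr.pair φ
        (Φ (fun _ => A.Y (v 0) (A.Y (v 1) A.vac k.2) k.1) fun _ => 0) * z 0 ^ (-k.1 - 1) * z 1 ^ (-k.2 - 1))
      (MvPolynomial.eval z N / MvPolynomial.eval z (den M)) := by
  have hreg : Region (cenS ([0, 1] : List (Fin 2)).toFinset 0) z ([] ++ [] ++ [0, 1]) := by
    simpa [Region, cenS] using hz
  have h := B.chain w hA hB hw0 hwD v M hMV hMW φ hφ (by decide) (by decide) hN 0 _ hreg
  have he : (fun i => z i + cenS ([0, 1] : List (Fin 2)).toFinset 0 i) = z := by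
    funext i
    fin_cases i <;> simp [cenS]
  rw [he] at h
  convert h.equiv (finTwoArrowEquiv ℤ).symm using 1
  funext k
  rw [B.pair_cochain w hB hwD Φ hΦ hφ, mono, Fin.prod_univ_two, mul_assoc]
  rfl

include hw0 hwD hMV hMW hφ in
theorem Bimod.num_cancel {NL NC NR : MvPolynomial (Fin 2) ℂ}
    (hL : act (den M) (B.coef w hA hB v φ [0] [] [1]) = fam NL)
    (hC : act (den M) (B.coef w hA hB v φ [] [] [0, 1]) = fam NC)
    (hR : act (den M) (B.coef w hA hB v φ [] [1] [0]) = fam NR) (z : Fin 2 → ℂ) :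
    MvPolynomial.eval z NL - MvPolynomial.eval z NC + MvPolynomial.eval z NR = 0 := by
  rw [B.act_coef w hA hB hw0 hwD v M hMV hMW φ hφ (by decide)] at hL hC hR
  have hsum : fam NL + fam NR = fam NC := by
    rw [← hL, ← hC, ← hR]
    exact sub_add_sub_cancel _ _ _
  have h1 := (fam_conv NL z).2.add (fam_conv NR z).2
  have h2 := (fam_conv NC z).2
  have h3 := h1.unique (f := fun K => fam NL K * mono z K + fam NR K * mono z K) (a₂ := MvPolynomial.eval z NC) (by
    convert h2 using 2 with K
    rw [← hsum, Pi.add_apply, add_mul])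
  rw [sub_add_eq_add_sub, h3, sub_self]
end

include hw0 hwD hA hB hΦ in
theorem Bimod.delta_eq_zero (Θ : (Fin 2 → V) → (Fin 2 → ℂ) → B.gr.Comp) (hΘ : IsDelta A B Φ Θ)
    (v : Fin 2 → V) (z : Fin 2 → ℂ) (hz : Conf z) {φ : W →ₗ[ℂ] ℂ} (hφ : InGradedDual B.gr.proj φ) :
    B.gr.pair φ (Θ v z) = 0 := by
  obtain ⟨gL, gR, gC, ⟨hLW, hL⟩, ⟨hRW, hR⟩, hC, hsum⟩ := hΘ
  obtain ⟨hCW, hC⟩ := hC 0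
  let M : Fin 2 → Fin 2 → ℕ := fun i j => B.bound hA hB (v i) (v j)
  have hMV : ∀ i j, (A.modes hA).C (v i) (v j) ≤ M i j := fun i j => B.bound_left hA hB _ _
  have hMW : ∀ i j, (B.modes hB).C (v i) (v j) ≤ M i j := fun i j => B.bound_right hA hB _ _
  obtain ⟨NL, hNL⟩ := B.exists_num w hA hB hw0 hwD v M hMV hMW φ hφ (p := [0]) (q := []) (a := [1])
    (by decide) (by decide)
  obtain ⟨NC, hNC⟩ := B.exists_num w hA hB hw0 hwD v M hMV hMW φ hφ (p := []) (q := []) (a := [0, 1])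
    (by decide) (by decide)
  obtain ⟨NR, hNR⟩ := B.exists_num w hA hB hw0 hwD v M hMV hMW φ hφ (p := []) (q := [1]) (a := [0])
    (by decide) (by decide)
  have eL : B.gr.pair φ (gL v z) = MvPolynomial.eval z NL / MvPolynomial.eval z (den M) := by
    obtain ⟨R, hR⟩ := (hLW v).1 φ hφ
    rw [hR z hz]
    refine R.eval_eq_of_annuli NL M (fun y hy h1 h10 => ?_) z hz
    rw [← hR y hy]
    have e : Fin.cons (y 0) (fun _ : Fin 1 => y 1) = y := by
      funext i; fin_cases i <;> rfl
    have h := hL v φ hφ (y 0) (fun _ => y 1) (by rwa [e]) (fun _ => h10) (fun _ => h1)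
    rw [e, show Fin.tail v = fun _ => v 1 by funext i; fin_cases i; rfl] at h
    exact h.2.unique (B.left_series w hA hB hw0 hwD Φ hΦ v M hMV hMW hφ hNL y h10).2
  have eR : B.gr.pair φ (gR v z) = MvPolynomial.eval z NR / MvPolynomial.eval z (den M) := by
    obtain ⟨R, hR'⟩ := (hRW v).1 φ hφ
    rw [hR' z hz]
    refine R.eval_eq_of_annuli_swap NR M (fun y hy h1 h10 => ?_) z hz
    rw [← hR' y hy]
    have e : (Fin.snoc (fun _ : Fin 1 => y 0) (y 1) : Fin 2 → ℂ) = y := by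
      funext i; fin_cases i <;> rfl
    have h := hR v φ hφ (y 1) (fun _ => y 0) (by rwa [e]) (fun _ => h10) (fun _ => h1)
    rw [e, show Fin.init v = fun _ => v 0 by funext i; fin_cases i; rfl] at h
    exact h.2.unique (B.right_series w hA hB hw0 hwD Φ hΦ v M hMV hMW hφ hNR y h10).2
  have eC : B.gr.pair φ (gC 0 v z) = MvPolynomial.eval z NC / MvPolynomial.eval z (den M) := by
    obtain ⟨R, hR⟩ := (hCW v).1 φ hφ
    rw [hR z hz]
    refine R.eval_eq_of_annuli NC M (fun y hy h1 h10 => ?_) z hz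
    rw [← hR y hy]
    have h := hC v φ hφ y 0 hy (fun i j hij => absurd (Subsingleton.elim i j) hij)
      (by simpa using h10) (by simpa using h1) (by
        intro j h0 h1
        fin_cases j
        · exact absurd rfl h0
        · exact absurd rfl h1)
    have h2 := B.circ_series w hA hB hw0 hwD Φ hΦ v M hMV hMW hφ hNC y h10
    refine h.2.unique ?_
    convert h2.2 using 2 with k
    · rw [mergeAt_fin_one, mergeAt_fin_one, sub_zero, sub_zero]
      rfl
  rw [hsum, B.gr.pair_add hφ, B.gr.pair_add hφ, Fin.sum_univ_one, B.gr.pair_smul hφ,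
    B.gr.pair_smul hφ, eL, eC, eR]
  have := B.num_cancel w hA hB hw0 hwD v M hMV hMW hφ hNL hNC hNR z
  calc _ = (MvPolynomial.eval z NL - MvPolynomial.eval z NC + MvPolynomial.eval z NR) /
        MvPolynomial.eval z (den M) := by simp; ring
    _ = 0 := by rw [this, zero_div]

end Main

end

section

section Main
variable {V : Type*} [AddCommGroup V] [Module ℂ V]
variable {W : Type*} [AddCommGroup W] [Module ℂ W] {A : MOSVA V}
variable (B : Bimod A W) (w : W) (hA : A.PoleOrder) (hB : B.PoleOrder)
  (hw0 : B.gr.proj 0 w = w) (hwD : B.DW w = 0)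

theorem Bimod.chi_apply (ζ : ℂ) (ψ : W →ₗ[ℂ] ℂ) (n0 : ℕ) (h : ∀ n, n0 ≤ n → ψ ∘ₗ B.DW ^ n = 0) (v : V) :
    B.chi w ζ ψ v = ∑ n ∈ Finset.range n0, ζ ^ n * ((n.factorial : ℂ)⁻¹ * ψ ((B.DW ^ n) (B.fD w v))) := by
  rw [B.chi_eq_sum w ζ ψ n0 h, LinearMap.sum_apply]
  refine Finset.sum_congr rfl fun n _ => ?_
  simp only [LinearMap.smul_apply, LinearMap.comp_apply, smul_eq_mul]
  ring

include hwD in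
theorem Bimod.fD_D_one (hA : A.PoleOrder) (hB : B.PoleOrder) (v : V) :
    B.fD w (A.D v) = B.DW (B.fD w v) := by
  have h := B.fD_D w hA hwD hB 1 v
  rw [pow_one, pow_one] at h
  exact h

include hwD in
theorem Bimod.chi_hasDerivAt (hA : A.PoleOrder) (hB : B.PoleOrder) {φ : W →ₗ[ℂ] ℂ}
    (hφ : InGradedDual B.gr.proj φ) (v : V) (ζ : ℂ) :
    HasDerivAt (fun t => B.chi w t φ v) (B.chi w ζ φ (A.D v)) ζ := by
  obtain ⟨n0, h0⟩ := (B.modes hB).exists_D_vanish hφ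
  have h1 : (fun t => B.chi w t φ v) = fun t => ∑ n ∈ Finset.range (n0 + 1),
      t ^ n * ((n.factorial : ℂ)⁻¹ * φ ((B.DW ^ n) (B.fD w v))) := by
    funext t
    exact B.chi_apply w t φ (n0 + 1) (fun n hn => h0 n (by omega)) v
  rw [h1, B.chi_apply w ζ φ n0 h0]
  have h2 := HasDerivAt.fun_sum (u := Finset.range (n0 + 1)) (x := ζ) fun n _ =>
    (hasDerivAt_pow n ζ).mul_const ((n.factorial : ℂ)⁻¹ * φ ((B.DW ^ n) (B.fD w v)))
  refine h2.congr_deriv ?_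
  rw [Finset.sum_range_succ']
  simp only [Nat.cast_zero, zero_mul, add_zero]
  refine Finset.sum_congr rfl fun n _ => ?_
  rw [B.fD_D_one w hwD hA hB, pow_succ, Module.End.mul_apply, Nat.add_sub_cancel, Nat.factorial_succ]
  have : (n.factorial : ℂ) ≠ 0 := Nat.cast_ne_zero.mpr n.factorial_ne_zero
  have : ((n : ℂ) + 1) ≠ 0 := by exact_mod_cast Nat.succ_ne_zero n
  push_cast
  field_simp

include hwD in
theorem Bimod.chi_DW (hA : A.PoleOrder) (hB : B.PoleOrder) {φ : W →ₗ[ℂ] ℂ}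
    (hφ : InGradedDual B.gr.proj φ) (v : V) (ζ : ℂ) :
    B.chi w ζ (φ ∘ₗ B.DW) v = B.chi w ζ φ (A.D v) := by
  obtain ⟨n0, h0⟩ := (B.modes hB).exists_D_vanish hφ
  have h1 : ∀ n, n0 ≤ n → (φ ∘ₗ B.DW) ∘ₗ B.DW ^ n = 0 := by
    intro n hn
    rw [LinearMap.comp_assoc, ← Module.End.mul_eq_comp, ← pow_succ']
    exact h0 (n + 1) (by omega)
  rw [B.chi_apply w ζ φ n0 h0, B.chi_apply w ζ _ n0 h1]
  refine Finset.sum_congr rfl fun n _ => ?_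
  rw [B.fD_D_one w hwD hA hB, ← Module.End.mul_apply (B.DW ^ n), ← pow_succ, pow_succ',
    LinearMap.comp_apply, Module.End.mul_apply]

include hw0 in
theorem Bimod.fD_shift : IsShift A.gr.toC B.gr {0} (B.fD w) := by
  intro m n x hm
  rw [Bimod.fD, LinearMap.sub_apply, map_sub, B.fL_shift w hw0 m n x hm,
    B.fR_shift w hw0 m n x hm, sub_zero]

include hw0 hB in
theorem Bimod.proj_DW_fD (n : ℤ) (k : ℕ) (v : V) (m : ℂ) (hm : m ≠ n + k) :
    B.gr.proj m ((B.DW ^ k) (B.fD w (A.gr.proj n v))) = 0 := by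
  have h := ((B.modes hB).wtD.pow k).comp (B.fD_shift w hw0)
  have := h m n v (by
    rintro ⟨a, rfl, b, rfl, hab⟩
    apply hm
    simp only [zero_add] at hab
    rw [hab]
    ring)
  rwa [ZGrading.toC_proj] at this

/-- Twisting a functional by `c ^ d`. -/
def CGrading.dualZd (G : CGrading W) (c : ℂ) {φ : W →ₗ[ℂ] ℂ} (hφ : InGradedDual G.proj φ) : W →ₗ[ℂ] ℂ :=
  ∑ m ∈ hφ.supp, c ^ m • (φ ∘ₗ G.proj m)

theorem CGrading.dualZd_mem (G : CGrading W) (c : ℂ) {φ : W →ₗ[ℂ] ℂ} (hφ : InGradedDual G.proj φ) :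
    InGradedDual G.proj (G.dualZd c hφ) :=
  InGradedDual.sum _ _ fun m _ => (G.dual_proj φ m).smul _

theorem CGrading.dualZd_apply (G : CGrading W) (c : ℂ) {φ : W →ₗ[ℂ] ℂ} (hφ : InGradedDual G.proj φ)
    (n : ℂ) (x : W) (hx : G.proj n x = x) : G.dualZd c hφ x = c ^ n * φ x := by
  classical
  have h : ∀ m, φ (G.proj m x) = if m = n then φ x else 0 := by
    intro m
    rw [← hx, G.proj_proj]
    split_ifs <;> simp
  simp only [CGrading.dualZd, LinearMap.sum_apply, LinearMap.smul_apply, LinearMap.comp_apply, h,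
    smul_eq_mul, mul_ite, mul_zero, Finset.sum_ite_eq', hφ.mem_supp]
  split_ifs with hn
  · rfl
  · push Not at hn
    rw [← hx, show φ (G.proj n x) = 0 from LinearMap.congr_fun hn x, mul_zero]

theorem CGrading.pair_zd (G : CGrading W) (c : ℂ) {φ : W →ₗ[ℂ] ℂ} (hφ : InGradedDual G.proj φ)
    (f : G.Comp) : G.pair φ (G.zd c f) = G.pair (G.dualZd c hφ) f := by
  unfold CGrading.pair
  refine finsum_congr fun n => ?_
  rw [G.dualZd_apply c hφ n _ (f.2 n)]
  exact map_smul φ _ _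

include hw0 in
theorem Bimod.chi_zd (hB : B.PoleOrder) {φ : W →ₗ[ℂ] ℂ} (hφ : InGradedDual B.gr.proj φ) (c : ℂ) (hc : c ≠ 0) (ζ : ℂ)
    (v : V) : B.chi w ζ (B.gr.dualZd c hφ) v = B.chi w (c * ζ) φ (A.gr.zd c v) := by
  have hfin : (Function.support fun n : ℤ => c ^ n • A.gr.proj n v).Finite := by
    refine (A.gr.proj_finite v).subset fun n hn h0 => hn ?_
    show c ^ n • A.gr.proj n v = 0
    rw [show A.gr.proj n v = 0 from h0, smul_zero]
  rw [ZGrading.zd, map_finsum_of_finite _ hfin]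
  conv_lhs => rw [← A.gr.proj_sum v, map_finsum_of_finite _ (A.gr.proj_finite v)]
  refine finsum_congr fun n => ?_
  obtain ⟨n1, h1⟩ := (B.modes hB).exists_D_vanish hφ
  obtain ⟨n2, h2⟩ := (B.modes hB).exists_D_vanish (B.gr.dualZd_mem c hφ)
  rw [map_smul, B.chi_apply w _ _ (max n1 n2) (fun k hk => h1 k (le_of_max_le_left hk)),
    B.chi_apply w _ _ (max n1 n2) (fun k hk => h2 k (le_of_max_le_right hk)), Finset.smul_sum]
  refine Finset.sum_congr rfl fun k _ => ?_
  rw [B.gr.dualZd_apply c hφ (n + k)]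
  · rw [Complex.cpow_add _ _ hc, Complex.cpow_intCast, Complex.cpow_natCast, smul_eq_mul, mul_pow]
    ring
  · conv_rhs => rw [← B.gr.proj_sum ((B.DW ^ k) (B.fD w (A.gr.proj n v)))]
    exact (finsum_eq_single _ _ fun m hm => B.proj_DW_fD w hB hw0 n k v m hm).symm

variable (Φ : (Fin 1 → V) → (Fin 1 → ℂ) → B.gr.Comp)
  (hΦ : ∀ (v : Fin 1 → V) (φ : W →ₗ[ℂ] ℂ), InGradedDual B.gr.proj φ → ∀ z : Fin 1 → ℂ,
    AbsConvTo (fun k : ℤ => φ (B.YL (v 0) w k - B.YsR (v 0) w k) * z 0 ^ (-k - 1))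
      (B.gr.pair φ (Φ v z)))

include hwD hB hΦ in
theorem Bimod.cochain_multilinear : IsMultilinear Φ := by
  refine ⟨fun v i x y => ?_, fun v i c x => ?_⟩ <;> funext z <;> refine B.gr.comp_ext fun φ hφ => ?_ <;>
    obtain rfl := Subsingleton.elim i 0
  · rw [Pi.add_apply, B.gr.pair_add hφ]
    simp only [B.pair_cochain w hB hwD Φ hΦ hφ, Function.update_self, map_add]
  · rw [Pi.smul_apply, B.gr.pair_smul hφ]
    simp only [B.pair_cochain w hB hwD Φ hΦ hφ, Function.update_self, map_smul, smul_eq_mul]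

theorem offDiag_fin_one : (Finset.univ : Finset (Fin 1)).offDiag = ∅ :=
  Finset.eq_empty_of_forall_notMem fun _ hq =>
    (Finset.mem_offDiag.mp hq).2.2 (Subsingleton.elim _ _)

include hwD hB hΦ in
theorem Bimod.cochain_wTilde (v : Fin 1 → V) : B.gr.WTilde (Φ v) := by
  refine ⟨fun φ hφ => ?_, fun _ _ => 0,
    fun k => (((k 0).factorial : ℂ)⁻¹) • (B.DW ^ k 0) (B.fD w (v 0)), fun φ hφ => ?_⟩
  · obtain ⟨n0, h0⟩ := (B.modes hB).exists_D_vanish hφ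
    refine ⟨⟨∑ n ∈ Finset.range n0, MvPolynomial.X 0 ^ n *
      MvPolynomial.C ((n.factorial : ℂ)⁻¹ * φ ((B.DW ^ n) (B.fD w (v 0)))), fun _ _ => 0⟩, fun z _ => ?_⟩
    rw [B.pair_cochain w hB hwD Φ hΦ hφ, B.chi_apply w _ _ n0 h0, DiagRatFn.eval, offDiag_fin_one]
    simp
  · obtain ⟨n0, h0⟩ := (B.modes hB).exists_D_vanish hφ
    have hv : ∀ n, n0 ≤ n → φ ((B.DW ^ n) (B.fD w (v 0))) = 0 := fun n hn =>
      LinearMap.congr_fun (h0 n hn) _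
    refine ⟨((Set.finite_Iio n0).image fun n (_ : Fin 1) => n).subset fun k hk => ?_, fun z _ => ?_⟩
    · refine ⟨k 0, ?_, funext fun i => by rw [Subsingleton.elim i 0]⟩
      by_contra hcon
      exact hk (by
        show φ (_ • _) = 0
        rw [map_smul, hv _ (not_lt.mp hcon), smul_zero])
    · rw [offDiag_fin_one, Finset.prod_empty, one_mul, B.pair_cochain w hB hwD Φ hΦ hφ,
        B.chi_apply w _ _ n0 h0, ← finsum_comp_equiv (Equiv.funUnique (Fin 1) ℕ).symm,
        finsum_eq_sum_of_support_subset (s := Finset.range n0)]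
      · refine Finset.sum_congr rfl fun n _ => ?_
        rw [map_smul, Fin.prod_univ_one, smul_eq_mul, mul_comm]
        rfl
      · intro n hn
        rw [Finset.coe_range, Set.mem_Iio]
        by_contra hcon
        apply hn
        show φ (_ • (B.DW ^ n) _) * _ = 0
        rw [map_smul, hv _ (not_lt.mp hcon), smul_zero, zero_mul]

include hwD hA hB hΦ in
theorem Bimod.cochain_dDeriv : DDerivProp A B Φ := by
  refine ⟨fun v i φ hφ z _ => ?_, fun v φ hφ z _ => ?_⟩
  · obtain rfl := Subsingleton.elim i 0
    simp only [B.pair_cochain w hB hwD Φ hΦ hφ, Function.update_self]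
    exact B.chi_hasDerivAt w hwD hA hB hφ _ _
  · have hO : IsShift B.gr B.gr {1} B.DW := (B.modes hB).wtD
    rw [B.gr.pair_ext hφ (Set.finite_singleton _) B.DW hO,
      B.pair_cochain w hB hwD Φ hΦ (hO.dual (Set.finite_singleton _) hφ), Fin.sum_univ_one,
      B.pair_cochain w hB hwD Φ hΦ hφ, Function.update_self]
    exact B.chi_DW w hwD hA hB hφ _ _

include hw0 hwD hB hΦ in
theorem Bimod.cochain_dConj : DConjProp A B Φ := by
  intro v φ hφ z c hc _ _
  rw [B.gr.pair_zd c hφ, B.pair_cochain w hB hwD Φ hΦ (B.gr.dualZd_mem c hφ),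
    B.pair_cochain w hB hwD Φ hΦ hφ, B.chi_zd w hw0 hB hφ c hc]

end Main

end

/-- Let `V` be a MOSVA and `W` a `V`-bimodule, both satisfying the
pole-order condition, and let `w ∈ W` be a vacuum-like vector (`w ∈ W_[0]`,
`D_W w = 0`). Let `Φ = δ̂⁰(w)` be the `1`-cochain defined by
`(δ̂⁰(w))(v)(z) = E(Y_W^L(v,z)w − Y_W^{s(R)}(v,z)w)` (pinned down by the requirement
that its pairings be the sums of the corresponding series). Then
`δ̂⁰(w) ∈ Ĉ¹_∞(V,W)` (it lies in `Ĉ¹_m(V,W)` for every `m`), and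
`δ̂¹(δ̂⁰(w)) = 0`: any representative of the coboundary of `Φ` vanishes. -/
theorem statement19 {V : Type*} [AddCommGroup V] [Module ℂ V]
    {W : Type*} [AddCommGroup W] [Module ℂ W]
    (A : MOSVA V) (B : Bimod A W) (hA : A.PoleOrder) (hB : B.PoleOrder)
    (w : W) (hw0 : B.gr.proj 0 w = w) (hwD : B.DW w = 0)
    (Φ : (Fin 1 → V) → (Fin 1 → ℂ) → B.gr.Comp)
    (hΦ : ∀ (v : Fin 1 → V) (φ : W →ₗ[ℂ] ℂ), InGradedDual B.gr.proj φ →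
      ∀ z : Fin 1 → ℂ,
        AbsConvTo (fun k : ℤ => φ (B.YL (v 0) w k - B.YsR (v 0) w k) * z 0 ^ (-k - 1))
          (B.gr.pair φ (Φ v z))) :
    (∀ m : ℕ, IsCochain A B 1 m Φ) ∧
    ∀ Θ : (Fin 2 → V) → (Fin 2 → ℂ) → B.gr.Comp, IsDelta A B Φ Θ →
      ∀ (v : Fin 2 → V) (z : Fin 2 → ℂ), Conf z →
        ∀ φ : W →ₗ[ℂ] ℂ, InGradedDual B.gr.proj φ → B.gr.pair φ (Θ v z) = 0 := by
  exact ⟨fun m => ⟨B.cochain_multilinear w hB hwD Φ hΦ, B.cochain_wTilde w hB hwD Φ hΦ,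
      B.cochain_dDeriv w hA hB hwD Φ hΦ, B.cochain_dConj w hB hw0 hwD Φ hΦ,
      B.composable w hA hB hw0 hwD Φ hΦ m⟩,
     fun Θ hΘ v z hz _ hφ => B.delta_eq_zero w hA hB hw0 hwD Φ hΦ Θ hΘ v z hz hφ⟩

end VA
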